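/- Let 𝔤 be a finite-dimensional complex simple Lie algebra of type E7, and let (e,h,f) be an sl2-triple in 𝔤 such that e is a distinguished nilpotent element which is not regular. Then e satisfies property (P). -/

import Mathlib

open scoped ComplexOrder

/-- The centralizer `𝔤^e = {x ∈ 𝔤 : ⁅x, e⁆ = 0}` of an element `e`, as a Lie subalgebra. -/
def centralizer (L : Type*) [LieRing L] [LieAlgebra ℂ L] (e : L) : LieSubalgebra ℂ L where
  carrier := {x : L | ⁅x, e⁆ = 0}
  add_mem' := fun {a b} ha hb => by
    simp only [Set.mem_setOf_eq] at *
    rw [add_lie, ha, hb, add_zero]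
  zero_mem' := by simp
  smul_mem' := fun c a ha => by
    simp only [Set.mem_setOf_eq] at *
    rw [smul_lie, ha, smul_zero]
  lie_mem' := fun {a b} ha hb => by
    simp only [Set.mem_setOf_eq] at *
    simp [lie_lie, ha, hb]

/-- Membership in the centre `𝔷(𝔤^e)` of the centralizer of `e`:
`v` centralizes `e` and commutes with every element of `𝔤^e`. -/
def InCenterOfCentralizer (L : Type*) [LieRing L] [LieAlgebra ℂ L] (e v : L) : Prop :=
  ⁅v, e⁆ = 0 ∧ ∀ y : L, ⁅y, e⁆ = 0 → ⁅v, y⁆ = 0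

/-- The centre `𝔷(𝔤^e)` of the centralizer of `e`, as a subspace of `L`. -/
def zCenter (L : Type*) [LieRing L] [LieAlgebra ℂ L] (e : L) : Submodule ℂ L where
  carrier := {v : L | ⁅v, e⁆ = 0 ∧ ∀ y : L, ⁅y, e⁆ = 0 → ⁅v, y⁆ = 0}
  add_mem' := fun {a b} ha hb => ⟨by rw [add_lie, ha.1, hb.1, add_zero],
    fun y hy => by rw [add_lie, ha.2 y hy, hb.2 y hy, add_zero]⟩
  zero_mem' := ⟨zero_lie e, fun y _ => zero_lie y⟩
  smul_mem' := fun c a ha => ⟨by rw [smul_lie, ha.1, smul_zero],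
    fun y hy => by rw [smul_lie, ha.2 y hy, smul_zero]⟩

/-- Property (P) for an `sl₂`-triple `(e, h, f)`: for every nonzero `v ∈ 𝔷(𝔤^e)`, the
eigenspace `𝔷_max` of the restriction of `ad h` to `𝔷(𝔤^e)` for its largest eigenvalue is
contained in `[[f, 𝔤^e], v] = {⁅⁅f, x⁆, v⁆ : x ∈ 𝔤^e}`. -/
def PropertyP (L : Type*) [LieRing L] [LieAlgebra ℂ L] (e h f : L) : Prop :=
  ∀ m : ℂ,
    (∃ z : L, z ≠ 0 ∧ InCenterOfCentralizer L e z ∧ ⁅h, z⁆ = m • z) →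
    (∀ m' : ℂ, (∃ z : L, z ≠ 0 ∧ InCenterOfCentralizer L e z ∧ ⁅h, z⁆ = m' • z) → m' ≤ m) →
    ∀ v : L, InCenterOfCentralizer L e v → v ≠ 0 →
      ∀ z : L, InCenterOfCentralizer L e z → ⁅h, z⁆ = m • z →
        ∃ x : L, ⁅x, e⁆ = 0 ∧ ⁅⁅f, x⁆, v⁆ = z

/-- The stabilizer `{x ∈ 𝔮 : ξ(⁅x, y⁆) = 0 for all y ∈ 𝔮}` of a linear functional `ξ`. -/
def coadStab (Q : Type*) [LieRing Q] [LieAlgebra ℂ Q] (ξ : Module.Dual ℂ Q) : Submodule ℂ Q where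
  carrier := {x : Q | ∀ y : Q, ξ ⁅x, y⁆ = 0}
  add_mem' := fun {a b} ha hb y => by rw [add_lie, map_add, ha y, hb y, add_zero]
  zero_mem' := fun y => by rw [zero_lie, map_zero]
  smul_mem' := fun c a ha y => by rw [smul_lie, map_smul, ha y, smul_zero]

/-- The index of a complex Lie algebra:
`ind 𝔮 = min_{ξ ∈ 𝔮*} dim {x ∈ 𝔮 : ξ(⁅x, y⁆) = 0 for all y ∈ 𝔮}`. -/
noncomputable def lieIndex (Q : Type*) [LieRing Q] [LieAlgebra ℂ Q] : ℕ :=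
  ⨅ ξ : Module.Dual ℂ Q, Module.finrank ℂ ↥(coadStab Q ξ)

/-- A nilpotent element `e` is distinguished if the only `x ∈ 𝔤^e` such that `ad x` is a
semisimple endomorphism of `𝔤` is `x = 0`. -/
def IsDistinguished (L : Type*) [LieRing L] [LieAlgebra ℂ L] (e : L) : Prop :=
  ∀ x : L, ⁅x, e⁆ = 0 → (LieAlgebra.ad ℂ L x).IsSemisimple → x = 0

open Module

section ExpDerivation

open NormedSpace Topology

variable {V : Type*} [NormedAddCommGroup V] [NormedSpace ℂ V] [FiniteDimensional ℂ V]

theorem exp_apply_bilinear_of_derivation (B : V →ₗ[ℂ] V →ₗ[ℂ] V) (D : V →L[ℂ] V)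
    (hD : ∀ x y, D (B x y) = B (D x) y + B x (D y)) (x y : V) :
    exp D (B x y) = B (exp D x) (exp D y) := by
  have : CompleteSpace V := FiniteDimensional.complete ℂ V
  let _ : NormedAlgebra ℚ (V →L[ℂ] V) := NormedAlgebra.restrictScalars ℚ ℂ _
  let Bc : V →L[ℂ] V →L[ℂ] V := LinearMap.toContinuousLinearMap
    ((LinearMap.toContinuousLinearMap : (V →ₗ[ℂ] V) ≃ₗ[ℂ] (V →L[ℂ] V)).toLinearMap ∘ₗ B)
  have hBc : ∀ a b, Bc a b = B a b := fun a b => rfl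
  have hd : ∀ (v : V) (t : ℂ), HasDerivAt (fun t : ℂ => exp (t • D) v) (D (exp (t • D) v)) t := by
    intro v t
    have := (hasDerivAt_exp_smul_const' (𝕂 := ℂ) D t).clm_apply (hasDerivAt_const t v)
    simpa using this
  have hd' : ∀ t : ℂ, HasDerivAt (fun t : ℂ => exp (t • (-D))) (-(exp (t • (-D)) * D)) t := by
    intro t
    simpa using hasDerivAt_exp_smul_const (𝕂 := ℂ) (-D) t
  have hg : ∀ t : ℂ, HasDerivAt
      (fun t : ℂ => exp (t • (-D)) (Bc (exp (t • D) x) (exp (t • D) y))) 0 t := by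
    intro t
    have h1 := (Bc.hasFDerivAt.comp_hasDerivAt t (hd x t)).clm_apply (hd y t)
    have h2 := (hd' t).clm_apply h1
    refine HasDerivAt.congr_deriv h2 ?_
    change -(exp (t • (-D)) (D (B (exp (t • D) x) (exp (t • D) y)))) +
      exp (t • (-D)) (B (D (exp (t • D) x)) (exp (t • D) y) +
        B (exp (t • D) x) (D (exp (t • D) y))) = 0
    rw [hD, neg_add_cancel]
  have hconst := is_const_of_deriv_eq_zero (fun t => (hg t).differentiableAt)
    (fun t => (hg t).deriv) 1 0
  simp only [one_smul, zero_smul, exp_zero, one_apply_eq_self, hBc] at hconst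
  rw [← hconst, ← mul_apply_eq_comp, ← exp_add_of_commute]
  · simp
  · exact (Commute.refl D).neg_right

theorem eventually_exists_exp_apply (B : V →ₗ[ℂ] V →ₗ[ℂ] V) (A K : Submodule ℂ V) (s : V)
    (hs : ∀ x, ∃ u ∈ A, ∃ k ∈ K, x = B u s + k) (w : V) :
    ∀ᶠ t : ℂ in 𝓝 0, ∃ u ∈ A, ∃ k ∈ K,
      s + t • w = exp (LinearMap.toContinuousLinearMap (B u)) (s + k) := by
  have : CompleteSpace V := FiniteDimensional.complete ℂ V
  have : CompleteSpace A := FiniteDimensional.complete ℂ A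
  have : CompleteSpace K := FiniteDimensional.complete ℂ K
  let T : (A × K) →L[ℂ] (V →L[ℂ] V) := LinearMap.toContinuousLinearMap
    ((LinearMap.toContinuousLinearMap : (V →ₗ[ℂ] V) ≃ₗ[ℂ] (V →L[ℂ] V)).toLinearMap ∘ₗ B ∘ₗ
      A.subtype ∘ₗ LinearMap.fst ℂ A K)
  let S : (A × K) →L[ℂ] V := LinearMap.toContinuousLinearMap (K.subtype ∘ₗ LinearMap.snd ℂ A K)
  let Φ : A × K → V := fun p => exp (T p) (s + S p)
  have h1 : HasStrictFDerivAt (fun p => exp (T p)) ((1 : (V →L[ℂ] V) →L[ℂ] (V →L[ℂ] V)).comp T)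
      (0 : A × K) := by
    refine HasStrictFDerivAt.comp (g := exp) (f := T) (0 : A × K) ?_ T.hasStrictFDerivAt
    rw [map_zero]
    exact hasStrictFDerivAt_exp_zero
  have h2 : HasStrictFDerivAt (fun p => s + S p) S (0 : A × K) := S.hasStrictFDerivAt.const_add s
  have h3 := h1.clm_apply h2
  have h4 := h3.map_nhds_eq_of_surj (by
    rw [LinearMap.range_eq_top]
    intro x
    obtain ⟨u, hu, k, hk, rfl⟩ := hs x
    refine ⟨(⟨u, hu⟩, ⟨k, hk⟩), ?_⟩
    simp [T, S, add_comm])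
  have h5 : Filter.Tendsto (fun t : ℂ => s + t • w) (𝓝 0) (𝓝 s) := by
    have : Continuous (fun t : ℂ => s + t • w) := by fun_prop
    simpa using this.tendsto 0
  have h6 : Set.range Φ ∈ 𝓝 s := by
    have h7 : Φ 0 = s := by simp [Φ]
    have h8 : Set.range Φ ∈ Filter.map Φ (𝓝 0) := Filter.range_mem_map
    rw [h4] at h8
    simpa using h8
  filter_upwards [h5 h6] with t ht
  obtain ⟨⟨⟨u, hu⟩, ⟨k, hk⟩⟩, hp⟩ := ht
  exact ⟨u, hu, k, hk, hp.symm⟩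

end ExpDerivation

section LieExp

open Topology

variable {L : Type*} [LieRing L] [LieAlgebra ℂ L] [FiniteDimensional ℂ L]

theorem eventually_exists_lieEquiv_apply (A K : Submodule ℂ L) (s : L)
    (hs : ∀ x, ∃ u ∈ A, ∃ k ∈ K, x = ⁅u, s⁆ + k) (w : L) :
    ∀ᶠ t : ℂ in 𝓝 0, ∃ u ∈ A, ∃ k ∈ K, ∃ φ : L ≃ₗ⁅ℂ⁆ L,
      (∀ x, ⁅u, x⁆ = 0 → φ x = x) ∧ s + t • w = φ (s + k) := by
  let ψ := (Module.finBasis ℂ L).equivFun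
  let _ : NormedAddCommGroup L := NormedAddCommGroup.induced L _ ψ.toLinearMap ψ.injective
  let _ : NormedSpace ℂ L := NormedSpace.induced ℂ L _ ψ.toLinearMap
  have : CompleteSpace L := FiniteDimensional.complete ℂ L
  let _ : NormedAlgebra ℚ (L →L[ℂ] L) := NormedAlgebra.restrictScalars ℚ ℂ _
  let B : L →ₗ[ℂ] L →ₗ[ℂ] L := LinearMap.mk₂ ℂ (fun x y : L => ⁅x, y⁆) add_lie smul_lie lie_add
    (fun c x y => lie_smul c x y)
  filter_upwards [eventually_exists_exp_apply B A K s hs w] with t ht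
  obtain ⟨u, hu, k, hk, h⟩ := ht
  set D := LinearMap.toContinuousLinearMap (B u) with hD
  have hDapp : ∀ x, D x = ⁅u, x⁆ := fun x => rfl
  have hder : ∀ x y, NormedSpace.exp D ⁅x, y⁆ = ⁅NormedSpace.exp D x, NormedSpace.exp D y⁆ :=
    exp_apply_bilinear_of_derivation B D
      (fun x y => leibniz_lie u x y)
  let φ₀ : L →ₗ⁅ℂ⁆ L := { (NormedSpace.exp D : L →L[ℂ] L).toLinearMap with
    map_lie' := fun {x y} => hder x y }
  have hinv : ∀ x, NormedSpace.exp (-D) (NormedSpace.exp D x) = x := fun x => by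
    rw [← mul_apply_eq_comp, ← NormedSpace.exp_add_of_commute]
    · simp
    · exact (Commute.refl D).neg_left
  have hinj : Function.Injective φ₀ := Function.LeftInverse.injective
    (g := fun x => NormedSpace.exp (-D) x) hinv
  refine ⟨u, hu, k, hk, LieEquiv.ofBijective φ₀ ⟨hinj,
    (LinearMap.injective_iff_surjective (f := (φ₀ : L →ₗ[ℂ] L))).mp hinj⟩, ?_, h⟩
  intro x hx
  change NormedSpace.exp D x = x
  have hd : ∀ (t : ℂ), HasDerivAt (fun t : ℂ => NormedSpace.exp (t • D) x) 0 t := by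
    intro t
    have := (hasDerivAt_exp_smul_const (𝕂 := ℂ) D t).clm_apply (hasDerivAt_const t x)
    simpa [hDapp, hx] using this
  have := is_const_of_deriv_eq_zero (fun t => (hd t).differentiableAt)
    (fun t => (hd t).deriv) 1 0
  simpa using this

end LieExp

open Topology in
theorem related_of_eventually_related {G : Set ℂ} (hG : Gᶜ.Finite) (r : ℂ → ℂ → Prop)
    (hsymm : ∀ x y, r x y → r y x) (htrans : ∀ x y z, r x y → r y z → r x z)
    (hloc : ∀ x ∈ G, ∀ᶠ y in 𝓝 x, y ∈ G → r x y) {x y : ℂ} (hx : x ∈ G) (hy : y ∈ G) :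
    r x y := by
  have hconn : IsPreconnected G := by
    have := (Set.Countable.isConnected_compl_of_one_lt_rank (E := ℂ) (by simp)
      hG.countable).isPreconnected
    rwa [compl_compl] at this
  exact hconn.induction₂ r (fun x hx => eventually_nhdsWithin_iff.mpr (hloc x hx))
    (fun x y z _ _ _ h1 h2 => htrans x y z h1 h2) (fun x y _ _ h => hsymm x y h) hx hy

section EngelConj

open Topology LieAlgebra LieSubalgebra

variable {L : Type*} [LieRing L] [LieAlgebra ℂ L]

theorem map_engel (φ : L ≃ₗ⁅ℂ⁆ L) (x y : L) : φ y ∈ engel ℂ (φ x) ↔ y ∈ engel ℂ x := by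
  have key : ∀ n : ℕ, (ad ℂ L (φ x) ^ n) (φ y) = φ ((ad ℂ L x ^ n) y) := by
    intro n
    induction n with
    | zero => simp
    | succ n ih => rw [pow_succ', End.mul_apply, ih, pow_succ', End.mul_apply]; exact (LieEquiv.map_lie φ _ _).symm
  simp only [mem_engel_iff, key, EmbeddingLike.map_eq_zero_iff]

theorem finrank_engel_map (φ : L ≃ₗ⁅ℂ⁆ L) (x : L) :
    finrank ℂ (engel ℂ (φ x)) = finrank ℂ (engel ℂ x) := by
  have : (engel ℂ (φ x)).toSubmodule = (engel ℂ x).toSubmodule.map (φ.toLinearEquiv : L →ₗ[ℂ] L) := by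
    ext z
    constructor
    · intro hz
      exact ⟨φ.symm z, (map_engel φ x _).mp (by simpa using hz), by simp⟩
    · rintro ⟨y, hy, rfl⟩
      exact (map_engel φ x y).mpr hy
  change finrank ℂ (engel ℂ (φ x)).toSubmodule = finrank ℂ (engel ℂ x).toSubmodule
  rw [this]
  exact LinearEquiv.finrank_map_eq φ.toLinearEquiv _

variable [FiniteDimensional ℂ L]

theorem exists_lie_add_of_mem_engel (x y : L) : ∃ u : L, ∃ k ∈ engel ℂ x, y = ⁅u, x⁆ + k := by
  have hc := LinearMap.isCompl_iSup_ker_pow_iInf_range_pow (ad ℂ L x)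
  obtain ⟨k, hk, w, hw, rfl⟩ := Submodule.mem_sup.mp (hc.sup_eq_top ▸ Submodule.mem_top : y ∈ _)
  obtain ⟨v, rfl⟩ : w ∈ LinearMap.range (ad ℂ L x ^ 1) := (Submodule.mem_iInf _).mp hw 1
  refine ⟨-v, k, ?_, by simp [add_comm]⟩
  rw [mem_engel_iff]
  have hle : (⨆ n, LinearMap.ker (ad ℂ L x ^ n)) ≤ (ad ℂ L x).maxGenEigenspace 0 :=
    iSup_le fun n z hz => by
      rw [End.mem_maxGenEigenspace]
      exact ⟨n, by simpa using hz⟩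
  simpa [End.mem_maxGenEigenspace] using hle hk

theorem engel_le_engel_of_isRegular {x y : L} (hx : IsRegular ℂ x) (hy : y ∈ engel ℂ x) :
    engel ℂ x ≤ engel ℂ y := by
  set Ex : {engel ℂ z | z ∈ engel ℂ x} := ⟨engel ℂ x, x, self_mem_engel _ _, rfl⟩
  suffices IsBot Ex from @this ⟨engel ℂ y, y, hy, rfl⟩
  refine engel_isBot_of_isMin (Cardinal.natCast_le_aleph0.trans <|
    Cardinal.infinite_iff.mp inferInstance) (engel ℂ x) Ex le_rfl ?_
  rintro ⟨_, y, hy, rfl⟩ hyx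
  suffices finrank ℂ (engel ℂ x) ≤ finrank ℂ (engel ℂ y) by
    suffices engel ℂ y = engel ℂ x from this.ge
    apply LieSubalgebra.toSubmodule_injective
    exact Submodule.eq_of_le_of_finrank_le hyx this
  rw [(isRegular_iff_finrank_engel_eq_rank ℂ x).mp hx]
  apply rank_le_finrank_engel

theorem finite_compl_isRegular_line (a b : L) (hb : IsRegular ℂ (a + b)) :
    {t : ℂ | IsRegular ℂ (a + t • b)}ᶜ.Finite := by
  classical
  let B := Module.finBasis ℂ L
  obtain ⟨P, hP⟩ : ∃ P : MvPolynomial (Fin (finrank ℂ L)) ℂ,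
      ∀ x, IsRegular ℂ x ↔ MvPolynomial.eval (B.repr x) P ≠ 0 :=
    ⟨_, fun x => isRegular_iff_coeff_polyCharpoly_rank_ne_zero ℂ B x⟩
  let q : Polynomial ℂ := MvPolynomial.aeval
    (fun i => Polynomial.C (B.repr a i) + Polynomial.X * Polynomial.C (B.repr b i)) P
  have hq : ∀ t : ℂ, q.eval t = MvPolynomial.eval (B.repr (a + t • b)) P := by
    intro t
    have : (Polynomial.evalRingHom t).comp (MvPolynomial.aeval
        (fun i => Polynomial.C (B.repr a i) + Polynomial.X * Polynomial.C (B.repr b i))).toRingHom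
        = MvPolynomial.eval (R := ℂ) (B.repr (a + t • b)) := by
      ext i
      · simp
      · simp [mul_comm (B.repr b i)]
    exact RingHom.congr_fun this P
  have hq0 : q ≠ 0 := by
    intro h0
    have := hq 1
    rw [h0, one_smul, Polynomial.eval_zero] at this
    exact (hP _).mp hb this.symm
  refine (q.rootSet_finite ℂ).subset fun t ht => ?_
  rw [Polynomial.mem_rootSet]
  refine ⟨hq0, ?_⟩
  by_contra hne
  refine ht ((hP _).mpr ?_)
  rw [← hq]
  simpa using hne

theorem isRegular_of_forall_le_engel {x : L} (hx : ∀ y ∈ engel ℂ x, engel ℂ x ≤ engel ℂ y) :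
    IsRegular ℂ x := by
  obtain ⟨y, hy⟩ := exists_isRegular ℂ L
  have h1 := eventually_exists_lieEquiv_apply ⊤ (engel ℂ x).toSubmodule x
    (fun z => by
      obtain ⟨u, k, hk, h⟩ := exists_lie_add_of_mem_engel x z
      exact ⟨u, trivial, k, hk, h⟩) (y - x)
  have h2 : ∀ᶠ t in 𝓝[≠] (0 : ℂ), IsRegular ℂ (x + t • (y - x)) := by
    have := (finite_compl_isRegular_line x (y - x) (by simpa using hy))
    have h3 := (this.subset Set.sdiff_subset).isClosed.compl_mem_nhds
      (x := (0 : ℂ)) (s := {t : ℂ | IsRegular ℂ (x + t • (y - x))}ᶜ \ {0}) (by simp)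
    filter_upwards [nhdsWithin_le_nhds h3, self_mem_nhdsWithin] with t ht ht0
    by_contra hne
    exact ht ⟨hne, ht0⟩
  obtain ⟨t, ⟨u, -, k, hk, φ, -, h⟩, ht⟩ :=
    ((h1.filter_mono nhdsWithin_le_nhds).and h2).exists
  rw [isRegular_iff_finrank_engel_eq_rank] at ht ⊢
  refine le_antisymm ?_ (rank_le_finrank_engel ℂ x)
  rw [← ht, h, finrank_engel_map]
  exact Submodule.finrank_mono (hx _ (add_mem (self_mem_engel ℂ x) hk))

theorem exists_lieEquiv_mem_engel {x₀ : L} (hx₀ : ∀ y ∈ engel ℂ x₀, engel ℂ x₀ ≤ engel ℂ y)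
    {h : L} (hss : ∀ x, ∃ u k : L, ⁅h, k⁆ = 0 ∧ x = ⁅u, h⁆ + k) :
    ∃ φ : L ≃ₗ⁅ℂ⁆ L, φ h ∈ engel ℂ x₀ := by
  have hreg := isRegular_of_forall_le_engel hx₀
  let X : ℂ → L := fun t => h + t • (x₀ - h)
  let G : Set ℂ := {t | IsRegular ℂ (X t)}
  have hG : Gᶜ.Finite := finite_compl_isRegular_line h (x₀ - h) (by simpa using hreg)
  have engel_eq : ∀ x k : L, IsRegular ℂ x → IsRegular ℂ (x + k) → k ∈ engel ℂ x →
      engel ℂ (x + k) = engel ℂ x := by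
    intro x k hx hxk hk
    have hle := engel_le_engel_of_isRegular hx (add_mem (self_mem_engel ℂ x) hk)
    rw [isRegular_iff_finrank_engel_eq_rank] at hx hxk
    exact (LieSubalgebra.toSubmodule_injective
      (Submodule.eq_of_le_of_finrank_le hle (hxk.trans hx.symm).le)).symm
  have reg_iff : ∀ (φ : L ≃ₗ⁅ℂ⁆ L) (x : L), IsRegular ℂ (φ x) → IsRegular ℂ x := by
    intro φ x hx
    rw [isRegular_iff_finrank_engel_eq_rank] at hx ⊢
    rwa [finrank_engel_map] at hx
  let r : ℂ → ℂ → Prop := fun s t => ∃ φ : L ≃ₗ⁅ℂ⁆ L, ∀ y, φ y ∈ engel ℂ (X t) ↔ y ∈ engel ℂ (X s)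
  have X_add : ∀ s t, X t = X s + (t - s) • (x₀ - h) := by
    intro s t
    simp only [X, sub_smul]
    abel
  have hr : ∀ s ∈ G, ∀ t ∈ G, r s t := by
    intro s hs t ht
    refine related_of_eventually_related hG r ?_ ?_ ?_ hs ht
    · rintro s t ⟨φ, hφ⟩
      exact ⟨φ.symm, fun y => by rw [← hφ]; simp⟩
    · rintro s t u ⟨φ, hφ⟩ ⟨ψ, hψ⟩
      exact ⟨φ.trans ψ, fun y => by rw [LieEquiv.trans_apply, hψ, hφ]⟩
    · intro s hs
      have h1 := eventually_exists_lieEquiv_apply ⊤ (engel ℂ (X s)).toSubmodule (X s)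
        (fun z => by
          obtain ⟨u, k, hk, h⟩ := exists_lie_add_of_mem_engel (X s) z
          exact ⟨u, trivial, k, hk, h⟩) (x₀ - h)
      have h2 : Filter.Tendsto (fun t : ℂ => t - s) (𝓝 s) (𝓝 0) := by
        have : Continuous fun t : ℂ => t - s := by fun_prop
        simpa using this.tendsto s
      filter_upwards [h2.eventually h1] with t ⟨u, _, k, hk, φ, _, h⟩ ht
      rw [← X_add] at h
      refine ⟨φ, fun y => ?_⟩
      have hk' : IsRegular ℂ (X s + k) := reg_iff φ _ (h ▸ ht)
      rw [h, map_engel, engel_eq _ _ hs hk' hk]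
  have h1 := eventually_exists_lieEquiv_apply ⊤ (LinearMap.ker (ad ℂ L h)) h
    (fun z => by
      obtain ⟨u, k, hk, h⟩ := hss z
      exact ⟨u, trivial, k, by simpa using hk, h⟩) (x₀ - h)
  have h2 : ∀ᶠ t in 𝓝[≠] (0 : ℂ), t ∈ G := by
    have h3 := (hG.subset Set.sdiff_subset).isClosed.compl_mem_nhds
      (x := (0 : ℂ)) (s := Gᶜ \ {0}) (by simp)
    filter_upwards [nhdsWithin_le_nhds h3, self_mem_nhdsWithin] with t ht ht0
    by_contra hne
    exact ht ⟨hne, ht0⟩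
  obtain ⟨t, ⟨u, -, k, hk, φ, -, h3⟩, ht⟩ :=
    ((h1.filter_mono nhdsWithin_le_nhds).and h2).exists
  obtain ⟨ψ, hψ⟩ := hr t ht 1 (by simpa [G, X] using hreg)
  refine ⟨φ.trans ψ, ?_⟩
  have hX1 : X 1 = x₀ := by simp [X]
  rw [← hX1, LieEquiv.trans_apply, hψ]
  change φ h ∈ engel ℂ (h + t • (x₀ - h))
  rw [h3, map_engel, mem_engel_iff]
  refine ⟨1, ?_⟩
  have hk : ⁅h, k⁆ = 0 := by simpa using hk
  rw [pow_one, ad_apply, add_lie, lie_self, zero_add, ← lie_skew, hk, neg_zero]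

end EngelConj

section SlTwo

variable {V : Type*} [AddCommGroup V] [Module ℂ V]

/-- The `sl₂` commutation relations for three endomorphisms of a vector space. -/
structure SlTwoRel (E H F : End ℂ V) : Prop where
  ef : E * F - F * E = H
  he : H * E - E * H = (2 : ℂ) • E
  hf : H * F - F * H = -((2 : ℂ) • F)

theorem pow_commutator_of_commutator_eq_smul {A : Type*} [Ring A] [Algebra ℂ A] {H X : A} {c : ℂ}
    (h : H * X - X * H = c • X) (n : ℕ) : H * X ^ n - X ^ n * H = (n * c) • X ^ n := by
  induction n with
  | zero => simp
  | succ n ih =>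
    have : H * X ^ (n + 1) - X ^ (n + 1) * H
        = (H * X ^ n - X ^ n * H) * X + X ^ n * (H * X - X * H) := by
      rw [pow_succ]; noncomm_ring
    rw [this, ih, h, smul_mul_assoc, mul_smul_comm, ← pow_succ, ← add_smul]
    push_cast; ring_nf

theorem isNilpotent_of_commutator_eq_smul [FiniteDimensional ℂ V] {H X : End ℂ V} {c : ℂ}
    (hc : c ≠ 0) (h : H * X - X * H = c • X) : IsNilpotent X := by
  by_contra hX
  have hne : ∀ n : ℕ, X ^ n ≠ 0 := fun n hn => hX ⟨n, hn⟩
  let T : End ℂ (End ℂ V) := LinearMap.mulLeft ℂ H - LinearMap.mulRight ℂ H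
  have hT : ∀ n : ℕ, T.HasEigenvalue (n * c) := fun n => by
    refine End.hasEigenvalue_of_hasEigenvector (x := X ^ n) ⟨?_, hne n⟩
    rw [End.mem_eigenspace_iff]
    simpa [T] using pow_commutator_of_commutator_eq_smul h n
  have hfin : Set.Finite {μ | T.HasEigenvalue μ} := End.finite_hasEigenvalue T
  refine (Set.infinite_of_injective_forall_mem (f := fun n : ℕ => (n : ℂ) * c) ?_ hT) hfin
  intro a b hab
  simpa [hc] using hab

theorem mem_iSup_eigenspace_of_prod_apply_eq_zero {ι : Type*} (T : End ℂ V) (a : ι → ℂ)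
    (ha : Function.Injective a) (s : Finset ι) (v : V)
    (h : Polynomial.aeval T (∏ i ∈ s, (Polynomial.X - Polynomial.C (a i))) v = 0) :
    v ∈ ⨆ i ∈ s, T.eigenspace (a i) := by
  classical
  induction s using Finset.induction_on generalizing v with
  | empty => simpa using h
  | insert i s his ih =>
    rw [Finset.prod_insert his] at h
    have hcop : IsCoprime (Polynomial.X - Polynomial.C (a i))
        (∏ j ∈ s, (Polynomial.X - Polynomial.C (a j))) := by
      refine IsCoprime.prod_right fun j hj => ?_
      refine Polynomial.isCoprime_X_sub_C_of_isUnit_sub ?_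
      rw [isUnit_iff_ne_zero, sub_ne_zero]
      exact fun hij => his (ha hij ▸ hj)
    have := Polynomial.sup_ker_aeval_eq_ker_aeval_mul_of_coprime T hcop
    have hv : v ∈ LinearMap.ker (Polynomial.aeval T ((Polynomial.X - Polynomial.C (a i)) *
        ∏ j ∈ s, (Polynomial.X - Polynomial.C (a j)))) := h
    rw [← this] at hv
    obtain ⟨x, hx, y, hy, rfl⟩ := Submodule.mem_sup.mp hv
    rw [Finset.iSup_insert]
    refine Submodule.add_mem_sup ?_ (ih y hy)
    rw [End.mem_eigenspace_iff]
    simpa [sub_eq_zero, Algebra.algebraMap_eq_smul_one] using hx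

/-- A normalisation of the Casimir operator. -/
def SlTwoRel.casimir (E H F : End ℂ V) : End ℂ V := (H + 1) ^ 2 + (4 : ℂ) • (F * E)

namespace SlTwoRel

variable {E H F : End ℂ V} (t : SlTwoRel E H F)
include t

theorem swap : SlTwoRel F (-H) E where
  ef := by rw [← t.ef]; abel
  he := by have := t.hf; simp only [neg_mul, mul_neg, sub_neg_eq_add]; rw [← neg_inj, ← this]; abel
  hf := by have := t.he; simp only [neg_mul, mul_neg, sub_neg_eq_add]; rw [← this]; abel

theorem ef_apply (v : V) : E (F v) = F (E v) + H v := by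
  have := LinearMap.congr_fun t.ef v
  simp only [LinearMap.sub_apply, End.mul_apply] at this
  rw [← this]; abel

theorem he_apply (v : V) : H (E v) = E (H v) + (2 : ℂ) • E v := by
  have := LinearMap.congr_fun t.he v
  simp only [LinearMap.sub_apply, End.mul_apply, LinearMap.smul_apply] at this
  rw [← this]; abel

theorem hf_apply (v : V) : H (F v) = F (H v) - (2 : ℂ) • F v := by
  have := LinearMap.congr_fun t.hf v
  simp only [LinearMap.sub_apply, End.mul_apply, LinearMap.smul_apply, LinearMap.neg_apply] at this
  rw [sub_eq_add_neg, ← this]; abel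

theorem hf_pow_apply (n : ℕ) (v : V) : H ((F ^ n) v) = (F ^ n) (H v) - (2 * n : ℂ) • (F ^ n) v := by
  have := LinearMap.congr_fun (pow_commutator_of_commutator_eq_smul
    (c := -2) (by rw [t.hf, neg_smul]) n) v
  simp only [LinearMap.sub_apply, End.mul_apply, LinearMap.smul_apply] at this
  rw [sub_eq_iff_eq_add.mp this]
  module

theorem he_pow_apply (n : ℕ) (v : V) : H ((E ^ n) v) = (E ^ n) (H v) + (2 * n : ℂ) • (E ^ n) v := by
  have := LinearMap.congr_fun (pow_commutator_of_commutator_eq_smul t.he n) v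
  simp only [LinearMap.sub_apply, End.mul_apply, LinearMap.smul_apply] at this
  rw [sub_eq_iff_eq_add.mp this]
  module

theorem e_f_pow_succ_apply (n : ℕ) (v : V) (hv : E v = 0) :
    E ((F ^ (n + 1)) v) = ((n : ℂ) + 1) • (F ^ n) (H v - (n : ℂ) • v) := by
  induction n with
  | zero => simp [t.ef_apply, hv]
  | succ n ih =>
    rw [pow_succ', End.mul_apply, t.ef_apply, ih, pow_succ' F n, End.mul_apply, t.hf_apply,
      t.hf_pow_apply]
    simp only [map_smul, map_sub, End.mul_apply]
    push_cast
    module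

theorem e_pow_f_pow_apply (n : ℕ) (v : V) (hv : E v = 0) :
    (E ^ n) ((F ^ n) v) = (n.factorial : ℂ) • Polynomial.aeval H
      (∏ i ∈ Finset.range n, (Polynomial.X - Polynomial.C (i : ℂ))) v := by
  induction n generalizing v with
  | zero => simp
  | succ n ih =>
    have hw : E (H v - (n : ℂ) • v) = 0 := by
      have := t.he_apply v
      rw [hv] at this
      simp only [map_zero, smul_zero, add_zero] at this
      simp [hv, ← this]
    rw [pow_succ E, End.mul_apply, t.e_f_pow_succ_apply n v hv, map_smul, ih _ hw,
      Finset.prod_range_succ, map_mul, End.mul_apply, smul_smul, Nat.factorial_succ]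
    congr 1
    · push_cast; ring
    · simp [Nat.cast_smul_eq_nsmul]

theorem casimir_swap : casimir F (-H) E = casimir E H F := by
  have h : E * F = F * E + H := by rw [← t.ef]; abel
  simp only [casimir, h]
  rw [pow_two, pow_two]
  simp only [mul_add, add_mul, neg_mul, mul_neg, mul_one, one_mul, smul_add]
  have : (4 : ℂ) • H = H + H + H + H := by module
  rw [this]; abel

theorem commute_casimir_h : Commute (casimir E H F) H := by
  ext v
  simp only [casimir, pow_two, End.mul_apply, LinearMap.add_apply, LinearMap.smul_apply,
    End.one_apply, map_add, map_smul, t.hf_apply, t.he_apply]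
  module

theorem commute_casimir_e : Commute (casimir E H F) E := by
  ext v
  simp only [casimir, pow_two, End.mul_apply, LinearMap.add_apply, LinearMap.smul_apply,
    End.one_apply, map_add, map_smul, t.ef_apply, t.he_apply]
  module

variable [FiniteDimensional ℂ V]

theorem isNilpotent_e : IsNilpotent E := isNilpotent_of_commutator_eq_smul two_ne_zero t.he

theorem isNilpotent_f : IsNilpotent F := t.swap.isNilpotent_e

theorem mem_iSup_eigenspace_of_e_apply_eq_zero {v : V} (hv : E v = 0) :
    v ∈ ⨆ k : ℕ, H.eigenspace (k : ℂ) := by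
  obtain ⟨n, hn⟩ := t.isNilpotent_f
  have h := t.e_pow_f_pow_apply n v hv
  rw [hn, LinearMap.zero_apply, map_zero, eq_comm, smul_eq_zero] at h
  have h := h.resolve_left (by exact_mod_cast n.factorial_ne_zero)
  have := mem_iSup_eigenspace_of_prod_apply_eq_zero H (fun k : ℕ => (k : ℂ)) Nat.cast_injective _ v h
  have hle : (⨆ i ∈ Finset.range n, H.eigenspace (i : ℂ)) ≤ ⨆ k : ℕ, H.eigenspace (k : ℂ) :=
    iSup_mono fun i => iSup_le fun _ => le_rfl
  exact hle this

theorem exists_nat_of_e_apply_eq_zero {v : V} (hv : E v = 0) (hv0 : v ≠ 0) {μ : ℂ}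
    (hμ : H v = μ • v) : ∃ k : ℕ, μ = k := by
  obtain ⟨n, hn⟩ := t.isNilpotent_f
  have h := t.e_pow_f_pow_apply n v hv
  rw [hn, LinearMap.zero_apply, map_zero, eq_comm, smul_eq_zero] at h
  have h := h.resolve_left (by exact_mod_cast n.factorial_ne_zero)
  have hev : H.HasEigenvector μ v := ⟨End.mem_eigenspace_iff.mpr hμ, hv0⟩
  rw [End.aeval_apply_of_hasEigenvector hev, smul_eq_zero] at h
  have h := h.resolve_right hv0
  rw [Polynomial.eval_prod, Finset.prod_eq_zero_iff] at h
  obtain ⟨i, -, hi⟩ := h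
  exact ⟨i, by simpa [sub_eq_zero] using hi⟩

theorem exists_nat_h_apply_eq (c : ℂ) : ∃ n : ℕ,
    ∀ v ∈ (casimir E H F).maxGenEigenspace c, E v = 0 → H v = (n : ℂ) • v := by
  set W := (casimir E H F).maxGenEigenspace c
  have key : ∀ x ∈ W, E x = 0 → x ≠ 0 → ∀ μ : ℂ, H x = μ • x → ∃ k : ℕ, μ = k ∧ (k + 1 : ℂ) ^ 2 = c := by
    intro x hx hex hx0 μ hμ
    obtain ⟨k, rfl⟩ := t.exists_nat_of_e_apply_eq_zero hex hx0 hμ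
    refine ⟨k, rfl, ?_⟩
    have hΩ : casimir E H F x = ((k + 1 : ℂ) ^ 2) • x := by
      simp only [casimir, pow_two, End.mul_apply, LinearMap.add_apply, LinearMap.smul_apply,
        End.one_apply, map_add, map_smul, hex, hμ, map_zero]
      module
    have h1 : x ∈ (casimir E H F).maxGenEigenspace ((k + 1 : ℂ) ^ 2) :=
      (End.genEigenspace _ _).mono le_top (End.mem_genEigenspace_one.mpr hΩ)
    by_contra hne
    have := (End.disjoint_genEigenspace (casimir E H F) hne ⊤ ⊤).le_bot ⟨h1, hx⟩
    exact hx0 (by simpa using this)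
  obtain ⟨n, hn⟩ : ∃ n : ℕ, ∀ k : ℕ, (k + 1 : ℂ) ^ 2 = c → k = n := by
    by_cases h : ∃ n : ℕ, (n + 1 : ℂ) ^ 2 = c
    · obtain ⟨n, hn⟩ := h
      refine ⟨n, fun k hk => ?_⟩
      rw [← hn] at hk
      have : (k + 1) ^ 2 = (n + 1) ^ 2 := by exact_mod_cast hk
      have := Nat.pow_left_injective (n := 2) two_ne_zero this
      simpa using this
    · exact ⟨0, fun k hk => (h ⟨k, hk⟩).elim⟩
  refine ⟨n, fun v hv hev => ?_⟩
  let p : Submodule ℂ V := W ⊓ LinearMap.ker E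
  have hp : ∀ x ∈ p, H x ∈ p := by
    rintro x ⟨hx, hex⟩
    refine ⟨End.mapsTo_maxGenEigenspace_of_comm t.commute_casimir_h c hx, ?_⟩
    have := t.he_apply x
    rw [SetLike.mem_coe, LinearMap.mem_ker] at hex ⊢
    rw [hex] at this
    simpa using this.symm
  have hv' : v ∈ p ⊓ ⨆ μ, H.genEigenspace μ 1 := by
    refine ⟨⟨hv, hev⟩, ?_⟩
    have := t.mem_iSup_eigenspace_of_e_apply_eq_zero hev
    have hle : (⨆ k : ℕ, H.eigenspace (k : ℂ)) ≤ ⨆ μ : ℂ, H.genEigenspace μ 1 :=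
      iSup_le fun k => le_iSup (fun μ : ℂ => H.genEigenspace μ 1) (k : ℂ)
    exact hle this
  rw [Submodule.inf_iSup_genEigenspace hp] at hv'
  rw [← End.mem_eigenspace_iff]
  suffices hle : (⨆ μ, p ⊓ H.genEigenspace μ 1) ≤ H.eigenspace (n : ℂ) from hle hv'
  refine iSup_le fun μ => ?_
  rintro x ⟨⟨hx, hex⟩, hμ⟩
  rw [SetLike.mem_coe, End.mem_genEigenspace_one] at hμ
  rw [End.mem_eigenspace_iff]
  by_cases hx0 : x = 0
  · simp [hx0]
  obtain ⟨k, rfl, hk⟩ := key x hx hex hx0 μ hμ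
  rw [hμ, hn k hk]

theorem mem_iSup_eigenspace_of_mem_maxGenEigenspace {c : ℂ} {v : V}
    (hv : v ∈ (casimir E H F).maxGenEigenspace c) : v ∈ ⨆ k : ℤ, H.eigenspace (k : ℂ) := by
  obtain ⟨κ, hκ⟩ := t.exists_nat_h_apply_eq c
  have key : ∀ n : ℕ, ∀ v ∈ (casimir E H F).maxGenEigenspace c, (E ^ n) v = 0 →
      Polynomial.aeval H (∏ j ∈ Finset.range n,
        (Polynomial.X - Polynomial.C (((κ : ℤ) - 2 * (j : ℤ) : ℤ) : ℂ))) v = 0 := by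
    intro n
    induction n with
    | zero => intro v _ h; simpa using h
    | succ n ih =>
      intro v hv hn
      have h1 := ih (E v) (End.mapsTo_maxGenEigenspace_of_comm t.commute_casimir_e c hv)
        (by rwa [pow_succ, End.mul_apply] at hn)
      set Q : Polynomial ℂ := ∏ j ∈ Finset.range n,
        (Polynomial.X - Polynomial.C (((κ : ℤ) - 2 * ((j + 1 : ℕ) : ℤ) : ℤ) : ℂ)) with hQ
      have hcomm : ∀ (m : ℕ) (w : V), E (Polynomial.aeval H (∏ j ∈ Finset.range m,
          (Polynomial.X - Polynomial.C (((κ : ℤ) - 2 * ((j + 1 : ℕ) : ℤ) : ℤ) : ℂ))) w) =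
          Polynomial.aeval H (∏ j ∈ Finset.range m,
            (Polynomial.X - Polynomial.C (((κ : ℤ) - 2 * (j : ℤ) : ℤ) : ℂ))) (E w) := by
        intro m
        induction m with
        | zero => simp
        | succ m ihm =>
          intro w
          rw [Finset.prod_range_succ, Finset.prod_range_succ, map_mul, map_mul, End.mul_apply,
            End.mul_apply, ihm]
          congr 1
          simp only [map_sub, Polynomial.aeval_X, Polynomial.aeval_C, LinearMap.sub_apply,
            Module.algebraMap_end_apply, t.he_apply, map_smul]
          push_cast
          module
      have h2 : E (Polynomial.aeval H Q v) = 0 := by rw [hcomm, h1]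
      have h3 : Polynomial.aeval H Q v ∈ (casimir E H F).maxGenEigenspace c :=
        End.mapsTo_maxGenEigenspace_of_comm
          ((Algebra.commute_of_mem_adjoin_singleton_of_commute
            (Polynomial.aeval_mem_adjoin_singleton ℂ H) t.commute_casimir_h)) c hv
      have h4 := hκ _ h3 h2
      rw [Finset.prod_range_succ', mul_comm, map_mul, End.mul_apply, ← hQ]
      simp only [map_sub, Polynomial.aeval_X, Polynomial.aeval_C, LinearMap.sub_apply,
        Module.algebraMap_end_apply, h4]
      simp
  obtain ⟨n, hn⟩ := t.isNilpotent_e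
  have h1 := key n v hv (by rw [hn]; rfl)
  have h2 := mem_iSup_eigenspace_of_prod_apply_eq_zero H
    (fun j : ℕ => (((κ : ℤ) - 2 * (j : ℤ) : ℤ) : ℂ)) (fun a b hab => by
      have : (κ : ℤ) - 2 * (a : ℤ) = (κ : ℤ) - 2 * (b : ℤ) :=
        Int.cast_injective (α := ℂ) hab
      omega) _ v h1
  suffices hle : (⨆ j ∈ Finset.range n, H.eigenspace ((((κ : ℤ) - 2 * (j : ℤ) : ℤ) : ℂ))) ≤
    ⨆ k : ℤ, H.eigenspace (k : ℂ) from hle h2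
  exact iSup_le fun j => iSup_le fun _ =>
    le_iSup (fun k : ℤ => H.eigenspace (k : ℂ)) ((κ : ℤ) - 2 * (j : ℤ))

theorem iSup_eigenspace_int_eq_top : ⨆ k : ℤ, H.eigenspace (k : ℂ) = ⊤ := by
  rw [eq_top_iff, ← End.iSup_maxGenEigenspace_eq_top (casimir E H F)]
  exact iSup_le fun c v hv => t.mem_iSup_eigenspace_of_mem_maxGenEigenspace hv

theorem exists_int_of_hasEigenvector {v : V} (hv0 : v ≠ 0) {μ : ℂ} (hμ : H v = μ • v) :
    ∃ k : ℤ, μ = k := by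
  by_contra! hne
  have h1 : v ∈ ⨆ k : ℤ, H.eigenspace (k : ℂ) := t.iSup_eigenspace_int_eq_top ▸ Submodule.mem_top
  have h2 : (⨆ k : ℤ, H.eigenspace (k : ℂ)) ≤ ⨆ ν ≠ μ, H.eigenspace ν :=
    iSup_le fun k => le_iSup₂_of_le (f := fun ν (_ : ν ≠ μ) => H.eigenspace ν) (k : ℂ)
      (hne k).symm le_rfl
  have := (End.eigenspaces_iSupIndep H μ).le_bot ⟨End.mem_eigenspace_iff.mpr hμ, h2 h1⟩
  exact hv0 (by simpa using this)

theorem h_apply_eq_zero_of_mem_maxGenEigenspace_one {v : V}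
    (hv : v ∈ (casimir E H F).maxGenEigenspace 1) : H v = 0 := by
  have key : ∀ {E H F : End ℂ V}, SlTwoRel E H F → ∀ x ∈ (casimir E H F).maxGenEigenspace 1,
      ∀ k : ℤ, H x = (k : ℂ) • x → x ≠ 0 → k ≤ 0 := by
    intro E H F t x hx k hk hx0
    have h0 : ∀ y ∈ (casimir E H F).maxGenEigenspace 1, E y = 0 → H y = 0 := by
      intro y hy hey
      obtain ⟨κ, hκ⟩ := t.exists_nat_h_apply_eq 1
      have := hκ y hy hey
      by_cases hy0 : y = 0
      · simp [hy0]
      have hΩ : casimir E H F y = ((κ + 1 : ℂ) ^ 2) • y := by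
        simp only [casimir, pow_two, End.mul_apply, LinearMap.add_apply, LinearMap.smul_apply,
          End.one_apply, map_add, map_smul, hey, this, map_zero]
        module
      have h1 : y ∈ (casimir E H F).maxGenEigenspace ((κ + 1 : ℂ) ^ 2) :=
        (End.genEigenspace _ _).mono le_top (End.mem_genEigenspace_one.mpr hΩ)
      by_cases hne : (κ + 1 : ℂ) ^ 2 = 1
      · have : (κ + 1) ^ 2 = 1 := by exact_mod_cast hne
        have : κ = 0 := by simpa using this
        simp_all
      · have := (End.disjoint_genEigenspace (casimir E H F) hne ⊤ ⊤).le_bot ⟨h1, hy⟩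
        exact (hy0 (by simpa using this)).elim
    have hex : ∃ n, (E ^ n) x = 0 := by
      obtain ⟨n, hn⟩ := t.isNilpotent_e
      exact ⟨n, by rw [hn]; rfl⟩
    classical
    obtain ⟨n, hn⟩ : ∃ n, Nat.find hex = n + 1 :=
      Nat.exists_eq_succ_of_ne_zero fun h => hx0 (by simpa [h] using Nat.find_spec hex)
    have h1 : (E ^ n) x ≠ 0 := Nat.find_min hex (by omega)
    have h2 : E ((E ^ n) x) = 0 := by
      rw [← End.mul_apply, ← pow_succ', ← hn]; exact Nat.find_spec hex
    have h3 := h0 _ (End.mapsTo_maxGenEigenspace_of_comm (t.commute_casimir_e.pow_right n) 1 hx) h2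
    rw [t.he_pow_apply, hk, map_smul, ← add_smul, smul_eq_zero] at h3
    have h4 := h3.resolve_right h1
    have h5 : k + 2 * n = 0 := by exact_mod_cast h4
    omega
  set W := (casimir E H F).maxGenEigenspace 1 with hW
  have hv' : v ∈ W ⊓ ⨆ μ, H.genEigenspace μ 1 := by
    refine ⟨hv, ?_⟩
    have hle : (⨆ k : ℤ, H.eigenspace (k : ℂ)) ≤ ⨆ μ : ℂ, H.genEigenspace μ 1 :=
      iSup_le fun k => le_iSup (fun μ : ℂ => H.genEigenspace μ 1) (k : ℂ)
    exact hle (t.iSup_eigenspace_int_eq_top ▸ Submodule.mem_top)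
  rw [Submodule.inf_iSup_genEigenspace
    (fun x hx => End.mapsTo_maxGenEigenspace_of_comm t.commute_casimir_h 1 hx)] at hv'
  suffices hle : (⨆ μ, W ⊓ H.genEigenspace μ 1) ≤ LinearMap.ker H from hle hv'
  refine iSup_le fun μ => ?_
  rintro x ⟨hx, hμ⟩
  rw [SetLike.mem_coe, End.mem_genEigenspace_one] at hμ
  rw [LinearMap.mem_ker]
  by_cases hx0 : x = 0
  · simp [hx0]
  obtain ⟨k, rfl⟩ := t.exists_int_of_hasEigenvector hx0 hμ
  have h1 := key t x hx k hμ hx0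
  have h2 := key t.swap x (by rwa [t.casimir_swap]) (-k) (by simp [hμ]) hx0
  obtain rfl : k = 0 := by omega
  simpa using hμ

/-- The space is spanned by the invariants together with the image of the (shifted) Casimir. -/
theorem exists_add_casimir (v : V) : ∃ u w : V, E u = 0 ∧ F u = 0 ∧
    v = u + (casimir E H F w - w) := by
  set T : End ℂ V := casimir E H F - 1 with hT
  have hc := LinearMap.isCompl_iSup_ker_pow_iInf_range_pow T
  obtain ⟨u, hu, w, hw, rfl⟩ := Submodule.mem_sup.mp
    (hc.sup_eq_top ▸ Submodule.mem_top : v ∈ _)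
  have hker : ∀ x ∈ ⨆ n, LinearMap.ker (T ^ n), x ∈ (casimir E H F).maxGenEigenspace 1 := by
    intro x hx
    suffices hle : (⨆ n, LinearMap.ker (T ^ n)) ≤ (casimir E H F).maxGenEigenspace 1 from hle hx
    refine iSup_le fun n y hy => ?_
    rw [End.mem_maxGenEigenspace]
    exact ⟨n, by simpa [hT] using hy⟩
  have hu' := hker u hu
  have hH := t.h_apply_eq_zero_of_mem_maxGenEigenspace_one hu'
  have hE := t.h_apply_eq_zero_of_mem_maxGenEigenspace_one
    (End.mapsTo_maxGenEigenspace_of_comm t.commute_casimir_e 1 hu')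
  have hF := t.h_apply_eq_zero_of_mem_maxGenEigenspace_one
    (End.mapsTo_maxGenEigenspace_of_comm (t.casimir_swap ▸ t.swap.commute_casimir_e) 1 hu')
  rw [t.he_apply, hH, map_zero, zero_add, smul_eq_zero] at hE
  rw [t.hf_apply, hH, map_zero, zero_sub, neg_eq_zero, smul_eq_zero] at hF
  have hw1 : w ∈ LinearMap.range (T ^ 1) := (Submodule.mem_iInf _).mp hw 1
  obtain ⟨w', rfl⟩ := hw1
  exact ⟨u, w', hE.resolve_left two_ne_zero, hF.resolve_left two_ne_zero, by simp [hT]⟩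

end SlTwoRel
end SlTwo

section Distinguished

open LieAlgebra

variable {L : Type*} [LieRing L] [LieAlgebra ℂ L]

theorem IsSl2Triple.slTwoRel_ad {h e f : L} (t : IsSl2Triple h e f) :
    SlTwoRel (ad ℂ L e) (ad ℂ L h) (ad ℂ L f) where
  ef := by ext x; simp [← t.lie_e_f]
  he := by
    ext x
    have : ⁅⁅h, e⁆, x⁆ = (2 : ℂ) • ⁅e, x⁆ := by rw [t.lie_h_e_nsmul, two_nsmul, add_lie, two_smul]
    simp [← this]
  hf := by
    ext x
    have : ⁅⁅h, f⁆, x⁆ = -((2 : ℂ) • ⁅f, x⁆) := by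
      rw [t.lie_h_f_nsmul, two_nsmul, neg_lie, add_lie, two_smul]
    simp [← this]

theorem SlTwoRel.f_apply_eq_zero {V : Type*} [AddCommGroup V] [Module ℂ V] [FiniteDimensional ℂ V]
    {E H F : End ℂ V} (t : SlTwoRel E H F) {v : V} (he : E v = 0) (hh : H v = 0) : F v = 0 := by
  by_contra hne
  obtain ⟨k, hk⟩ := t.exists_nat_of_e_apply_eq_zero (v := F v) (μ := -2)
    (by rw [t.ef_apply, he, hh, map_zero, add_zero]) hne
    (by rw [t.hf_apply, hh, map_zero, zero_sub, neg_smul])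
  have : ((-2 : ℤ) : ℂ) = ((k : ℤ) : ℂ) := by push_cast; exact hk
  have := Int.cast_injective this
  omega

variable [FiniteDimensional ℂ L]

theorem apply_eq_smul_of_mem_maxGenEigenspace {V : Type*} [AddCommGroup V] [Module ℂ V]
    [FiniteDimensional ℂ V] {n s : End ℂ V} (hc : Commute n s) (hn : IsNilpotent n)
    (hs : s.IsSemisimple) {μ : ℂ} {v : V} (hv : v ∈ (n + s).maxGenEigenspace μ) :
    s v = μ • v := by
  rw [← End.mem_eigenspace_iff, ← (End.isFinitelySemisimple_iff_isSemisimple.mpr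
    hs).maxGenEigenspace_eq_eigenspace]
  rw [End.mem_maxGenEigenspace] at hv ⊢
  obtain ⟨k, hk⟩ := hv
  obtain ⟨m, hm⟩ := hn
  have h1 : Commute (n + s - μ • 1) n := by
    refine ((Commute.refl n).add_left hc.symm).sub_left ?_
    exact (Commute.one_left n).smul_left μ
  have h2 : s - μ • 1 = (n + s - μ • 1) - n := by abel
  refine ⟨k + m, ?_⟩
  rw [h2, sub_eq_neg_add, h1.symm.neg_left.add_pow, LinearMap.sum_apply]
  refine Finset.sum_eq_zero fun i _ => ?_
  rw [← nsmul_eq_mul', LinearMap.smul_apply, End.mul_apply]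
  rcases le_or_gt m i with hi | hi
  · rw [neg_pow, pow_eq_zero_of_le hi hm, mul_zero, LinearMap.zero_apply, smul_zero]
  · rw [End.pow_map_zero_of_le (by omega : k ≤ k + m - i) hk, map_zero, smul_zero]

theorem exists_ad_eq_of_isSemisimple_part [IsKilling ℂ L] {x : L} {n s : End ℂ L}
    (hc : Commute n s) (hn : IsNilpotent n) (hs : s.IsSemisimple) (hx : ad ℂ L x = n + s) :
    ∃ z, ad ℂ L z = s := by
  have hleib : ∀ a b, s ⁅a, b⁆ = ⁅a, s b⁆ - ⁅b, s a⁆ := by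
    intro a b
    have ha : a ∈ ⨆ μ, (n + s).maxGenEigenspace μ :=
      End.iSup_maxGenEigenspace_eq_top (n + s) ▸ Submodule.mem_top
    have hb : b ∈ ⨆ μ, (n + s).maxGenEigenspace μ :=
      End.iSup_maxGenEigenspace_eq_top (n + s) ▸ Submodule.mem_top
    induction ha using Submodule.iSup_induction' with
    | zero => simp
    | add a a' _ _ h h' => simp only [map_add, add_lie, lie_add, h, h']; abel
    | mem μ a ha =>
      induction hb using Submodule.iSup_induction' with
      | zero => simp
      | add a a' _ _ h h' => simp only [map_add, add_lie, lie_add, h, h']; abel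
      | mem ν b hb =>
        rw [apply_eq_smul_of_mem_maxGenEigenspace hc hn hs ha,
          apply_eq_smul_of_mem_maxGenEigenspace hc hn hs hb]
        rw [← hx] at ha hb
        have hab : ⁅a, b⁆ ∈ (n + s).maxGenEigenspace (μ + ν) :=
          hx ▸ LieModule.lie_mem_maxGenEigenspace_toEnd (M := L) ha hb
        rw [apply_eq_smul_of_mem_maxGenEigenspace hc hn hs hab, lie_smul, lie_smul,
          ← lie_skew b a, add_smul]
        module
  let D : LieDerivation ℂ L L := { toLinearMap := s, leibniz' := hleib }
  obtain ⟨z, hz⟩ := LieDerivation.IsKilling.exists_eq_ad D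
  exact ⟨z, by ext y; exact (LieDerivation.ad_apply_apply ℂ L z y).symm.trans congr($hz y)⟩

theorem IsDistinguished.eq_zero_of_lie_eq_zero [IsKilling ℂ L] {h e f : L} (t : IsSl2Triple h e f)
    (hd : IsDistinguished L e) {x : L} (hxe : ⁅e, x⁆ = 0) (hxh : ⁅h, x⁆ = 0) : x = 0 := by
  have T := t.slTwoRel_ad
  have hnil : ∀ y, ⁅e, y⁆ = 0 → ⁅h, y⁆ = 0 → IsNilpotent (ad ℂ L y) := by
    intro y hye hyh
    obtain ⟨n, hn, s, hs, hnn, hss, hy⟩ := (ad ℂ L y).exists_isNilpotent_isSemisimple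
    have hc : Commute n s := Algebra.commute_of_mem_adjoin_singleton_of_commute hs
      (Algebra.commute_of_mem_adjoin_self hn).symm
    obtain ⟨z, rfl⟩ := exists_ad_eq_of_isSemisimple_part hc hnn hss hy
    have hz : ⁅z, e⁆ = 0 := by
      have := apply_eq_smul_of_mem_maxGenEigenspace hc hnn hss (μ := 0) (v := e) (by
        rw [← hy, End.mem_maxGenEigenspace]
        exact ⟨1, by rw [pow_one, zero_smul, sub_zero, ad_apply, ← lie_skew, hye, neg_zero]⟩)
      simpa using this
    rw [hd z hz hss, map_zero, add_zero] at hy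
    rwa [hy]
  have hk : ∀ y, ⁅e, y⁆ = 0 → ⁅h, y⁆ = 0 → killingForm ℂ L y y = 0 := by
    intro y hye hyh
    rw [killingForm_apply_apply]
    have : IsNilpotent (ad ℂ L y ∘ₗ ad ℂ L y) := (Commute.refl _).isNilpotent_mul_left (hnil y hye hyh)
    exact (LinearMap.isNilpotent_trace_of_isNilpotent this).eq_zero
  have inv : ∀ a b c : L, killingForm ℂ L a ⁅b, c⁆ = killingForm ℂ L ⁅a, b⁆ c := fun a b c =>
    (LieModule.traceForm_apply_lie_apply ℂ L L a b c).symm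
  have symm : ∀ a b : L, killingForm ℂ L a b = killingForm ℂ L b a :=
    LieModule.traceForm_comm ℂ L L
  have hxf : ⁅f, x⁆ = 0 := T.f_apply_eq_zero hxe hxh
  refine (IsKilling.killingForm_nondegenerate ℂ L).1 x fun y => ?_
  obtain ⟨u, w, hue, huf, rfl⟩ := T.exists_add_casimir y
  have huh : ⁅h, u⁆ = 0 := by
    rw [← t.lie_e_f, lie_lie]
    rw [ad_apply] at hue huf
    rw [hue, huf, lie_zero, lie_zero, sub_zero]
  have hxu : killingForm ℂ L x u = 0 := by
    have := hk (x + u) (by rw [lie_add, hxe, zero_add]; exact hue) (by rw [lie_add, hxh, huh, zero_add])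
    simp only [map_add, LinearMap.add_apply, hk x hxe hxh, hk u hue huh, symm u x] at this
    linear_combination this / 2
  have hkill : ∀ a z, ⁅a, x⁆ = 0 → killingForm ℂ L x ⁅a, z⁆ = 0 := fun a z ha => by
    rw [inv, ← lie_skew, ha, neg_zero, map_zero, LinearMap.zero_apply]
  have hcas : SlTwoRel.casimir (ad ℂ L e) (ad ℂ L h) (ad ℂ L f) w - w =
      ⁅h, ⁅h, w⁆⁆ + (2 : ℂ) • ⁅h, w⁆ + (4 : ℂ) • ⁅f, ⁅e, w⁆⁆ := by
    simp only [SlTwoRel.casimir, pow_two, End.mul_apply, LinearMap.add_apply, LinearMap.smul_apply,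
      End.one_apply, map_add, ad_apply]
    module
  rw [map_add, hxu, hcas]
  simp [hkill _ _ hxh, hkill _ _ hxf]

theorem finrank_eigenspace_ad_eq {h e f : L} (t : IsSl2Triple h e f)
    (h0 : ∀ x : L, ⁅e, x⁆ = 0 → ⁅h, x⁆ = 0 → x = 0) :
    finrank ℂ ((ad ℂ L h).eigenspace 0) = finrank ℂ ((ad ℂ L h).eigenspace 2) := by
  have T := t.slTwoRel_ad
  have he : ∀ x ∈ (ad ℂ L h).eigenspace 0, ad ℂ L e x ∈ (ad ℂ L h).eigenspace 2 := by
    intro x hx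
    rw [End.mem_eigenspace_iff] at hx ⊢
    rw [T.he_apply, hx, zero_smul, map_zero, zero_add]
  have hf : ∀ x ∈ (ad ℂ L h).eigenspace 2, ad ℂ L f x ∈ (ad ℂ L h).eigenspace 0 := by
    intro x hx
    rw [End.mem_eigenspace_iff] at hx ⊢
    rw [T.hf_apply, hx, map_smul, sub_self, zero_smul]
  refine le_antisymm (LinearMap.finrank_le_finrank_of_injective
    (f := (ad ℂ L e).restrict he) ?_) (LinearMap.finrank_le_finrank_of_injective
    (f := (ad ℂ L f).restrict hf) ?_)
  · refine (injective_iff_map_eq_zero _).mpr fun x hx => ?_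
    have hx' : ⁅e, (x : L)⁆ = 0 := congrArg Subtype.val hx
    have := End.mem_eigenspace_iff.mp x.2
    exact Subtype.ext (h0 x hx' (by simpa using this))
  · refine (injective_iff_map_eq_zero _).mpr fun x hx => ?_
    have hx' : ad ℂ L f (x : L) = 0 := congrArg Subtype.val hx
    have hx2 := End.mem_eigenspace_iff.mp x.2
    by_contra hne
    obtain ⟨k, hk⟩ := T.swap.exists_nat_of_e_apply_eq_zero hx' (by simpa using hne) (μ := -2)
      (by rw [LinearMap.neg_apply, hx2, neg_smul])
    have : ((-2 : ℤ) : ℂ) = ((k : ℤ) : ℂ) := by push_cast; exact hk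
    have := Int.cast_injective this
    omega

end Distinguished

section Lattice

/-- The parity sign `(-1) ^ n`. -/
def paritySign (n : ℤ) : ℤ := if n % 2 = 0 then 1 else -1

theorem paritySign_add (m n : ℤ) : paritySign (m + n) = paritySign m * paritySign n := by
  rcases Int.emod_two_eq_zero_or_one m with hm | hm <;>
    rcases Int.emod_two_eq_zero_or_one n with hn | hn <;>
    simp [paritySign, Int.add_emod, hm, hn]

theorem paritySign_mul_self (n : ℤ) : paritySign n * paritySign n = 1 := by
  rcases Int.emod_two_eq_zero_or_one n with hn | hn <;> simp [paritySign, hn]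

/-- A positive definite integral bilinear form, not assumed symmetric. -/
structure PosForm (Λ : Type*) [AddCommGroup Λ] where
  form : Λ → Λ → ℤ
  add_left : ∀ x y z, form (x + y) z = form x z + form y z
  add_right : ∀ x y z, form x (y + z) = form x y + form x z
  pos : ∀ x, x ≠ 0 → 0 < form x x

namespace PosForm

variable {Λ : Type*} [AddCommGroup Λ] (F : PosForm Λ)

/-- The symmetrization of a form. -/
def ip (x y : Λ) : ℤ := F.form x y + F.form y x

theorem zero_left (y : Λ) : F.form 0 y = 0 := by simpa using F.add_left 0 0 y

theorem zero_right (x : Λ) : F.form x 0 = 0 := by simpa using F.add_right x 0 0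

theorem neg_left (x y : Λ) : F.form (-x) y = -F.form x y := by
  have := F.add_left (-x) x y
  rw [neg_add_cancel, zero_left] at this
  omega

theorem neg_right (x y : Λ) : F.form x (-y) = -F.form x y := by
  have := F.add_right x (-y) y
  rw [neg_add_cancel, zero_right] at this
  omega

theorem sub_left (x y z : Λ) : F.form (x - y) z = F.form x z - F.form y z := by
  rw [sub_eq_add_neg, add_left, neg_left, sub_eq_add_neg]

theorem sub_right (x y z : Λ) : F.form x (y - z) = F.form x y - F.form x z := by
  rw [sub_eq_add_neg, add_right, neg_right, sub_eq_add_neg]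

theorem ip_comm (x y : Λ) : F.ip x y = F.ip y x := add_comm _ _

theorem ip_add_left (x y z : Λ) : F.ip (x + y) z = F.ip x z + F.ip y z := by
  simp only [ip, add_left, add_right]; ring

theorem ip_add_right (x y z : Λ) : F.ip x (y + z) = F.ip x y + F.ip x z := by
  simp only [ip, add_left, add_right]; ring

theorem ip_neg_left (x y : Λ) : F.ip (-x) y = -F.ip x y := by
  simp only [ip, neg_left, neg_right]; ring

theorem ip_neg_right (x y : Λ) : F.ip x (-y) = -F.ip x y := by
  simp only [ip, neg_left, neg_right]; ring

theorem ip_sub_left (x y z : Λ) : F.ip (x - y) z = F.ip x z - F.ip y z := by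
  simp only [ip, sub_left, sub_right]; ring

theorem ip_sub_right (x y z : Λ) : F.ip x (y - z) = F.ip x y - F.ip x z := by
  simp only [ip, sub_left, sub_right]; ring

theorem form_add_self (x y : Λ) : F.form (x + y) (x + y) = F.form x x + F.form y y + F.ip x y := by
  simp only [ip, add_left, add_right]; ring

theorem form_sub_self (x y : Λ) : F.form (x - y) (x - y) = F.form x x + F.form y y - F.ip x y := by
  simp only [ip, sub_left, sub_right]; ring

theorem ip_self (x : Λ) : F.ip x x = 2 * F.form x x := by rw [ip, two_mul]

theorem form_nonneg (x : Λ) : 0 ≤ F.form x x := by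
  by_cases h : x = 0
  · simp [h, zero_left]
  · exact (F.pos x h).le

theorem neg_one_le_ip {x y : Λ} (hx : F.form x x = 1) (hy : F.form y y = 1) (h : x + y ≠ 0) :
    -1 ≤ F.ip x y := by
  have := F.pos _ h
  rw [form_add_self] at this
  omega

theorem ip_le_one {x y : Λ} (hx : F.form x x = 1) (hy : F.form y y = 1) (h : x ≠ y) :
    F.ip x y ≤ 1 := by
  have := F.pos _ (sub_ne_zero.mpr h)
  rw [form_sub_self] at this
  omega

/-- The cocycle sign of a form. -/
def eps (x y : Λ) : ℤ := paritySign (F.form x y)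

end PosForm

/-- Elements `X α`, `H α` of a Lie algebra multiplying as in the Lie algebra constructed from a
lattice by means of the cocycle `eps`. -/
structure ChevalleySystem {Λ : Type*} [AddCommGroup Λ] (F : PosForm Λ) (L : Type*) [LieRing L]
    [LieAlgebra ℂ L] where
  X : Λ → L
  H : Λ → L
  H_add : ∀ α β, H (α + β) = H α + H β
  X_eq_zero : ∀ α, F.form α α ≠ 1 → X α = 0
  lie_H_H : ∀ α β, ⁅H α, H β⁆ = 0
  lie_H_X : ∀ α β, ⁅H α, X β⁆ = (F.ip α β : ℂ) • X β
  lie_X_X : ∀ α β, F.form α α = 1 → F.form β β = 1 → α + β ≠ 0 →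
    ⁅X α, X β⁆ = (F.eps α β : ℂ) • X (α + β)
  lie_X_neg : ∀ α, F.form α α = 1 → ⁅X α, X (-α)⁆ = -H α

/-- A lattice form together with a grading, used to build minuscule representations. -/
structure LevelForm (Λ : Type*) [AddCommGroup Λ] extends PosForm Λ where
  lev : Λ → ℤ
  lev_add : ∀ x y, lev (x + y) = lev x + lev y

namespace LevelForm

variable {Λ : Type*} [AddCommGroup Λ] (F : LevelForm Λ)

theorem lev_zero : F.lev 0 = 0 := by simpa using F.lev_add 0 0

theorem lev_sub (x y : Λ) : F.lev (x - y) = F.lev x - F.lev y := by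
  have := F.lev_add (x - y) y
  rw [sub_add_cancel] at this
  omega

/-- The weights: the norm-two vectors of level one. -/
def IsWt (x : Λ) : Prop := F.form x x = 1 ∧ F.lev x = 1

/-- The matrix coefficient from `μ - α` to `μ` of the operator of a root `α`. -/
noncomputable def coefX (α μ : Λ) : ℂ :=
  open scoped Classical in
  if F.form α α = 1 ∧ F.IsWt μ ∧ F.IsWt (μ - α) then (F.eps α (μ - α) : ℂ) else 0

/-- The diagonal coefficient of the operator of a coroot `α`. -/
noncomputable def coefH (α μ : Λ) : ℂ :=
  open scoped Classical in if F.IsWt μ then (F.ip α μ : ℂ) else 0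

/-- The operator attached to a root `α`. -/
noncomputable def opX (α : Λ) : End ℂ (Λ → ℂ) where
  toFun v μ := F.coefX α μ * v (μ - α)
  map_add' v w := by ext μ; simp [mul_add]
  map_smul' c v := by ext μ; simp [mul_left_comm]

/-- The operator attached to a coroot `α`. -/
noncomputable def opH (α : Λ) : End ℂ (Λ → ℂ) where
  toFun v μ := F.coefH α μ * v μ
  map_add' v w := by ext μ; simp [mul_add]
  map_smul' c v := by ext μ; simp [mul_left_comm]

theorem opX_apply (α : Λ) (v : Λ → ℂ) (μ : Λ) : F.opX α v μ = F.coefX α μ * v (μ - α) := rfl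

theorem opH_apply (α : Λ) (v : Λ → ℂ) (μ : Λ) : F.opH α v μ = F.coefH α μ * v μ := rfl

theorem opH_add (α β : Λ) : F.opH (α + β) = F.opH α + F.opH β := by
  ext v μ
  simp only [opH_apply, LinearMap.add_apply, Pi.add_apply, coefH, F.ip_add_left]
  split_ifs <;> push_cast <;> ring

theorem opX_eq_zero (α : Λ) (h : F.form α α ≠ 1) : F.opX α = 0 := by
  ext v μ
  simp [opX_apply, coefX, h]

theorem opH_mul_opH (α β : Λ) : F.opH α * F.opH β - F.opH β * F.opH α = 0 := by
  ext v μ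
  simp only [opH_apply, LinearMap.sub_apply, Pi.sub_apply, End.mul_apply, LinearMap.zero_apply,
    Pi.zero_apply]
  ring

theorem opH_mul_opX (α β : Λ) :
    F.opH α * F.opX β - F.opX β * F.opH α = (F.ip α β : ℂ) • F.opX β := by
  ext v μ
  simp only [opH_apply, opX_apply, LinearMap.sub_apply, Pi.sub_apply, End.mul_apply,
    LinearMap.smul_apply, Pi.smul_apply, smul_eq_mul]
  by_cases h : F.form β β = 1 ∧ F.IsWt μ ∧ F.IsWt (μ - β)
  · simp only [coefH, h.2.1, h.2.2, if_true, F.ip_sub_right]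
    push_cast
    ring
  · simp [coefX, h]

theorem isWt_sub_iff {μ α : Λ} (hμ : F.IsWt μ) (hα : F.form α α = 1) (hl : F.lev α = 0) :
    F.IsWt (μ - α) ↔ F.ip α μ = 1 := by
  have h1 := hμ.1
  have h2 := hμ.2
  have h3 := F.ip_comm α μ
  rw [IsWt, F.form_sub_self, lev_sub]
  omega

theorem ip_mem_of_isWt {μ α : Λ} (hμ : F.IsWt μ) (hα : F.form α α = 1) (hl : F.lev α = 0) :
    -1 ≤ F.ip α μ ∧ F.ip α μ ≤ 1 := by
  constructor
  · refine F.neg_one_le_ip hα hμ.1 fun h => ?_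
    have := F.lev_add α μ
    rw [h, lev_zero, hl, hμ.2] at this
    omega
  · refine F.ip_le_one hα hμ.1 fun h => ?_
    have := hμ.2
    rw [← h, hl] at this
    omega

theorem eps_add_left (x y z : Λ) : F.eps (x + y) z = F.eps x z * F.eps y z := by
  rw [PosForm.eps, F.add_left, paritySign_add]; rfl

theorem eps_add_right (x y z : Λ) : F.eps x (y + z) = F.eps x y * F.eps x z := by
  rw [PosForm.eps, F.add_right, paritySign_add]; rfl

theorem eps_comm (x y : Λ) : F.eps x y = paritySign (F.ip x y) * F.eps y x := by
  have h : F.form x y = F.ip x y + F.form y x - 2 * F.form y x := by rw [PosForm.ip]; ring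
  have h2 : paritySign (-(2 * F.form y x)) = 1 := by
    rw [paritySign, if_pos (by omega)]
  rw [PosForm.eps, h, sub_eq_add_neg, paritySign_add, paritySign_add, h2, mul_one]; rfl

theorem opX_mul_opX {α β : Λ} (hα : F.form α α = 1) (hβ : F.form β β = 1) (hα' : F.lev α = 0)
    (hβ' : F.lev β = 0) (hαβ : α + β ≠ 0) :
    F.opX α * F.opX β - F.opX β * F.opX α = (F.eps α β : ℂ) • F.opX (α + β) := by
  ext v μ
  simp only [opX_apply, LinearMap.sub_apply, Pi.sub_apply, End.mul_apply,
    LinearMap.smul_apply, Pi.smul_apply, smul_eq_mul]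
  have e1 : μ - α - β = μ - (α + β) := by abel
  have e2 : μ - β - α = μ - (α + β) := by abel
  rw [e1, e2, ← mul_assoc, ← mul_assoc, ← mul_assoc, ← sub_mul]
  congr 1
  by_cases hμ : F.IsWt μ
  swap
  · simp [coefX, hμ]
  by_cases hl : F.IsWt (μ - (α + β))
  swap
  · simp [coefX, hl, e1, e2]
  have a1 := F.ip_mem_of_isWt hμ hα hα'
  have b1 := F.ip_mem_of_isWt hμ hβ hβ'
  have c1 := F.neg_one_le_ip hα hβ hαβ
  have s1 : F.ip α μ + F.ip β μ - F.ip α β = 2 := by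
    have h1 := hl.1
    have h2 := hμ.1
    rw [F.form_sub_self, F.form_add_self, F.ip_comm μ, F.ip_add_left] at h1
    omega
  have ea : F.eps α (μ - α) = F.eps α β * F.eps α (μ - (α + β)) := by
    rw [← eps_add_right, ← e1]; congr 1; abel
  have eb : F.eps β (μ - β) = F.eps β α * F.eps β (μ - (α + β)) := by
    rw [← eps_add_right, ← e2]; congr 1; abel
  simp only [coefX, hα, hβ, hμ, hl, e1, e2, true_and, and_true, F.isWt_sub_iff hμ hα hα',
    F.isWt_sub_iff hμ hβ hβ', ea, eb, F.form_add_self, eps_add_left, F.eps_comm β α,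
    F.ip_comm β α]
  rcases (by omega : (F.ip α μ = 1 ∧ F.ip β μ = 1 ∧ F.ip α β = 0) ∨
    (F.ip α μ = 1 ∧ F.ip β μ = 0 ∧ F.ip α β = -1) ∨
    (F.ip α μ = 0 ∧ F.ip β μ = 1 ∧ F.ip α β = -1)) with ⟨h1, h2, h3⟩ | ⟨h1, h2, h3⟩ | ⟨h1, h2, h3⟩ <;>
  · simp [h1, h2, h3, paritySign]
    try ring

theorem opX_mul_opX_neg {α : Λ} (hα : F.form α α = 1) (hα' : F.lev α = 0) :
    F.opX α * F.opX (-α) - F.opX (-α) * F.opX α = -F.opH α := by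
  ext v μ
  simp only [opX_apply, opH_apply, LinearMap.sub_apply, Pi.sub_apply, End.mul_apply,
    LinearMap.neg_apply, Pi.neg_apply]
  have hn : F.form (-α) (-α) = 1 := by rw [F.neg_left, F.neg_right, neg_neg, hα]
  have hn' : F.lev (-α) = 0 := by
    have := F.lev_sub 0 α
    rwa [zero_sub, lev_zero, hα', sub_zero] at this
  have e1 : μ - α - -α = μ := by abel
  have e2 : μ - -α - α = μ := by abel
  rw [e1, e2, ← mul_assoc, ← mul_assoc, ← sub_mul, ← neg_mul]
  congr 1
  by_cases hμ : F.IsWt μ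
  swap
  · simp [coefX, coefH, hμ]
  have a1 := F.ip_mem_of_isWt hμ hα hα'
  have h2 : F.IsWt (μ - -α) ↔ F.ip α μ = -1 := by
    rw [F.isWt_sub_iff hμ hn hn', F.ip_neg_left]; omega
  have ea : F.eps α (μ - α) = -F.eps α μ := by
    have : F.eps α (-α) = -1 := by rw [PosForm.eps, F.neg_right, hα]; rfl
    rw [sub_eq_add_neg, eps_add_right, this, mul_neg_one]
  have ec : F.eps (-α) μ = F.eps α μ := by
    rw [PosForm.eps, PosForm.eps, F.neg_left, paritySign, paritySign]
    congr 1
    simp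
  have eb : F.eps (-α) (μ - -α) = -F.eps α μ := by
    have h1 : F.eps (-α) (μ - -α) = F.eps (-α) μ * F.eps (-α) α := by
      rw [← eps_add_right, sub_neg_eq_add]
    have h2 : F.eps (-α) α = -1 := by rw [PosForm.eps, F.neg_left, hα]; rfl
    rw [h1, h2, ec, mul_neg_one]
  have hs : (F.eps α μ : ℂ) * F.eps α μ = 1 := by
    exact_mod_cast paritySign_mul_self _
  simp only [coefX, coefH, hα, hn, hμ, e1, e2, true_and, and_true, F.isWt_sub_iff hμ hα hα',
    h2, ea, eb, ec, if_true]
  rcases (by omega : F.ip α μ = 1 ∨ F.ip α μ = 0 ∨ F.ip α μ = -1) with h | h | h <;>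
  · simp [h, hs]

end LevelForm

end Lattice

section Serre

open LieAlgebra CartanMatrix

/-- The image in the Serre presentation of `𝔢₇` of a generator of the free Lie algebra. -/
noncomputable def e7Gen (g : CartanMatrix.Generators (Fin 7)) : e₇ ℂ :=
  LieSubmodule.Quotient.mk' (Relations.toIdeal ℂ CartanMatrix.E₇) (FreeLieAlgebra.of ℂ g)

theorem exists_e7_lieHom_of_forall_mem_toSet {M : Type*} [LieRing M] [LieAlgebra ℂ M]
    (ψ : FreeLieAlgebra ℂ (CartanMatrix.Generators (Fin 7)) →ₗ⁅ℂ⁆ M)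
    (hψ : ∀ r ∈ Relations.toSet ℂ CartanMatrix.E₇, ψ r = 0) :
    ∃ φ : e₇ ℂ →ₗ⁅ℂ⁆ M, ∀ g, φ (e7Gen g) = ψ (FreeLieAlgebra.of ℂ g) := by
  have hle : (Relations.toIdeal ℂ CartanMatrix.E₇) ≤ ψ.ker := by
    rw [Relations.toIdeal, LieSubmodule.lieSpan_le]
    exact fun r hr => LieHom.mem_ker.mpr (hψ r hr)
  let φ₀ : e₇ ℂ →ₗ[ℂ] M := Submodule.liftQ (Relations.toIdeal ℂ CartanMatrix.E₇).toSubmodule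
    (ψ : FreeLieAlgebra ℂ (CartanMatrix.Generators (Fin 7)) →ₗ[ℂ] M)
    (fun x hx => LieHom.mem_ker.mp (hle hx))
  refine ⟨{ φ₀ with map_lie' := ?_ }, fun g => rfl⟩
  intro x y
  obtain ⟨x, rfl⟩ := LieSubmodule.Quotient.surjective_mk' _ x
  obtain ⟨y, rfl⟩ := LieSubmodule.Quotient.surjective_mk' _ y
  exact ψ.map_lie x y

theorem eq_top_of_e7Gen_mem (K : LieSubalgebra ℂ (e₇ ℂ)) (hK : ∀ g, e7Gen g ∈ K) : K = ⊤ := by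
  rw [eq_top_iff]
  intro x _
  obtain ⟨x, rfl⟩ := LieSubmodule.Quotient.surjective_mk' _ x
  let π₀ : FreeLieAlgebra ℂ (CartanMatrix.Generators (Fin 7)) →ₗ[ℂ] e₇ ℂ :=
    (Relations.toIdeal ℂ CartanMatrix.E₇).toSubmodule.mkQ
  let π : FreeLieAlgebra ℂ (CartanMatrix.Generators (Fin 7)) →ₗ⁅ℂ⁆ e₇ ℂ :=
    { π₀ with map_lie' := fun {x y} => rfl }
  have h : K.incl.comp (FreeLieAlgebra.lift ℂ fun g => (⟨e7Gen g, hK g⟩ : K)) = π := by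
    ext g
    simp
    rfl
  have h2 : (LieSubmodule.Quotient.mk' (Relations.toIdeal ℂ CartanMatrix.E₇)) x = π x := rfl
  rw [h2, ← h]
  exact Subtype.property _

variable {M : Type*} [LieRing M] [LieAlgebra ℂ M] {Λ : Type*} [AddCommGroup Λ] {F : PosForm Λ}

theorem ChevalleySystem.exists_lieHom_e7 (C : ChevalleySystem F M) (β : Fin 7 → Λ)
    (hβ : ∀ i j, F.ip (β i) (β j) = CartanMatrix.E₇ i j) :
    ∃ φ : e₇ ℂ →ₗ⁅ℂ⁆ M, (∀ i, φ (e7Gen (.H i)) = C.H (β i)) ∧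
      (∀ i, φ (e7Gen (.E i)) = C.X (β i)) ∧ ∀ i, φ (e7Gen (.F i)) = -C.X (-β i) := by
  have hn : ∀ i, F.form (β i) (β i) = 1 := by
    intro i
    have := hβ i i
    rw [F.ip_self, CartanMatrix.E₇_diag] at this
    omega
  have hn' : ∀ i, F.form (-β i) (-β i) = 1 := by
    intro i
    rw [F.neg_left, F.neg_right, neg_neg, hn]
  have hcm : ∀ i j, i ≠ j → CartanMatrix.E₇ i j = 0 ∨ CartanMatrix.E₇ i j = -1 := by
    intro i j
    fin_cases i <;> fin_cases j <;> simp [CartanMatrix.E₇]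
  let gen : CartanMatrix.Generators (Fin 7) → M
    | .H i => C.H (β i)
    | .E i => C.X (β i)
    | .F i => -C.X (-β i)
  obtain ⟨φ, hφ⟩ := exists_e7_lieHom_of_forall_mem_toSet (FreeLieAlgebra.lift ℂ gen) (by
    have key : ∀ i j (γ : Fin 7 → Λ), (∀ i j, F.ip (γ i) (γ j) = CartanMatrix.E₇ i j) →
        ((ad ℂ M (C.X (γ i))) ^ (-CartanMatrix.E₇ i j).toNat) ⁅C.X (γ i), C.X (γ j)⁆ = 0 := by
      intro i j γ hγ
      have hn : ∀ i, F.form (γ i) (γ i) = 1 := by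
        intro i
        have := hγ i i
        rw [F.ip_self, CartanMatrix.E₇_diag] at this
        omega
      by_cases hij : i = j
      · subst hij
        rw [lie_self, map_zero]
      · have hs : γ i + γ j ≠ 0 := by
          intro h
          have h1 := F.form_add_self (γ i) (γ j)
          rw [h, F.zero_left, hn, hn, hγ] at h1
          rcases hcm i j hij with h2 | h2 <;> omega
        rw [C.lie_X_X _ _ (hn i) (hn j) hs]
        rcases hcm i j hij with h2 | h2
        · have h3 : F.form (γ i + γ j) (γ i + γ j) ≠ 1 := by
            rw [F.form_add_self, hn, hn, hγ, h2]; omega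
          rw [C.X_eq_zero _ h3, smul_zero, map_zero]
        · have h3 : F.form (γ i + (γ i + γ j)) (γ i + (γ i + γ j)) = 3 := by
            rw [F.form_add_self, F.form_add_self, F.ip_add_right, F.ip_self, hn, hn, hγ, h2]; rfl
          have h4 : F.form (γ i + γ j) (γ i + γ j) = 1 := by
            rw [F.form_add_self, hn, hn, hγ, h2]; omega
          have h5 : γ i + (γ i + γ j) ≠ 0 := by
            intro h
            rw [h, F.zero_left] at h3
            omega
          have h6 : (-CartanMatrix.E₇ i j).toNat = 1 := by rw [h2]; rfl
          rw [h6, pow_one, map_smul, ad_apply, C.lie_X_X _ _ (hn i) h4 h5,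
            C.X_eq_zero _ (by rw [h3]; omega), smul_zero, smul_zero]
    have hadE : ∀ (x y : FreeLieAlgebra ℂ (CartanMatrix.Generators (Fin 7))) (n : ℕ),
        FreeLieAlgebra.lift ℂ gen ((ad ℂ _ x ^ n) y) =
          (ad ℂ M (FreeLieAlgebra.lift ℂ gen x) ^ n) (FreeLieAlgebra.lift ℂ gen y) := by
      intro x y n
      induction n with
      | zero => simp
      | succ n ih => rw [pow_succ', End.mul_apply, ad_apply, LieHom.map_lie, ih, pow_succ',
          End.mul_apply, ad_apply]
    rintro r (((((⟨⟨i, j⟩, rfl⟩ | ⟨⟨i, j⟩, rfl⟩) | ⟨⟨i, j⟩, rfl⟩) | ⟨⟨i, j⟩, rfl⟩) |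
      ⟨⟨i, j⟩, rfl⟩) | ⟨⟨i, j⟩, rfl⟩)
    · simp [Relations.HH, gen, C.lie_H_H]
    · simp only [Relations.EF, Function.uncurry_apply_pair, Function.comp_apply]
      split_ifs with hij
      · subst hij
        simp [gen, C.lie_X_neg _ (hn i)]
      · have h3 : 2 ≤ F.form (β i + -β j) (β i + -β j) := by
          rw [F.form_add_self, hn, hn', F.ip_neg_right, hβ]
          rcases hcm i j hij with h2 | h2 <;> omega
        have h5 : β i + -β j ≠ 0 := by
          intro h
          rw [h, F.zero_left] at h3
          omega
        simp [gen, C.lie_X_X _ _ (hn i) (hn' j) h5, C.X_eq_zero _ (by omega : F.form (β i + -β j) (β i + -β j) ≠ 1)]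
    · simp [Relations.HE, gen, C.lie_H_X, hβ, Int.cast_smul_eq_zsmul]
    · simp [Relations.HF, gen, C.lie_H_X, hβ, F.ip_neg_right, Int.cast_smul_eq_zsmul]
    · simp only [Relations.adE, Function.uncurry_apply_pair, Function.comp_apply]
      rw [hadE, LieHom.map_lie, FreeLieAlgebra.lift_of_apply, FreeLieAlgebra.lift_of_apply]
      exact key i j β hβ
    · simp only [Relations.adF, Function.uncurry_apply_pair, Function.comp_apply]
      rw [hadE, LieHom.map_lie, FreeLieAlgebra.lift_of_apply, FreeLieAlgebra.lift_of_apply]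
      have h := key i j (fun i => -β i) (fun i j => by rw [F.ip_neg_left, F.ip_neg_right, neg_neg, hβ])
      simp only [gen, lie_neg, neg_lie, neg_neg]
      rw [map_neg, neg_pow, End.mul_apply, h, map_zero])
  exact ⟨φ, fun i => by simp [hφ, gen], fun i => by simp [hφ, gen], fun i => by simp [hφ, gen]⟩

end Serre

section E7Lattice

/-- The root lattice of type `E₇` in the coordinates given by the simple roots (numbered as in
`CartanMatrix.E₇`). -/
abbrev E7Lattice : Type := ℤ × ℤ × ℤ × ℤ × ℤ × ℤ × ℤ

set_option synthInstance.maxSize 1000 in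
instance : DecidableEq E7Lattice :=
  inferInstanceAs (DecidableEq (ℤ × ℤ × ℤ × ℤ × ℤ × ℤ × ℤ))

/-- A bilinear form on the `E₇` lattice whose symmetrization has Gram matrix `CartanMatrix.E₇`. -/
def formE7 : E7Lattice → E7Lattice → ℤ
  | (a₁, a₂, a₃, a₄, a₅, a₆, a₇), (b₁, b₂, b₃, b₄, b₅, b₆, b₇) =>
    a₁ * (b₁ - b₃) + a₂ * (b₂ - b₄) + a₃ * (b₃ - b₄) + a₄ * (b₄ - b₅) + a₅ * (b₅ - b₆) +
      a₆ * (b₆ - b₇) + a₇ * b₇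

theorem formE7_add_left (x y z : E7Lattice) : formE7 (x + y) z = formE7 x z + formE7 y z := by
  obtain ⟨a₁, a₂, a₃, a₄, a₅, a₆, a₇⟩ := x
  obtain ⟨b₁, b₂, b₃, b₄, b₅, b₆, b₇⟩ := y
  obtain ⟨c₁, c₂, c₃, c₄, c₅, c₆, c₇⟩ := z
  simp only [formE7]
  ring

theorem formE7_add_right (x y z : E7Lattice) : formE7 x (y + z) = formE7 x y + formE7 x z := by
  obtain ⟨a₁, a₂, a₃, a₄, a₅, a₆, a₇⟩ := x
  obtain ⟨b₁, b₂, b₃, b₄, b₅, b₆, b₇⟩ := y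
  obtain ⟨c₁, c₂, c₃, c₄, c₅, c₆, c₇⟩ := z
  simp only [formE7]
  ring

/-- Positivity of the form of the `E₈` lattice, viewed as an extension of the `E₇` lattice. -/
theorem formE7_add_sq_pos (x : E7Lattice) (b : ℤ) (h : (x, b) ≠ 0) :
    0 < formE7 x x + b * b - x.2.2.2.2.2.2 * b := by
  obtain ⟨a₁, a₂, a₃, a₄, a₅, a₆, a₇⟩ := x
  by_contra hc
  apply h
  have key : 120 * (formE7 (a₁, a₂, a₃, a₄, a₅, a₆, a₇) (a₁, a₂, a₃, a₄, a₅, a₆, a₇) + b * b -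
      a₇ * b) = 30 * (2 * a₂ - a₄) ^ 2 + 30 * (2 * a₁ - a₃) ^ 2 + 10 * (3 * a₃ - 2 * a₄) ^ 2 +
      30 * (2 * b - a₇) ^ 2 + 10 * (3 * a₇ - 2 * a₆) ^ 2 + 5 * (4 * a₆ - 3 * a₅) ^ 2 +
      3 * (5 * a₅ - 4 * a₄) ^ 2 + 2 * a₄ ^ 2 := by
    simp only [formE7]
    ring
  have hc' := not_lt.mp hc
  simp only at hc'
  have p1 := sq_nonneg (2 * a₂ - a₄)
  have p2 := sq_nonneg (2 * a₁ - a₃)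
  have p3 := sq_nonneg (3 * a₃ - 2 * a₄)
  have p4 := sq_nonneg (2 * b - a₇)
  have p5 := sq_nonneg (3 * a₇ - 2 * a₆)
  have p6 := sq_nonneg (4 * a₆ - 3 * a₅)
  have p7 := sq_nonneg (5 * a₅ - 4 * a₄)
  have p8 := sq_nonneg a₄
  have q1 : 2 * a₂ - a₄ = 0 := pow_eq_zero_iff two_ne_zero |>.mp (by linarith)
  have q2 : 2 * a₁ - a₃ = 0 := pow_eq_zero_iff two_ne_zero |>.mp (by linarith)
  have q3 : 3 * a₃ - 2 * a₄ = 0 := pow_eq_zero_iff two_ne_zero |>.mp (by linarith)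
  have q4 : 2 * b - a₇ = 0 := pow_eq_zero_iff two_ne_zero |>.mp (by linarith)
  have q5 : 3 * a₇ - 2 * a₆ = 0 := pow_eq_zero_iff two_ne_zero |>.mp (by linarith)
  have q6 : 4 * a₆ - 3 * a₅ = 0 := pow_eq_zero_iff two_ne_zero |>.mp (by linarith)
  have q7 : 5 * a₅ - 4 * a₄ = 0 := pow_eq_zero_iff two_ne_zero |>.mp (by linarith)
  have q8 : a₄ = 0 := pow_eq_zero_iff two_ne_zero |>.mp (by linarith)
  simp only [Prod.mk_eq_zero]
  omega

/-- The form on the `E₇` lattice. -/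
def posE7 : PosForm E7Lattice where
  form := formE7
  add_left := formE7_add_left
  add_right := formE7_add_right
  pos x hx := by
    have := formE7_add_sq_pos x 0 (by simpa using hx)
    simpa using this

/-- The `E₈` lattice, graded by the coefficient of the additional simple root. -/
def levelE8 : LevelForm (E7Lattice × ℤ) where
  form x y := formE7 x.1 y.1 + x.2 * y.2 - x.1.2.2.2.2.2.2 * y.2
  add_left x y z := by
    simp only [Prod.fst_add, Prod.snd_add, formE7_add_left]
    ring
  add_right x y z := by
    simp only [Prod.fst_add, Prod.snd_add, formE7_add_right]
    ring
  pos x hx := formE7_add_sq_pos x.1 x.2 hx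
  lev x := x.2
  lev_add x y := rfl

/-- The simple roots. -/
def simpleE7 : Fin 7 → E7Lattice :=
  ![(1,0,0,0,0,0,0), (0,1,0,0,0,0,0), (0,0,1,0,0,0,0), (0,0,0,1,0,0,0), (0,0,0,0,1,0,0),
    (0,0,0,0,0,1,0), (0,0,0,0,0,0,1)]

theorem ip_simpleE7 : ∀ i j, posE7.ip (simpleE7 i) (simpleE7 j) = CartanMatrix.E₇ i j := by
  intro i j
  fin_cases i <;> fin_cases j <;> rfl

/-- The positive roots. -/
def posRootsE7 : List E7Lattice :=
  [(0,0,0,0,0,0,1), (0,0,0,0,0,1,0), (0,0,0,0,1,0,0), (0,0,0,1,0,0,0),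
   (0,0,1,0,0,0,0), (0,1,0,0,0,0,0), (1,0,0,0,0,0,0), (0,0,0,0,0,1,1),
   (0,0,0,0,1,1,0), (0,0,0,1,1,0,0), (0,0,1,1,0,0,0), (0,1,0,1,0,0,0),
   (1,0,1,0,0,0,0), (0,0,0,0,1,1,1), (0,0,0,1,1,1,0), (0,0,1,1,1,0,0),
   (0,1,0,1,1,0,0), (0,1,1,1,0,0,0), (1,0,1,1,0,0,0), (0,0,0,1,1,1,1),
   (0,0,1,1,1,1,0), (0,1,0,1,1,1,0), (0,1,1,1,1,0,0), (1,0,1,1,1,0,0),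
   (1,1,1,1,0,0,0), (0,0,1,1,1,1,1), (0,1,0,1,1,1,1), (0,1,1,1,1,1,0),
   (0,1,1,2,1,0,0), (1,0,1,1,1,1,0), (1,1,1,1,1,0,0), (0,1,1,1,1,1,1),
   (0,1,1,2,1,1,0), (1,0,1,1,1,1,1), (1,1,1,1,1,1,0), (1,1,1,2,1,0,0),
   (0,1,1,2,1,1,1), (0,1,1,2,2,1,0), (1,1,1,1,1,1,1), (1,1,1,2,1,1,0),
   (1,1,2,2,1,0,0), (0,1,1,2,2,1,1), (1,1,1,2,1,1,1), (1,1,1,2,2,1,0),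
   (1,1,2,2,1,1,0), (0,1,1,2,2,2,1), (1,1,1,2,2,1,1), (1,1,2,2,1,1,1),
   (1,1,2,2,2,1,0), (1,1,1,2,2,2,1), (1,1,2,2,2,1,1), (1,1,2,3,2,1,0),
   (1,1,2,2,2,2,1), (1,1,2,3,2,1,1), (1,2,2,3,2,1,0), (1,1,2,3,2,2,1),
   (1,2,2,3,2,1,1), (1,1,2,3,3,2,1), (1,2,2,3,2,2,1), (1,2,2,3,3,2,1),
   (1,2,2,4,3,2,1), (1,2,3,4,3,2,1), (2,2,3,4,3,2,1)]

theorem form_eq_one_of_mem_posRootsE7 : ∀ x ∈ posRootsE7, posE7.form x x = 1 := by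
  decide +kernel

theorem add_simpleE7_mem_posRootsE7 : ∀ x ∈ posRootsE7, ∀ i, posE7.ip x (simpleE7 i) = -1 →
    x + simpleE7 i ∈ posRootsE7 := by
  decide +kernel

theorem simpleE7_mem_posRootsE7 : ∀ i, simpleE7 i ∈ posRootsE7 := by
  decide +kernel

/-- Nonnegativity of all coordinates. -/
def NonnegE7 : E7Lattice → Prop
  | (a₁, a₂, a₃, a₄, a₅, a₆, a₇) =>
    0 ≤ a₁ ∧ 0 ≤ a₂ ∧ 0 ≤ a₃ ∧ 0 ≤ a₄ ∧ 0 ≤ a₅ ∧ 0 ≤ a₆ ∧ 0 ≤ a₇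

/-- The sum of the coordinates. -/
def heightE7 : E7Lattice → ℤ
  | (a₁, a₂, a₃, a₄, a₅, a₆, a₇) => a₁ + a₂ + a₃ + a₄ + a₅ + a₆ + a₇

theorem exists_ip_simpleE7_pos {x : E7Lattice} (hx : NonnegE7 x) (h1 : posE7.form x x = 1) :
    ∃ i, 0 < posE7.ip x (simpleE7 i) ∧ NonnegE7 (x - simpleE7 i) ∧
      heightE7 (x - simpleE7 i) = heightE7 x - 1 := by
  by_contra! hc
  obtain ⟨a₁, a₂, a₃, a₄, a₅, a₆, a₇⟩ := x
  have hs := fun i => hc i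
  have c0 := hc 0
  have c1 := hc 1
  have c2 := hc 2
  have c3 := hc 3
  have c4 := hc 4
  have c5 := hc 5
  have c6 := hc 6
  simp only [simpleE7, PosForm.ip, posE7, formE7, NonnegE7, heightE7, Matrix.cons_val,
    Prod.mk_sub_mk] at c0 c1 c2 c3 c4 c5 c6 hx h1
  obtain ⟨h₁, h₂, h₃, h₄, h₅, h₆, h₇⟩ := hx
  have key : ∀ a t : ℤ, 0 ≤ a → (0 < a → t ≤ 0) → a * t ≤ 0 := by
    intro a t ha h
    rcases ha.eq_or_lt with h0 | h0
    · rw [← h0, zero_mul]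
    · exact mul_nonpos_of_nonneg_of_nonpos ha (h h0)
  have k1 := key a₁ (2 * a₁ - a₃) h₁ fun h => by
    by_contra h'
    exact c0 (by omega) (by omega) (by omega)
  have k2 := key a₂ (2 * a₂ - a₄) h₂ fun h => by
    by_contra h'
    exact c1 (by omega) (by omega) (by omega)
  have k3 := key a₃ (2 * a₃ - a₁ - a₄) h₃ fun h => by
    by_contra h'
    exact c2 (by omega) (by omega) (by omega)
  have k4 := key a₄ (2 * a₄ - a₂ - a₃ - a₅) h₄ fun h => by
    by_contra h'
    exact c3 (by omega) (by omega) (by omega)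
  have k5 := key a₅ (2 * a₅ - a₄ - a₆) h₅ fun h => by
    by_contra h'
    exact c4 (by omega) (by omega) (by omega)
  have k6 := key a₆ (2 * a₆ - a₅ - a₇) h₆ fun h => by
    by_contra h'
    exact c5 (by omega) (by omega) (by omega)
  have k7 := key a₇ (2 * a₇ - a₆) h₇ fun h => by
    by_contra h'
    exact c6 (by omega) (by omega) (by omega)
  nlinarith

theorem nonnegE7_induction {P : E7Lattice → Prop} (hP : ∀ i, P (simpleE7 i))
    (hP' : ∀ x i, posE7.form x x = 1 → posE7.ip x (simpleE7 i) = -1 → P x → P (x + simpleE7 i))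
    {x : E7Lattice} (hx : NonnegE7 x) (h1 : posE7.form x x = 1) : P x := by
  induction hn : (heightE7 x).toNat using Nat.strong_induction_on generalizing x with
  | _ n ih =>
    obtain ⟨i, hi, hnn, hh⟩ := exists_ip_simpleE7_pos hx h1
    have hs := form_eq_one_of_mem_posRootsE7 _ (simpleE7_mem_posRootsE7 i)
    by_cases hxi : x = simpleE7 i
    · rw [hxi]; exact hP i
    have h2 : posE7.ip x (simpleE7 i) = 1 := le_antisymm (posE7.ip_le_one h1 hs hxi) hi
    have h3 : posE7.form (x - simpleE7 i) (x - simpleE7 i) = 1 := by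
      rw [PosForm.form_sub_self, h1, hs, h2]; rfl
    have h4 : 0 < heightE7 x := by
      have h5 : 0 ≤ heightE7 (x - simpleE7 i) := by
        revert hnn
        generalize x - simpleE7 i = y
        obtain ⟨a₁, a₂, a₃, a₄, a₅, a₆, a₇⟩ := y
        simp only [NonnegE7, heightE7]
        omega
      omega
    have h6 := ih _ (by omega) hnn h3 rfl
    have h7 := hP' _ i h3 (by rw [PosForm.ip_sub_left, h2, PosForm.ip_self, hs]; rfl) h6
    rwa [sub_add_cancel] at h7

theorem mem_posRootsE7_of_nonneg {x : E7Lattice} (hx : NonnegE7 x) (h1 : posE7.form x x = 1) :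
    x ∈ posRootsE7 := by
  refine (nonnegE7_induction (P := fun x => posE7.form x x = 1 ∧ x ∈ posRootsE7)
    (fun i => ⟨form_eq_one_of_mem_posRootsE7 _ (simpleE7_mem_posRootsE7 i),
      simpleE7_mem_posRootsE7 i⟩) (fun x i h1 h2 h3 => ?_) hx h1).2
  have := add_simpleE7_mem_posRootsE7 _ h3.2 i h2
  exact ⟨form_eq_one_of_mem_posRootsE7 _ this, this⟩

theorem addSubgroup_eq_top_of_simpleE7_mem (S : AddSubgroup E7Lattice)
    (h : ∀ i, simpleE7 i ∈ S) : S = ⊤ := by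
  rw [eq_top_iff]
  rintro x -
  have hx : x = x.1 • simpleE7 0 + x.2.1 • simpleE7 1 + x.2.2.1 • simpleE7 2 +
      x.2.2.2.1 • simpleE7 3 + x.2.2.2.2.1 • simpleE7 4 + x.2.2.2.2.2.1 • simpleE7 5 +
      x.2.2.2.2.2.2 • simpleE7 6 := by
    obtain ⟨a₁, a₂, a₃, a₄, a₅, a₆, a₇⟩ := x
    simp [simpleE7]
  rw [hx]
  have hz : ∀ (n : ℤ) i, n • simpleE7 i ∈ S := fun n i => S.zsmul_mem (h i) n
  exact S.add_mem (S.add_mem (S.add_mem (S.add_mem (S.add_mem (S.add_mem (hz _ _) (hz _ _))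
    (hz _ _)) (hz _ _)) (hz _ _)) (hz _ _)) (hz _ _)

theorem nonnegE7_or_neg {x : E7Lattice} (h1 : posE7.form x x = 1) :
    NonnegE7 x ∨ NonnegE7 (-x) := by
  obtain ⟨a₁, a₂, a₃, a₄, a₅, a₆, a₇⟩ := x
  have key : ∀ a : ℤ, ∃ p n : ℤ, 0 ≤ p ∧ 0 ≤ n ∧ a = p - n ∧ p * n = 0 := fun a => by
    rcases le_total 0 a with h | h
    · exact ⟨a, 0, h, le_rfl, by simp, by simp⟩
    · exact ⟨0, -a, le_rfl, by omega, by simp, by simp⟩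
  obtain ⟨p₁, n₁, hp₁, hn₁, rfl, z₁⟩ := key a₁
  obtain ⟨p₂, n₂, hp₂, hn₂, rfl, z₂⟩ := key a₂
  obtain ⟨p₃, n₃, hp₃, hn₃, rfl, z₃⟩ := key a₃
  obtain ⟨p₄, n₄, hp₄, hn₄, rfl, z₄⟩ := key a₄
  obtain ⟨p₅, n₅, hp₅, hn₅, rfl, z₅⟩ := key a₅
  obtain ⟨p₆, n₆, hp₆, hn₆, rfl, z₆⟩ := key a₆
  obtain ⟨p₇, n₇, hp₇, hn₇, rfl, z₇⟩ := key a₇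
  have hip : posE7.ip (p₁, p₂, p₃, p₄, p₅, p₆, p₇) (n₁, n₂, n₃, n₄, n₅, n₆, n₇) ≤ 0 := by
    simp only [PosForm.ip, posE7, formE7]
    nlinarith [mul_nonneg hp₁ hn₃, mul_nonneg hp₃ hn₁, mul_nonneg hp₂ hn₄, mul_nonneg hp₄ hn₂,
      mul_nonneg hp₃ hn₄, mul_nonneg hp₄ hn₃, mul_nonneg hp₄ hn₅, mul_nonneg hp₅ hn₄,
      mul_nonneg hp₅ hn₆, mul_nonneg hp₆ hn₅, mul_nonneg hp₆ hn₇, mul_nonneg hp₇ hn₆]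
  have hsub := posE7.form_sub_self (p₁, p₂, p₃, p₄, p₅, p₆, p₇) (n₁, n₂, n₃, n₄, n₅, n₆, n₇)
  have hzero : (n₁, n₂, n₃, n₄, n₅, n₆, n₇) = (0 : E7Lattice) ∨
      (p₁, p₂, p₃, p₄, p₅, p₆, p₇) = (0 : E7Lattice) := by
    by_contra! hc
    have h2 := posE7.pos _ hc.1
    have h3 := posE7.pos _ hc.2
    simp only [Prod.mk_sub_mk] at hsub
    omega
  rcases hzero with h | h
  · left
    simp only [Prod.mk_eq_zero] at h
    simp only [NonnegE7]
    omega
  · right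
    simp only [Prod.mk_eq_zero] at h
    simp only [NonnegE7]
    omega

theorem mem_posRootsE7_or_neg {x : E7Lattice} (h1 : posE7.form x x = 1) :
    x ∈ posRootsE7 ∨ -x ∈ posRootsE7 := by
  refine (nonnegE7_or_neg h1).imp (mem_posRootsE7_of_nonneg · h1) fun h => ?_
  exact mem_posRootsE7_of_nonneg h (by rw [posE7.neg_left, posE7.neg_right, neg_neg, h1])

theorem exists_isWt_levelE8 {τ : E7Lattice} (h1 : posE7.form τ τ = 1) :
    ∃ μ, levelE8.IsWt μ ∧ levelE8.IsWt (μ + (τ, 0)) := by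
  have key : ∀ τ ∈ posRootsE7, ∃ μ ∈ [(0,0,0,0,0,0,0), (0,0,0,0,0,0,1), (0,0,0,0,0,1,1),
      (0,0,0,0,1,1,1), (0,0,0,1,1,1,1), (0,0,1,1,1,1,1)],
      levelE8.form (μ, 1) (μ, 1) = 1 ∧ levelE8.form (μ + τ, 1) (μ + τ, 1) = 1 := by
    decide +kernel
  rcases mem_posRootsE7_or_neg h1 with h | h
  · obtain ⟨μ, -, h2, h3⟩ := key _ h
    exact ⟨(μ, 1), ⟨h2, rfl⟩, by simpa using h3, rfl⟩
  · obtain ⟨μ, -, h2, h3⟩ := key _ h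
    exact ⟨(μ + -τ, 1), ⟨h3, rfl⟩, by simpa using h2, rfl⟩

end E7Lattice

section E7Frame

attribute [local instance] LieRing.ofAssociativeRing

/-- The action of the `E₇` Chevalley system on functions on the `E₈` lattice. -/
noncomputable def chevalleyLevelE8 : ChevalleySystem posE7 (End ℂ (E7Lattice × ℤ → ℂ)) where
  X α := levelE8.opX (α, 0)
  H α := levelE8.opH (α, 0)
  H_add α β := by rw [← levelE8.opH_add]; simp
  X_eq_zero α h := levelE8.opX_eq_zero _ (by simpa [levelE8, posE7] using h)
  lie_H_H α β := levelE8.opH_mul_opH _ _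
  lie_H_X α β := by
    rw [LieRing.of_associative_ring_bracket, levelE8.opH_mul_opX]
    simp [PosForm.ip, levelE8, posE7]
  lie_X_X α β hα hβ hαβ := by
    rw [LieRing.of_associative_ring_bracket, levelE8.opX_mul_opX (by simpa [levelE8, posE7] using hα)
      (by simpa [levelE8, posE7] using hβ) rfl rfl (by simpa using hαβ)]
    simp [PosForm.eps, levelE8, posE7]
  lie_X_neg α hα := by
    have := levelE8.opX_mul_opX_neg (α := (α, 0)) (by simpa [levelE8, posE7] using hα) rfl
    rw [LieRing.of_associative_ring_bracket, ← this]
    simp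

namespace ChevalleySystem

variable {Λ M : Type*} [AddCommGroup Λ] {F : PosForm Λ} [LieRing M] [LieAlgebra ℂ M]
  (C : ChevalleySystem F M)

theorem H_zero : C.H 0 = 0 := by simpa using C.H_add 0 0

/-- The coroot map as a homomorphism. -/
def HHom : Λ →+ M := ⟨⟨C.H, C.H_zero⟩, C.H_add⟩

theorem lie_X_X_mem (K : Submodule ℂ M) (hX : ∀ α, C.X α ∈ K) (hH : ∀ α, C.H α ∈ K) (α β : Λ) :
    ⁅C.X α, C.X β⁆ ∈ K := by
  by_cases hα : F.form α α = 1
  swap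
  · rw [C.X_eq_zero _ hα, zero_lie]; exact K.zero_mem
  by_cases hβ : F.form β β = 1
  swap
  · rw [C.X_eq_zero _ hβ, lie_zero]; exact K.zero_mem
  by_cases h : α + β = 0
  · rw [eq_neg_of_add_eq_zero_right h, C.lie_X_neg _ hα]
    exact K.neg_mem (hH _)
  · rw [C.lie_X_X _ _ hα hβ h]
    exact K.smul_mem _ (hX _)

/-- The Lie subalgebra spanned by a Chevalley system. -/
def lieSpan : LieSubalgebra ℂ M where
  toSubmodule := Submodule.span ℂ (Set.range C.X ∪ Set.range C.H)
  lie_mem' {x y} hx hy := by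
    have hX : ∀ α, C.X α ∈ Submodule.span ℂ (Set.range C.X ∪ Set.range C.H) := fun α =>
      Submodule.subset_span (Or.inl ⟨α, rfl⟩)
    have hH : ∀ α, C.H α ∈ Submodule.span ℂ (Set.range C.X ∪ Set.range C.H) := fun α =>
      Submodule.subset_span (Or.inr ⟨α, rfl⟩)
    change x ∈ Submodule.span ℂ _ at hx
    change y ∈ Submodule.span ℂ _ at hy
    change ⁅x, y⁆ ∈ Submodule.span ℂ _
    induction hx using Submodule.span_induction with
    | zero => rw [zero_lie]; exact Submodule.zero_mem _
    | add _ _ _ _ h1 h2 => rw [add_lie]; exact Submodule.add_mem _ h1 h2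
    | smul c _ _ h1 => rw [smul_lie]; exact Submodule.smul_mem _ _ h1
    | mem x hx =>
      induction hy using Submodule.span_induction with
      | zero => rw [lie_zero]; exact Submodule.zero_mem _
      | add _ _ _ _ h1 h2 => rw [lie_add]; exact Submodule.add_mem _ h1 h2
      | smul c _ _ h1 => rw [lie_smul]; exact Submodule.smul_mem _ _ h1
      | mem y hy =>
        rcases hx with ⟨α, rfl⟩ | ⟨α, rfl⟩ <;> rcases hy with ⟨β, rfl⟩ | ⟨β, rfl⟩
        · exact C.lie_X_X_mem _ hX hH α β
        · rw [← lie_skew, C.lie_H_X]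
          exact Submodule.neg_mem _ (Submodule.smul_mem _ _ (hX _))
        · rw [C.lie_H_X]
          exact Submodule.smul_mem _ _ (hX _)
        · rw [C.lie_H_H]
          exact Submodule.zero_mem _

variable (C : ChevalleySystem posE7 M)

theorem X_H_mem_of_simple (K : LieSubalgebra ℂ M) (hX : ∀ i, C.X (simpleE7 i) ∈ K)
    (hX' : ∀ i, C.X (-simpleE7 i) ∈ K) (hH : ∀ i, C.H (simpleE7 i) ∈ K) :
    (∀ α, C.X α ∈ K) ∧ ∀ α, C.H α ∈ K := by
  have hs : ∀ i, posE7.form (simpleE7 i) (simpleE7 i) = 1 := fun i =>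
    form_eq_one_of_mem_posRootsE7 _ (simpleE7_mem_posRootsE7 i)
  have hneg : ∀ x, posE7.form (-x) (-x) = posE7.form x x := fun x => by
    rw [posE7.neg_left, posE7.neg_right, neg_neg]
  have step : ∀ x y, posE7.form x x = 1 → posE7.form y y = 1 → posE7.ip x y = -1 →
      C.X x ∈ K → C.X y ∈ K → C.X (x + y) ∈ K := by
    intro x y hx hy hxy h1 h2
    have h3 : x + y ≠ 0 := fun h0 => by
      have := posE7.form_add_self x y
      rw [h0, posE7.zero_left, hx, hy, hxy] at this
      omega
    have h4 := K.lie_mem h1 h2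
    rw [C.lie_X_X x y hx hy h3] at h4
    have h5 := K.smul_mem (posE7.eps x y : ℂ) h4
    rwa [smul_smul, ← Int.cast_mul, PosForm.eps, paritySign_mul_self, Int.cast_one, one_smul] at h5
  refine ⟨fun α => ?_, fun α => ?_⟩
  · by_cases hα : posE7.form α α = 1
    swap
    · rw [C.X_eq_zero _ hα]; exact K.zero_mem
    rcases nonnegE7_or_neg hα with h | h
    · exact nonnegE7_induction (P := fun x => C.X x ∈ K) hX
        (fun x i h1 h2 h3 => step x _ h1 (hs i) h2 h3 (hX i)) h hα
    · have := nonnegE7_induction (P := fun x => C.X (-x) ∈ K) hX'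
        (fun x i h1 h2 h3 => by
          rw [neg_add]
          exact step _ _ (by rw [hneg, h1]) (by rw [hneg, hs])
            (by rw [posE7.ip_neg_left, posE7.ip_neg_right, neg_neg, h2]) h3 (hX' i)) h
        (by rw [hneg, hα])
      rwa [neg_neg] at this
  · have := addSubgroup_eq_top_of_simpleE7_mem (K.toSubmodule.toAddSubgroup.comap C.HHom) hH
    have h2 : α ∈ (⊤ : AddSubgroup E7Lattice) := trivial
    rw [← this] at h2
    exact h2

end ChevalleySystem

/-- A Chevalley system spanning a Lie algebra of type `E₇`, together with the coordinate
functionals of the root vectors and the automorphisms defined by changes of base. -/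
structure E7Frame (L : Type*) [LieRing L] [LieAlgebra ℂ L] extends ChevalleySystem posE7 L where
  coef : E7Lattice → L →ₗ[ℂ] ℂ
  coef_X : ∀ σ τ, posE7.form τ τ = 1 → coef τ (X σ) = if σ = τ then 1 else 0
  coef_H : ∀ α τ, posE7.form τ τ = 1 → coef τ (H α) = 0
  span_eq : Submodule.span ℂ (Set.range X ∪ Set.range H) = ⊤
  exists_equiv : ∀ β : Fin 7 → E7Lattice,
    (∀ i j, posE7.ip (β i) (β j) = CartanMatrix.E₇ i j) →
      ∃ φ : L ≃ₗ⁅ℂ⁆ L, ∀ i, φ (H (simpleE7 i)) = H (β i)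

theorem LieHom.injective_of_isSimple {L M : Type*} [LieRing L] [LieAlgebra ℂ L] [LieRing M]
    [LieAlgebra ℂ M] [LieAlgebra.IsSimple ℂ L] (ψ : L →ₗ⁅ℂ⁆ M) {x : L} (hx : ψ x ≠ 0) :
    Function.Injective ψ := by
  rw [← LieHom.ker_eq_bot]
  refine (LieAlgebra.IsSimple.eq_bot_or_eq_top ψ.ker).resolve_right fun h => hx ?_
  have : x ∈ ψ.ker := h ▸ LieSubmodule.mem_top x
  exact LieHom.mem_ker.mp this

theorem ChevalleySystem.exists_E7Frame {L : Type*} [LieRing L] [LieAlgebra ℂ L]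
    [FiniteDimensional ℂ L] [LieAlgebra.IsSimple ℂ L] (C : ChevalleySystem posE7 L)
    (ι : L ≃ₗ⁅ℂ⁆ LieAlgebra.e₇ ℂ) (hH : ∀ i, ι (C.H (simpleE7 i)) = e7Gen (.H i))
    (hE : ∀ i, ι (C.X (simpleE7 i)) = e7Gen (.E i))
    (hF : ∀ i, ι (-C.X (-simpleE7 i)) = e7Gen (.F i))
    (coef : E7Lattice → L →ₗ[ℂ] ℂ)
    (coef_X : ∀ σ τ, posE7.form τ τ = 1 → coef τ (C.X σ) = if σ = τ then 1 else 0)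
    (coef_H : ∀ α τ, posE7.form τ τ = 1 → coef τ (C.H α) = 0) : Nonempty (E7Frame L) := by
  refine ⟨{ C with
    coef := coef
    coef_X := coef_X
    coef_H := coef_H
    span_eq := ?_
    exists_equiv := fun β hβ => ?_ }⟩
  · have h1 : C.lieSpan.map (ι : L →ₗ⁅ℂ⁆ LieAlgebra.e₇ ℂ) = ⊤ := by
      refine eq_top_of_e7Gen_mem _ fun g => ?_
      rw [LieSubalgebra.mem_map]
      rcases g with i | i | i
      · exact ⟨_, Submodule.subset_span (Or.inr ⟨_, rfl⟩), hH i⟩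
      · exact ⟨_, Submodule.subset_span (Or.inl ⟨_, rfl⟩), hE i⟩
      · exact ⟨_, Submodule.neg_mem _ (Submodule.subset_span (Or.inl ⟨_, rfl⟩)), hF i⟩
    rw [eq_top_iff]
    rintro x -
    have h2 : ι x ∈ C.lieSpan.map (ι : L →ₗ⁅ℂ⁆ LieAlgebra.e₇ ℂ) := h1 ▸ LieSubalgebra.mem_top _
    obtain ⟨y, hy, hyx⟩ := (LieSubalgebra.mem_map _ _ _).mp h2
    rwa [← ι.injective hyx]
  · obtain ⟨φ, hφ, hφ', -⟩ := C.exists_lieHom_e7 β hβ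
    have h1 : posE7.form (β 0) (β 0) = 1 := by
      have := hβ 0 0
      rw [posE7.ip_self, CartanMatrix.E₇_diag] at this
      omega
    have hinj : Function.Injective (φ.comp (ι : L →ₗ⁅ℂ⁆ LieAlgebra.e₇ ℂ)) := by
      refine LieHom.injective_of_isSimple _ (x := C.X (simpleE7 0)) fun h => ?_
      have h2 : C.X (β 0) = 0 := by rw [← hφ', ← hE]; exact h
      have h3 := coef_X (β 0) (β 0) h1
      rw [h2, map_zero, if_pos rfl] at h3
      exact zero_ne_one h3
    have hsurj : Function.Surjective (φ.comp (ι : L →ₗ⁅ℂ⁆ LieAlgebra.e₇ ℂ)) :=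
      (LinearMap.injective_iff_surjective
        (f := (φ.comp (ι : L →ₗ⁅ℂ⁆ LieAlgebra.e₇ ℂ) : L →ₗ[ℂ] L))).mp hinj
    refine ⟨LieEquiv.ofBijective _ ⟨hinj, hsurj⟩, fun i => ?_⟩
    change φ (ι (C.H (simpleE7 i))) = _
    rw [hH, hφ]

/-- The linear functional reading off a matrix coefficient. -/
noncomputable def matrixCoef (μ τ : E7Lattice × ℤ) : End ℂ (E7Lattice × ℤ → ℂ) →ₗ[ℂ] ℂ :=
  LinearMap.proj (μ + τ) ∘ₗ LinearMap.applyₗ (Pi.single μ (1 : ℂ))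

theorem matrixCoef_apply (μ τ : E7Lattice × ℤ) (T : End ℂ (E7Lattice × ℤ → ℂ)) :
    matrixCoef μ τ T = T (Pi.single μ (1 : ℂ)) (μ + τ) := rfl

theorem matrixCoef_X {μ : E7Lattice × ℤ} {τ : E7Lattice} (hτ : posE7.form τ τ = 1)
    (hμ : levelE8.IsWt μ) (hμ' : levelE8.IsWt (μ + (τ, 0))) (σ : E7Lattice) :
    matrixCoef μ (τ, 0) (chevalleyLevelE8.X σ) =
      if σ = τ then (levelE8.eps (τ, 0) μ : ℂ) else 0 := by
  rw [matrixCoef_apply]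
  change levelE8.opX (σ, 0) _ _ = _
  rw [levelE8.opX_apply]
  split_ifs with h
  · subst h
    have h1 : levelE8.form (σ, 0) (σ, 0) = 1 := by simpa [levelE8, posE7] using hτ
    rw [add_sub_cancel_right, Pi.single_eq_same, LevelForm.coefX, add_sub_cancel_right,
      if_pos ⟨h1, hμ', hμ⟩, mul_one]
  · rw [Pi.single_eq_of_ne, mul_zero]
    intro h1
    apply h
    have h2 : (τ, (0 : ℤ)) = (σ, 0) := by
      rwa [add_sub_assoc, add_eq_left, sub_eq_zero] at h1
    exact (congrArg Prod.fst h2).symm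

theorem matrixCoef_H (μ : E7Lattice × ℤ) {τ : E7Lattice} (hτ : posE7.form τ τ = 1)
    (α : E7Lattice) : matrixCoef μ (τ, 0) (chevalleyLevelE8.H α) = 0 := by
  rw [matrixCoef_apply]
  change levelE8.opH (α, 0) _ _ = _
  rw [levelE8.opH_apply, Pi.single_eq_of_ne, mul_zero]
  intro h
  rw [add_eq_left, Prod.mk_eq_zero] at h
  rw [h.1, posE7.zero_left] at hτ
  omega

theorem nonempty_E7Frame {L : Type*} [LieRing L] [LieAlgebra ℂ L] [FiniteDimensional ℂ L]
    [LieAlgebra.IsSimple ℂ L] (ι : L ≃ₗ⁅ℂ⁆ LieAlgebra.e₇ ℂ) : Nonempty (E7Frame L) := by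
  obtain ⟨φ, hH, hE, hF⟩ := chevalleyLevelE8.exists_lieHom_e7 simpleE7 ip_simpleE7
  let ψ : L →ₗ⁅ℂ⁆ End ℂ (E7Lattice × ℤ → ℂ) := φ.comp (ι : L →ₗ⁅ℂ⁆ LieAlgebra.e₇ ℂ)
  have hψ : ∀ g, ψ (ι.symm (e7Gen g)) = φ (e7Gen g) := fun g => by simp [ψ]
  choose! μ hμ hμ' using fun τ => exists_isWt_levelE8 (τ := τ)
  have hs := form_eq_one_of_mem_posRootsE7 _ (simpleE7_mem_posRootsE7 0)
  have hsq : ∀ τ, (levelE8.eps (τ, 0) (μ τ) : ℂ) * levelE8.eps (τ, 0) (μ τ) = 1 := fun τ => by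
    exact_mod_cast paritySign_mul_self _
  have hinj : Function.Injective ψ := by
    refine LieHom.injective_of_isSimple ψ (x := ι.symm (e7Gen (.E 0))) fun h => ?_
    have h1 := matrixCoef_X hs (hμ _ hs) (hμ' _ hs) (simpleE7 0)
    rw [← hE, ← hψ, h, map_zero, if_pos rfl] at h1
    have h2 := hsq (simpleE7 0)
    rw [← h1, zero_mul] at h2
    exact zero_ne_one h2
  have hmem := chevalleyLevelE8.X_H_mem_of_simple ψ.range
    (fun i => ⟨ι.symm (e7Gen (.E i)), by rw [← hE]; exact hψ _⟩)
    (fun i => ⟨-ι.symm (e7Gen (.F i)), by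
      have := hF i
      rw [← hψ] at this
      exact (map_neg ψ _).trans (by rw [this, neg_neg])⟩)
    (fun i => ⟨ι.symm (e7Gen (.H i)), by rw [← hH]; exact hψ _⟩)
  choose X hX using hmem.1
  choose H hHH using hmem.2
  replace hX : ∀ α, ψ (X α) = chevalleyLevelE8.X α := hX
  replace hHH : ∀ α, ψ (H α) = chevalleyLevelE8.H α := hHH
  let C : ChevalleySystem posE7 L :=
    { X := X
      H := H
      H_add := fun α β => hinj (by rw [map_add, hHH, hHH, hHH, chevalleyLevelE8.H_add])
      X_eq_zero := fun α h => hinj (by rw [map_zero, hX, chevalleyLevelE8.X_eq_zero α h])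
      lie_H_H := fun α β => hinj (by
        rw [LieHom.map_lie, map_zero, hHH, hHH, chevalleyLevelE8.lie_H_H])
      lie_H_X := fun α β => hinj (by
        rw [LieHom.map_lie, map_smul, hHH, hX, chevalleyLevelE8.lie_H_X])
      lie_X_X := fun α β hα hβ h => hinj (by
        rw [LieHom.map_lie, map_smul, hX, hX, hX, chevalleyLevelE8.lie_X_X α β hα hβ h])
      lie_X_neg := fun α hα => hinj (by
        rw [LieHom.map_lie, map_neg, hX, hX, hHH, chevalleyLevelE8.lie_X_neg α hα]) }
  have hι : ∀ x g, ψ x = φ (e7Gen g) → ι x = e7Gen g := fun x g h => by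
    rw [← hψ] at h
    rw [hinj h, LieEquiv.apply_symm_apply]
  refine C.exists_E7Frame ι (fun i => hι _ _ ((hHH _).trans (hH i).symm))
    (fun i => hι _ _ ((hX _).trans (hE i).symm))
    (fun i => hι _ _ (by rw [map_neg, hF]; exact congrArg _ (hX _)))
    (fun τ => (levelE8.eps (τ, 0) (μ τ) : ℂ) • (matrixCoef (μ τ) (τ, 0) ∘ₗ (ψ : L →ₗ[ℂ] _)))
    (fun σ τ hτ => ?_) (fun α τ hτ => ?_)
  · change (levelE8.eps (τ, 0) (μ τ) : ℂ) * matrixCoef (μ τ) (τ, 0) (ψ (X σ)) = _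
    rw [hX, matrixCoef_X hτ (hμ _ hτ) (hμ' _ hτ)]
    split_ifs with h
    · exact hsq τ
    · exact mul_zero _
  · change (levelE8.eps (τ, 0) (μ τ) : ℂ) * matrixCoef (μ τ) (τ, 0) (ψ (H α)) = _
    rw [hHH, matrixCoef_H _ hτ, mul_zero]

end E7Frame

section E7Basis

/-- The set of roots. -/
def rootsE7 : Finset E7Lattice := (posRootsE7 ++ posRootsE7.map fun x => -x).toFinset

theorem nodup_rootsE7 : (posRootsE7 ++ posRootsE7.map fun x => -x).Nodup := by
  decide +kernel

theorem mem_rootsE7 {x : E7Lattice} : x ∈ rootsE7 ↔ posE7.form x x = 1 := by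
  have hneg : posE7.form (-x) (-x) = posE7.form x x := by
    rw [posE7.neg_left, posE7.neg_right, neg_neg]
  simp only [rootsE7, List.mem_toFinset, List.mem_append, List.mem_map]
  constructor
  · rintro (h | ⟨y, hy, rfl⟩)
    · exact form_eq_one_of_mem_posRootsE7 _ h
    · rw [posE7.neg_left, posE7.neg_right, neg_neg]
      exact form_eq_one_of_mem_posRootsE7 _ hy
  · intro h
    exact (mem_posRootsE7_or_neg h).imp id fun h => ⟨-x, h, neg_neg x⟩

/-- A linear system with the `E₇` Cartan matrix has only the obvious solution. -/
theorem cartanE7_solve (c n : Fin 7 → ℂ)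
    (h : ∀ j, ∑ i, c i * (posE7.ip (simpleE7 i) (simpleE7 j) : ℂ) = n j) :
    c 0 = (4 * n 0 + 4 * n 1 + 6 * n 2 + 8 * n 3 + 6 * n 4 + 4 * n 5 + 2 * n 6) / 2 ∧
    c 1 = (4 * n 0 + 7 * n 1 + 8 * n 2 + 12 * n 3 + 9 * n 4 + 6 * n 5 + 3 * n 6) / 2 ∧
    c 2 = (6 * n 0 + 8 * n 1 + 12 * n 2 + 16 * n 3 + 12 * n 4 + 8 * n 5 + 4 * n 6) / 2 ∧
    c 3 = (8 * n 0 + 12 * n 1 + 16 * n 2 + 24 * n 3 + 18 * n 4 + 12 * n 5 + 6 * n 6) / 2 ∧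
    c 4 = (6 * n 0 + 9 * n 1 + 12 * n 2 + 18 * n 3 + 15 * n 4 + 10 * n 5 + 5 * n 6) / 2 ∧
    c 5 = (4 * n 0 + 6 * n 1 + 8 * n 2 + 12 * n 3 + 10 * n 4 + 8 * n 5 + 4 * n 6) / 2 ∧
    c 6 = (2 * n 0 + 3 * n 1 + 4 * n 2 + 6 * n 3 + 5 * n 4 + 4 * n 5 + 3 * n 6) / 2 := by
  have e0 := h 0
  have e1 := h 1
  have e2 := h 2
  have e3 := h 3
  have e4 := h 4
  have e5 := h 5
  have e6 := h 6
  simp only [ip_simpleE7, CartanMatrix.E₇, Fin.sum_univ_seven, Matrix.of_apply, Matrix.cons_val]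
    at e0 e1 e2 e3 e4 e5 e6
  push_cast at e0 e1 e2 e3 e4 e5 e6
  refine ⟨?_, ?_, ?_, ?_, ?_, ?_, ?_⟩
  · linear_combination 4 / 2 * e0 + 4 / 2 * e1 + 6 / 2 * e2 + 8 / 2 * e3 + 6 / 2 * e4 + 4 / 2 * e5 + 2 / 2 * e6
  · linear_combination 4 / 2 * e0 + 7 / 2 * e1 + 8 / 2 * e2 + 12 / 2 * e3 + 9 / 2 * e4 + 6 / 2 * e5 + 3 / 2 * e6
  · linear_combination 6 / 2 * e0 + 8 / 2 * e1 + 12 / 2 * e2 + 16 / 2 * e3 + 12 / 2 * e4 + 8 / 2 * e5 + 4 / 2 * e6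
  · linear_combination 8 / 2 * e0 + 12 / 2 * e1 + 16 / 2 * e2 + 24 / 2 * e3 + 18 / 2 * e4 + 12 / 2 * e5 + 6 / 2 * e6
  · linear_combination 6 / 2 * e0 + 9 / 2 * e1 + 12 / 2 * e2 + 18 / 2 * e3 + 15 / 2 * e4 + 10 / 2 * e5 + 5 / 2 * e6
  · linear_combination 4 / 2 * e0 + 6 / 2 * e1 + 8 / 2 * e2 + 12 / 2 * e3 + 10 / 2 * e4 + 8 / 2 * e5 + 4 / 2 * e6
  · linear_combination 2 / 2 * e0 + 3 / 2 * e1 + 4 / 2 * e2 + 6 / 2 * e3 + 5 / 2 * e4 + 4 / 2 * e5 + 3 / 2 * e6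

namespace E7Frame

variable {L : Type*} [LieRing L] [LieAlgebra ℂ L] (C : E7Frame L)

theorem lie_sum_smul_H_X (c : Fin 7 → ℂ) (σ : E7Lattice) :
    ⁅∑ i, c i • C.H (simpleE7 i), C.X σ⁆ =
      (∑ i, c i * (posE7.ip (simpleE7 i) σ : ℂ)) • C.X σ := by
  rw [Finset.sum_smul, sum_lie]
  refine Finset.sum_congr rfl fun i _ => ?_
  rw [smul_lie, C.lie_H_X, smul_smul]

theorem X_ne_zero {σ : E7Lattice} (h : posE7.form σ σ = 1) : C.X σ ≠ 0 := fun h0 => by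
  have := C.coef_X σ σ h
  rw [h0, map_zero, if_pos rfl] at this
  exact zero_ne_one this

theorem eq_zero_of_sum_smul_H {c : Fin 7 → ℂ} (h : ∑ i, c i • C.H (simpleE7 i) = 0) : c = 0 := by
  have h1 := cartanE7_solve c 0 fun j => by
    have h2 := C.lie_sum_smul_H_X c (simpleE7 j)
    rw [h, zero_lie] at h2
    exact (smul_eq_zero.mp h2.symm).resolve_right
      (C.X_ne_zero (form_eq_one_of_mem_posRootsE7 _ (simpleE7_mem_posRootsE7 j)))
  simp only [Pi.zero_apply, mul_zero, add_zero, zero_div] at h1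
  ext i
  fin_cases i <;> simp [h1]

/-- The basis vectors. -/
def basisVec : Fin 7 ⊕ rootsE7 → L
  | .inl i => C.H (simpleE7 i)
  | .inr σ => C.X σ

theorem linearIndependent_basisVec : LinearIndependent ℂ C.basisVec := by
  rw [Fintype.linearIndependent_iff]
  intro g hg
  rw [Fintype.sum_sum_type] at hg
  simp only [basisVec] at hg
  have h1 : ∀ σ, g (.inr σ) = 0 := by
    intro σ
    have hσ := mem_rootsE7.mp σ.2
    have h2 := congrArg (C.coef σ) hg
    simp only [map_add, map_sum, map_smul, C.coef_H _ _ hσ, C.coef_X _ _ hσ, smul_eq_mul,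
      mul_zero, Finset.sum_const_zero, zero_add, map_zero, mul_ite, mul_one] at h2
    simpa [Subtype.ext_iff.symm] using h2
  simp only [h1, zero_smul, Finset.sum_const_zero, add_zero] at hg
  have h3 := C.eq_zero_of_sum_smul_H (c := fun i => g (.inl i)) hg
  rintro (i | σ)
  · exact congrFun h3 i
  · exact h1 σ

theorem H_mem_span (α : E7Lattice) :
    C.H α ∈ Submodule.span ℂ (Set.range fun i => C.H (simpleE7 i)) := by
  have := addSubgroup_eq_top_of_simpleE7_mem ((Submodule.span ℂ
    (Set.range fun i => C.H (simpleE7 i))).toAddSubgroup.comap C.HHom)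
    fun i => Submodule.subset_span ⟨i, rfl⟩
  have h2 : α ∈ (⊤ : AddSubgroup E7Lattice) := trivial
  rw [← this] at h2
  exact h2

theorem span_basisVec : ⊤ ≤ Submodule.span ℂ (Set.range C.basisVec) := by
  rw [← C.span_eq, Submodule.span_le]
  rintro _ (⟨α, rfl⟩ | ⟨α, rfl⟩)
  · by_cases h : posE7.form α α = 1
    · exact Submodule.subset_span ⟨.inr ⟨α, mem_rootsE7.mpr h⟩, rfl⟩
    · rw [C.X_eq_zero α h]
      exact Submodule.zero_mem _
  · refine Submodule.span_mono ?_ (C.H_mem_span α)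
    rintro _ ⟨i, rfl⟩
    exact ⟨.inl i, rfl⟩

/-- The basis of simple coroots and root vectors. -/
noncomputable def basis : Basis (Fin 7 ⊕ rootsE7) ℂ L :=
  Basis.mk C.linearIndependent_basisVec C.span_basisVec

theorem basis_inl (i : Fin 7) : C.basis (.inl i) = C.H (simpleE7 i) :=
  Basis.mk_apply _ _ _

theorem basis_inr (σ : rootsE7) : C.basis (.inr σ) = C.X σ :=
  Basis.mk_apply _ _ _

theorem exists_eq_sum (x : L) : ∃ c : Fin 7 → ℂ,
    x = ∑ i, c i • C.H (simpleE7 i) + ∑ σ ∈ rootsE7, C.coef σ x • C.X σ := by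
  refine ⟨fun i => C.basis.repr x (.inl i), ?_⟩
  have h0 := C.basis.sum_repr x
  rw [Fintype.sum_sum_type] at h0
  simp only [basis_inl, basis_inr] at h0
  have h1 : ∀ σ : rootsE7, C.basis.repr x (.inr σ) = C.coef σ x := by
    intro σ
    have hσ := mem_rootsE7.mp σ.2
    have h2 := congrArg (C.coef σ) h0
    simp only [map_add, map_sum, map_smul, C.coef_H _ _ hσ, C.coef_X _ _ hσ, smul_eq_mul,
      mul_zero, Finset.sum_const_zero, zero_add, mul_ite, mul_one] at h2
    simpa [Subtype.ext_iff.symm] using h2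
  simp only [h1] at h0
  rw [← Finset.sum_coe_sort rootsE7 fun σ => C.coef σ x • C.X σ]
  exact h0.symm

theorem coef_lie_H (u : E7Lattice) (x : L) {τ : E7Lattice} (hτ : posE7.form τ τ = 1) :
    C.coef τ ⁅C.H u, x⁆ = posE7.ip u τ * C.coef τ x := by
  have hx : x ∈ Submodule.span ℂ (Set.range C.X ∪ Set.range C.H) := C.span_eq ▸ trivial
  induction hx using Submodule.span_induction with
  | zero => simp
  | add x y _ _ h1 h2 => rw [lie_add, map_add, h1, h2, map_add, mul_add]
  | smul c x _ h1 => rw [lie_smul, map_smul, h1, map_smul, smul_eq_mul, smul_eq_mul, mul_left_comm]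
  | mem x hx =>
    rcases hx with ⟨σ, rfl⟩ | ⟨α, rfl⟩
    · rw [C.lie_H_X, map_smul, C.coef_X _ _ hτ]
      split_ifs with h
      · rw [h]; rfl
      · simp
    · rw [C.lie_H_H, C.coef_H _ _ hτ, map_zero, mul_zero]

end E7Frame

theorem Module.End.finrank_eigenspace_of_basis {V ι : Type*} [AddCommGroup V] [Module ℂ V]
    [Fintype ι] (b : Basis ι ℂ V) (T : End ℂ V) (w : ι → ℂ) (hT : ∀ i, T (b i) = w i • b i) (μ : ℂ)
    [Fintype {i // w i = μ}] : finrank ℂ (T.eigenspace μ) = Fintype.card {i // w i = μ} := by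
  have h1 : LinearIndependent ℂ fun i : {i // w i = μ} => b i :=
    b.linearIndependent.comp _ Subtype.val_injective
  rw [← finrank_span_eq_card h1]
  suffices h : T.eigenspace μ = Submodule.span ℂ (Set.range fun i : {i // w i = μ} => b i) by
    rw [h]
  apply le_antisymm
  · intro x hx
    rw [End.mem_eigenspace_iff] at hx
    have h2 : ∀ i, b.repr x i ≠ 0 → w i = μ := by
      intro i hi
      have h3 : T x = ∑ i, (b.repr x i * w i) • b i := by
        conv_lhs => rw [← b.sum_repr x, map_sum]
        simp only [map_smul, hT, smul_smul]
      have h4 : b.repr (T x) i = b.repr x i * w i := by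
        rw [h3, b.repr_sum_self]
      rw [hx, map_smul, Finsupp.smul_apply, smul_eq_mul, mul_comm] at h4
      exact (mul_left_cancel₀ hi h4).symm
    rw [← b.sum_repr x]
    refine Submodule.sum_mem _ fun i _ => ?_
    by_cases hi : b.repr x i = 0
    · rw [hi, zero_smul]; exact Submodule.zero_mem _
    · exact Submodule.smul_mem _ _ (Submodule.subset_span ⟨⟨i, h2 i hi⟩, rfl⟩)
  · rw [Submodule.span_le]
    rintro _ ⟨i, rfl⟩
    change b i ∈ T.eigenspace μ
    rw [End.mem_eigenspace_iff, hT, i.2]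

end E7Basis

section E7Conjugation

open LieAlgebra LieSubalgebra

theorem IsSl2Triple.map_lieEquiv {L : Type*} [LieRing L] [LieAlgebra ℂ L] {h e f : L}
    (t : IsSl2Triple h e f) (φ : L ≃ₗ⁅ℂ⁆ L) : IsSl2Triple (φ h) (φ e) (φ f) where
  h_ne_zero h0 := t.h_ne_zero (φ.injective (h0.trans (map_zero φ).symm))
  lie_e_f := by rw [← LieEquiv.map_lie, t.lie_e_f]
  lie_h_e_nsmul := by rw [← LieEquiv.map_lie, t.lie_h_e_nsmul, map_nsmul]
  lie_h_f_nsmul := by rw [← LieEquiv.map_lie, t.lie_h_f_nsmul, map_neg, map_nsmul]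

theorem IsSl2Triple.exists_eq_lie_add {L : Type*} [LieRing L] [LieAlgebra ℂ L]
    [FiniteDimensional ℂ L] {h e f : L} (t : IsSl2Triple h e f) (x : L) :
    ∃ u k : L, ⁅h, k⁆ = 0 ∧ x = ⁅u, h⁆ + k := by
  have hx : x ∈ ⨆ k : ℤ, (ad ℂ L h).eigenspace (k : ℂ) :=
    t.slTwoRel_ad.iSup_eigenspace_int_eq_top ▸ Submodule.mem_top
  induction hx using Submodule.iSup_induction' with
  | zero => exact ⟨0, 0, by simp, by simp⟩
  | add x y _ _ hx hy =>
    obtain ⟨u, k, h1, rfl⟩ := hx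
    obtain ⟨u', k', h1', rfl⟩ := hy
    exact ⟨u + u', k + k', by rw [lie_add, h1, h1', add_zero], by rw [add_lie]; abel⟩
  | mem k x hx =>
    rw [End.mem_eigenspace_iff, ad_apply] at hx
    by_cases hk : k = 0
    · exact ⟨0, x, by rw [hx, hk]; simp, by simp⟩
    · refine ⟨-((k : ℂ)⁻¹ • x), 0, lie_zero _, ?_⟩
      rw [neg_lie, smul_lie, ← lie_skew, hx, smul_neg, neg_neg, smul_smul,
        inv_mul_cancel₀ (by exact_mod_cast hk), one_smul, add_zero]

/-- The sum of the positive roots. -/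
def twoRhoE7 : E7Lattice := (34, 49, 66, 96, 75, 52, 27)

theorem ip_twoRhoE7_ne_zero {σ : E7Lattice} (h : posE7.form σ σ = 1) : posE7.ip twoRhoE7 σ ≠ 0 := by
  have key : ∀ σ ∈ posRootsE7, posE7.ip twoRhoE7 σ ≠ 0 := by decide +kernel
  rcases mem_posRootsE7_or_neg h with h | h
  · exact key _ h
  · have := key _ h
    rwa [posE7.ip_neg_right, neg_ne_zero] at this

theorem ip_twoRhoE7_simpleE7 : ∀ j, posE7.ip twoRhoE7 (simpleE7 j) = 2 := by decide +kernel

namespace E7Frame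

variable {L : Type*} [LieRing L] [LieAlgebra ℂ L] (C : E7Frame L)

theorem ad_H_pow (α : E7Lattice) {τ : E7Lattice} (hτ : posE7.form τ τ = 1) (n : ℕ) (x : L) :
    C.coef τ ((ad ℂ L (C.H α) ^ n) x) = (posE7.ip α τ : ℂ) ^ n * C.coef τ x := by
  induction n with
  | zero => simp
  | succ n ih => rw [pow_succ', End.mul_apply, ad_apply, C.coef_lie_H _ _ hτ, ih, pow_succ',
      mul_assoc]

theorem exists_eq_sum_smul_H_of_mem_engel {x : L} (hx : x ∈ engel ℂ (C.H twoRhoE7)) :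
    ∃ c : Fin 7 → ℂ, x = ∑ i, c i • C.H (simpleE7 i) := by
  obtain ⟨n, hn⟩ := (mem_engel_iff ℂ _ _).mp hx
  obtain ⟨c, hc⟩ := C.exists_eq_sum x
  refine ⟨c, ?_⟩
  rw [Finset.sum_eq_zero (s := rootsE7), add_zero] at hc
  · exact hc
  · intro σ hσ
    have hσ' := mem_rootsE7.mp hσ
    have h1 := C.ad_H_pow twoRhoE7 hσ' n x
    rw [hn, map_zero, eq_comm, mul_eq_zero] at h1
    rw [h1.resolve_left (pow_ne_zero n (by exact_mod_cast ip_twoRhoE7_ne_zero hσ')), zero_smul]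

theorem engel_twoRhoE7_le {y : L} (hy : y ∈ engel ℂ (C.H twoRhoE7)) :
    engel ℂ (C.H twoRhoE7) ≤ engel ℂ y := by
  intro z hz
  obtain ⟨c, rfl⟩ := C.exists_eq_sum_smul_H_of_mem_engel hy
  obtain ⟨c', rfl⟩ := C.exists_eq_sum_smul_H_of_mem_engel hz
  refine (mem_engel_iff ℂ _ _).mpr ⟨1, ?_⟩
  simp [C.lie_H_H]

theorem H_eq_sum (u : E7Lattice) (c : Fin 7 → ℂ) (h0 : u.1 = c 0) (h1 : u.2.1 = c 1)
    (h2 : u.2.2.1 = c 2) (h3 : u.2.2.2.1 = c 3) (h4 : u.2.2.2.2.1 = c 4)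
    (h5 : u.2.2.2.2.2.1 = c 5) (h6 : u.2.2.2.2.2.2 = c 6) :
    C.H u = ∑ i, c i • C.H (simpleE7 i) := by
  have hx : u = u.1 • simpleE7 0 + u.2.1 • simpleE7 1 + u.2.2.1 • simpleE7 2 +
      u.2.2.2.1 • simpleE7 3 + u.2.2.2.2.1 • simpleE7 4 + u.2.2.2.2.2.1 • simpleE7 5 +
      u.2.2.2.2.2.2 • simpleE7 6 := by
    obtain ⟨a₁, a₂, a₃, a₄, a₅, a₆, a₇⟩ := u
    simp [simpleE7]
  have h7 := congrArg C.HHom hx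
  simp only [map_add, map_zsmul] at h7
  refine Eq.trans h7 ?_
  rw [Fin.sum_univ_seven, ← h0, ← h1, ← h2, ← h3, ← h4, ← h5, ← h6]
  simp only [Int.cast_smul_eq_zsmul]
  rfl

theorem lieEquiv_apply_H {φ : L ≃ₗ⁅ℂ⁆ L} {θ : E7Lattice →+ E7Lattice}
    (hφ : ∀ i, φ (C.H (simpleE7 i)) = C.H (θ (simpleE7 i))) (u : E7Lattice) :
    φ (C.H u) = C.H (θ u) := by
  have := addSubgroup_eq_top_of_simpleE7_mem
    (AddMonoidHom.eqLocus (φ.toLinearEquiv.toAddMonoidHom.comp C.HHom) (C.HHom.comp θ)) hφ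
  have h2 : u ∈ (⊤ : AddSubgroup E7Lattice) := trivial
  rw [← this] at h2
  exact h2

variable [FiniteDimensional ℂ L]

theorem exists_lieEquiv_apply_eq_H {h e f : L} (t : IsSl2Triple h e f) :
    ∃ φ : L ≃ₗ⁅ℂ⁆ L, ∃ u, φ h = (1 / 2 : ℂ) • C.H u := by
  obtain ⟨φ, hφ⟩ := exists_lieEquiv_mem_engel (fun y hy => C.engel_twoRhoE7_le hy)
    t.exists_eq_lie_add
  obtain ⟨c, hc⟩ := C.exists_eq_sum_smul_H_of_mem_engel hφ
  have hn : ∀ j, ∃ n : ℤ, ∑ i, c i * (posE7.ip (simpleE7 i) (simpleE7 j) : ℂ) = n := fun j =>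
    (t.map_lieEquiv φ).slTwoRel_ad.exists_int_of_hasEigenvector
      (C.X_ne_zero (form_eq_one_of_mem_posRootsE7 _ (simpleE7_mem_posRootsE7 j)))
      (by rw [hc, ad_apply, C.lie_sum_smul_H_X])
  choose n hn using hn
  obtain ⟨k0, k1, k2, k3, k4, k5, k6⟩ := cartanE7_solve c (fun j => n j) hn
  refine ⟨φ, (4 * n 0 + 4 * n 1 + 6 * n 2 + 8 * n 3 + 6 * n 4 + 4 * n 5 + 2 * n 6,
    4 * n 0 + 7 * n 1 + 8 * n 2 + 12 * n 3 + 9 * n 4 + 6 * n 5 + 3 * n 6,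
    6 * n 0 + 8 * n 1 + 12 * n 2 + 16 * n 3 + 12 * n 4 + 8 * n 5 + 4 * n 6,
    8 * n 0 + 12 * n 1 + 16 * n 2 + 24 * n 3 + 18 * n 4 + 12 * n 5 + 6 * n 6,
    6 * n 0 + 9 * n 1 + 12 * n 2 + 18 * n 3 + 15 * n 4 + 10 * n 5 + 5 * n 6,
    4 * n 0 + 6 * n 1 + 8 * n 2 + 12 * n 3 + 10 * n 4 + 8 * n 5 + 4 * n 6,
    2 * n 0 + 3 * n 1 + 4 * n 2 + 6 * n 3 + 5 * n 4 + 4 * n 5 + 3 * n 6), ?_⟩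
  rw [C.H_eq_sum _ (fun i => 2 * c i), hc, Finset.smul_sum]
  · refine Finset.sum_congr rfl fun i _ => ?_
    rw [smul_smul]
    congr 1
    ring
  · rw [k0]; push_cast; ring
  · rw [k1]; push_cast; ring
  · rw [k2]; push_cast; ring
  · rw [k3]; push_cast; ring
  · rw [k4]; push_cast; ring
  · rw [k5]; push_cast; ring
  · rw [k6]; push_cast; ring

end E7Frame

/-- The reflection in a root. -/
def reflE7 (α : E7Lattice) : E7Lattice →+ E7Lattice where
  toFun u := u - posE7.ip α u • α
  map_zero' := by rw [PosForm.ip, posE7.zero_right, posE7.zero_left]; simp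
  map_add' u v := by rw [posE7.ip_add_right, add_smul]; abel

theorem reflE7_apply (α u : E7Lattice) : reflE7 α u = u - posE7.ip α u • α := rfl

theorem PosForm.ip_zsmul_right {Λ : Type*} [AddCommGroup Λ] (F : PosForm Λ) (x y : Λ) (n : ℤ) :
    F.ip x (n • y) = n * F.ip x y :=
  (map_zsmul (⟨⟨F.ip x, by rw [PosForm.ip, F.zero_right, F.zero_left]; rfl⟩, F.ip_add_right x⟩ :
    Λ →+ ℤ) n y).trans (smul_eq_mul _ _)

theorem PosForm.ip_zsmul_left {Λ : Type*} [AddCommGroup Λ] (F : PosForm Λ) (x y : Λ) (n : ℤ) :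
    F.ip (n • x) y = n * F.ip x y := by
  rw [F.ip_comm, F.ip_zsmul_right, F.ip_comm]

theorem ip_reflE7 {α : E7Lattice} (hα : posE7.form α α = 1) (u v : E7Lattice) :
    posE7.ip (reflE7 α u) (reflE7 α v) = posE7.ip u v := by
  simp only [reflE7_apply, posE7.ip_sub_left, posE7.ip_sub_right, posE7.ip_zsmul_left,
    posE7.ip_zsmul_right, posE7.ip_self, hα, posE7.ip_comm u α]
  ring

namespace E7Frame

variable {L : Type*} [LieRing L] [LieAlgebra ℂ L] [FiniteDimensional ℂ L] (C : E7Frame L)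

/-- Up to automorphism, the semisimple element of an `sl₂`-triple is dominant. -/
theorem exists_lieEquiv_apply_eq_H_dominant {h e f : L} (t : IsSl2Triple h e f) :
    ∃ φ : L ≃ₗ⁅ℂ⁆ L, ∃ u, φ h = (1 / 2 : ℂ) • C.H u ∧
      ∃ d : Fin 7 → ℕ, ∀ j, posE7.ip u (simpleE7 j) = 2 * d j := by
  obtain ⟨φ₀, u₀, hu₀⟩ := C.exists_lieEquiv_apply_eq_H t
  let P : ℤ → Prop := fun z => ∃ u, posE7.ip u u = posE7.ip u₀ u₀ ∧ posE7.ip twoRhoE7 u = z ∧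
    ∃ φ : L ≃ₗ⁅ℂ⁆ L, φ h = (1 / 2 : ℂ) • C.H u
  obtain ⟨z, ⟨u, hu, hz, φ, hφ⟩, hmax⟩ := Int.exists_greatest_of_bdd (P := P)
    ⟨posE7.form u₀ u₀ + posE7.form twoRhoE7 twoRhoE7, by
      rintro _ ⟨u, hu, rfl, -⟩
      have h1 := posE7.form_nonneg (twoRhoE7 - u)
      rw [posE7.form_sub_self] at h1
      rw [posE7.ip_self, posE7.ip_self] at hu
      omega⟩ ⟨_, u₀, rfl, rfl, φ₀, hu₀⟩
  have hs : ∀ j, posE7.form (simpleE7 j) (simpleE7 j) = 1 := fun j =>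
    form_eq_one_of_mem_posRootsE7 _ (simpleE7_mem_posRootsE7 j)
  have hdom : ∀ j, 0 ≤ posE7.ip u (simpleE7 j) := by
    intro j
    by_contra! hneg
    obtain ⟨ψ, hψ⟩ := C.exists_equiv (fun i => reflE7 (simpleE7 j) (simpleE7 i)) fun i k => by
      rw [ip_reflE7 (hs j), ip_simpleE7]
    have h1 := hmax (posE7.ip twoRhoE7 (reflE7 (simpleE7 j) u)) ⟨_, by rw [ip_reflE7 (hs j), hu],
      rfl, φ.trans ψ, by
        rw [LieEquiv.trans_apply, hφ, map_smul, C.lieEquiv_apply_H hψ]⟩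
    rw [reflE7_apply, posE7.ip_sub_right, posE7.ip_zsmul_right, ip_twoRhoE7_simpleE7, hz,
      posE7.ip_comm] at h1
    omega
  have hd : ∀ j, ∃ d : ℕ, posE7.ip u (simpleE7 j) = 2 * d := by
    intro j
    obtain ⟨k, hk⟩ := (t.map_lieEquiv φ).slTwoRel_ad.exists_int_of_hasEigenvector
      (C.X_ne_zero (hs j)) (μ := 1 / 2 * (posE7.ip u (simpleE7 j) : ℂ))
      (by rw [hφ, ad_apply, smul_lie, C.lie_H_X, smul_smul])
    have h1 : posE7.ip u (simpleE7 j) = 2 * k := by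
      have : (posE7.ip u (simpleE7 j) : ℂ) = 2 * k := by rw [← hk]; ring
      exact_mod_cast this
    have h2 := hdom j
    exact ⟨k.toNat, by omega⟩
  choose d hd using hd
  exact ⟨φ, u, hφ, d, hd⟩

end E7Frame

end E7Conjugation

section Enumeration

/-- The vectors `d` with entries in `{0, 1, 2}` such that the list `acc + ∑ d i • cols i`
satisfies `7 + 2 * #{entries 0} = #{entries 2}`. -/
def diagramSearch : List (List ℕ) → List ℕ → List (List ℕ)
  | [], acc => if 7 + 2 * acc.count 0 = acc.count 2 then [[]] else []
  | c :: cs, acc => [0, 1, 2].flatMap fun a =>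
      (diagramSearch cs (List.zipWith (fun x y => a * x + y) c acc)).map (a :: ·)

theorem mem_diagramSearch {ι : Type*} (l : List ι) : ∀ (fs : List (ι → ℕ)) (g : ι → ℕ) (d : List ℕ),
    d.length = fs.length → (∀ a ∈ d, a ≤ 2) →
    7 + 2 * (l.map fun σ => (List.zipWith (fun a f => a * f σ) d fs).sum + g σ).count 0 =
      (l.map fun σ => (List.zipWith (fun a f => a * f σ) d fs).sum + g σ).count 2 →
    d ∈ diagramSearch (fs.map fun f => l.map f) (l.map g)
  | [], g, [], _, _, h => by simpa [diagramSearch] using h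
  | f :: fs, g, a :: d, hl, hd, h => by
    simp only [diagramSearch, List.map_cons, List.mem_flatMap, List.mem_map]
    refine ⟨a, ?_, d, ?_, rfl⟩
    · have := hd a (by simp)
      interval_cases a <;> simp
    · have hz : List.zipWith (fun x y => a * x + y) (l.map f) (l.map g) =
          l.map fun σ => a * f σ + g σ := by
        rw [List.zipWith_map, List.zipWith_self]
      rw [hz]
      refine mem_diagramSearch l fs _ d (by simpa using hl)
        (fun b hb => hd b (List.mem_cons_of_mem _ hb)) ?_
      have he : ∀ σ, (List.zipWith (fun a f => a * f σ) d fs).sum + (a * f σ + g σ) =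
          (List.zipWith (fun a f => a * f σ) (a :: d) (f :: fs)).sum + g σ := fun σ => by
        simp only [List.zipWith_cons_cons, List.sum_cons]
        ring
      simpa only [he] using h

/-- The coordinate functions of the lattice, truncated to natural numbers. -/
def coordE7 : List (E7Lattice → ℕ) :=
  [fun x => x.1.toNat, fun x => x.2.1.toNat, fun x => x.2.2.1.toNat, fun x => x.2.2.2.1.toNat,
    fun x => x.2.2.2.2.1.toNat, fun x => x.2.2.2.2.2.1.toNat, fun x => x.2.2.2.2.2.2.toNat]

theorem diagramSearch_E7 :
    diagramSearch (coordE7.map fun f => posRootsE7.map f) (posRootsE7.map fun _ => 0) =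
      [[0, 0, 0, 2, 0, 0, 2], [2, 0, 0, 2, 0, 0, 2], [2, 0, 0, 2, 0, 2, 2], [2, 2, 2, 0, 2, 0, 2],
        [2, 2, 2, 0, 2, 2, 2], [2, 2, 2, 2, 2, 2, 2]] := by
  decide +kernel

end Enumeration

section Diagram

open LieAlgebra

/-- The degree of a lattice element when the simple roots have degrees `d`. -/
def degE7 (d : Fin 7 → ℕ) (σ : E7Lattice) : ℤ :=
  σ.1 * d 0 + σ.2.1 * d 1 + σ.2.2.1 * d 2 + σ.2.2.2.1 * d 3 + σ.2.2.2.2.1 * d 4 +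
    σ.2.2.2.2.2.1 * d 5 + σ.2.2.2.2.2.2 * d 6

theorem degE7_neg (d : Fin 7 → ℕ) (σ : E7Lattice) : degE7 d (-σ) = -degE7 d σ := by
  simp only [degE7, Prod.fst_neg, Prod.snd_neg]
  ring

theorem degE7_add (d : Fin 7 → ℕ) (σ τ : E7Lattice) :
    degE7 d (σ + τ) = degE7 d σ + degE7 d τ := by
  simp only [degE7, Prod.fst_add, Prod.snd_add]
  ring

theorem degE7_simpleE7 (d : Fin 7 → ℕ) (j : Fin 7) : degE7 d (simpleE7 j) = d j := by
  fin_cases j <;> simp [degE7, simpleE7]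

theorem ip_eq_sum_simpleE7 (u σ : E7Lattice) :
    posE7.ip u σ = σ.1 * posE7.ip u (simpleE7 0) + σ.2.1 * posE7.ip u (simpleE7 1) +
      σ.2.2.1 * posE7.ip u (simpleE7 2) + σ.2.2.2.1 * posE7.ip u (simpleE7 3) +
      σ.2.2.2.2.1 * posE7.ip u (simpleE7 4) + σ.2.2.2.2.2.1 * posE7.ip u (simpleE7 5) +
      σ.2.2.2.2.2.2 * posE7.ip u (simpleE7 6) := by
  have hx : σ = σ.1 • simpleE7 0 + σ.2.1 • simpleE7 1 + σ.2.2.1 • simpleE7 2 +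
      σ.2.2.2.1 • simpleE7 3 + σ.2.2.2.2.1 • simpleE7 4 + σ.2.2.2.2.2.1 • simpleE7 5 +
      σ.2.2.2.2.2.2 • simpleE7 6 := by
    obtain ⟨a₁, a₂, a₃, a₄, a₅, a₆, a₇⟩ := σ
    simp [simpleE7]
  conv_lhs => rw [hx]
  simp only [posE7.ip_add_right, posE7.ip_zsmul_right]

theorem ip_eq_two_mul_degE7 {u : E7Lattice} {d : Fin 7 → ℕ}
    (hd : ∀ j, posE7.ip u (simpleE7 j) = 2 * d j) (σ : E7Lattice) :
    posE7.ip u σ = 2 * degE7 d σ := by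
  rw [ip_eq_sum_simpleE7]
  simp only [hd, degE7]
  ring

theorem nonneg_of_mem_posRootsE7 : ∀ σ ∈ posRootsE7, 0 ≤ σ.1 ∧ 0 ≤ σ.2.1 ∧ 0 ≤ σ.2.2.1 ∧
    0 ≤ σ.2.2.2.1 ∧ 0 ≤ σ.2.2.2.2.1 ∧ 0 ≤ σ.2.2.2.2.2.1 ∧ 0 ≤ σ.2.2.2.2.2.2 := by
  decide +kernel

theorem degE7_of_mem_posRootsE7 (d : Fin 7 → ℕ) {σ : E7Lattice} (hσ : σ ∈ posRootsE7) :
    degE7 d σ = ((List.zipWith (fun a f => a * f σ) (List.ofFn d) coordE7).sum + 0 : ℕ) := by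
  obtain ⟨h0, h1, h2, h3, h4, h5, h6⟩ := nonneg_of_mem_posRootsE7 σ hσ
  simp only [degE7, coordE7, List.ofFn_succ, List.ofFn_zero, List.zipWith_cons_cons,
    List.zipWith_nil_right, List.sum_cons, List.sum_nil]
  push_cast [Int.toNat_of_nonneg h0, Int.toNat_of_nonneg h1, Int.toNat_of_nonneg h2,
    Int.toNat_of_nonneg h3, Int.toNat_of_nonneg h4, Int.toNat_of_nonneg h5,
    Int.toNat_of_nonneg h6]
  ring

theorem sub_simpleE7_mem_posRootsE7 : ∀ σ ∈ posRootsE7, ∀ j, σ = simpleE7 j ∨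
    posE7.form (σ - simpleE7 j) (σ - simpleE7 j) ≠ 1 ∨ σ - simpleE7 j ∈ posRootsE7 := by
  decide +kernel

namespace E7Frame

variable {L : Type*} [LieRing L] [LieAlgebra ℂ L] (C : E7Frame L)

theorem lie_H_eq_sum (u : E7Lattice) (x : L) :
    ⁅C.H u, x⁆ = ∑ σ ∈ rootsE7, (posE7.ip u σ * C.coef σ x : ℂ) • C.X σ := by
  obtain ⟨c, hc⟩ := C.exists_eq_sum x
  conv_lhs => rw [hc]
  simp only [lie_add, lie_sum, lie_smul, C.lie_H_H, smul_zero, Finset.sum_const_zero, zero_add,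
    C.lie_H_X, smul_smul, mul_comm]

theorem eq_sum_of_lie_H_eq {u : E7Lattice} {x : L} {μ : ℂ} (hμ : μ ≠ 0)
    (h : ⁅C.H u, x⁆ = μ • x) : x = ∑ σ ∈ rootsE7, C.coef σ x • C.X σ := by
  apply smul_right_injective L hμ
  change μ • x = μ • ∑ σ ∈ rootsE7, C.coef σ x • C.X σ
  rw [← h, lie_H_eq_sum, Finset.smul_sum]
  refine Finset.sum_congr rfl fun σ hσ => ?_
  rw [smul_smul, ← C.coef_lie_H _ _ (mem_rootsE7.mp hσ), h, map_smul, smul_eq_mul]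

theorem coef_eq_zero_of_lie_H_eq {u : E7Lattice} {x : L} {μ : ℂ} (h : ⁅C.H u, x⁆ = μ • x)
    {σ : E7Lattice} (hσ : posE7.form σ σ = 1) (hne : (posE7.ip u σ : ℂ) ≠ μ) :
    C.coef σ x = 0 := by
  have h1 := C.coef_lie_H u x hσ
  rw [h, map_smul, smul_eq_mul] at h1
  exact ((mul_eq_mul_right_iff.mp h1).resolve_left (Ne.symm hne))

theorem finrank_eigenspace_eq (h : L) (d : E7Lattice → ℤ) (hh : ∀ i, ⁅h, C.H i⁆ = 0)
    (hx : ∀ σ, ⁅h, C.X σ⁆ = (d σ : ℂ) • C.X σ) (μ : ℤ) :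
    finrank ℂ ((ad ℂ L h).eigenspace (μ : ℂ)) = (if μ = 0 then 7 else 0) +
      (posRootsE7 ++ posRootsE7.map fun x => -x).countP (fun σ => d σ = μ) := by
  classical
  rw [Module.End.finrank_eigenspace_of_basis C.basis (ad ℂ L h)
    (Sum.elim (fun _ => 0) fun σ => (d σ : ℂ)) (fun i => ?_),
    Fintype.card_congr Equiv.subtypeSum, Fintype.card_sum]
  · refine congrArg₂ (· + ·) ?_ ?_
    · split_ifs with h0
      · simp [h0]
      · simp [eq_comm, h0]
    · simp only [Sum.elim_inr, Int.cast_inj]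
      rw [List.countP_eq_length_filter, ← List.toFinset_card_of_nodup (nodup_rootsE7.filter _),
        List.toFinset_filter, ← Fintype.card_coe]
      refine Fintype.card_congr ((Equiv.subtypeSubtypeEquivSubtypeInter (· ∈ rootsE7)
        fun σ => d σ = μ).trans (Equiv.subtypeEquivRight fun σ => ?_))
      rw [Finset.mem_filter, decide_eq_true_iff]
      rfl
  · rcases i with i | σ
    · rw [C.basis_inl, ad_apply, hh]
      simp
    · rw [C.basis_inr, ad_apply, hx]
      rfl

end E7Frame

end Diagram

section Diagram

open LieAlgebra

theorem eq_of_ip_simpleE7_eq {u w : E7Lattice}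
    (h : ∀ j, posE7.ip u (simpleE7 j) = posE7.ip w (simpleE7 j)) : u = w := by
  by_contra hne
  have h1 := posE7.pos (u - w) (sub_ne_zero.mpr hne)
  have h2 : posE7.ip (u - w) (u - w) = 0 := by
    rw [ip_eq_sum_simpleE7]
    simp only [posE7.ip_sub_left, h, sub_self, mul_zero, add_zero]
  rw [posE7.ip_self] at h2
  omega

/-- The coweights that are the semisimple elements of the distinguished `sl₂`-triples. -/
def distinguishedE7 : List E7Lattice :=
  [(10, 15, 20, 30, 23, 16, 9), (14, 19, 26, 38, 29, 20, 11), (18, 25, 34, 50, 39, 28, 15),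
    (22, 31, 42, 60, 47, 32, 17), (26, 37, 50, 72, 57, 40, 21), (34, 49, 66, 96, 75, 52, 27)]

theorem exists_mem_distinguishedE7 : ∀ l ∈ diagramSearch (coordE7.map fun f => posRootsE7.map f)
    (posRootsE7.map fun _ => 0), ∃ w ∈ distinguishedE7,
      l = List.ofFn fun j => (posE7.ip w (simpleE7 j)).toNat := by
  rw [diagramSearch_E7]
  decide +kernel

theorem ip_simpleE7_nonneg_of_mem_distinguishedE7 : ∀ w ∈ distinguishedE7, ∀ j,
    0 ≤ posE7.ip w (simpleE7 j) := by
  decide +kernel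

namespace E7Frame

variable {L : Type*} [LieRing L] [LieAlgebra ℂ L] (C : E7Frame L)

theorem lie_X_eq_of_ip {h : L} {u : E7Lattice} (hu : h = (1 / 2 : ℂ) • C.H u) {d : Fin 7 → ℕ}
    (hd : ∀ j, posE7.ip u (simpleE7 j) = 2 * d j) (σ : E7Lattice) :
    ⁅h, C.X σ⁆ = (degE7 d σ : ℂ) • C.X σ := by
  rw [hu, smul_lie, C.lie_H_X, smul_smul, ip_eq_two_mul_degE7 hd]
  congr 1
  push_cast
  ring

variable [FiniteDimensional ℂ L]

theorem le_two_of_isSl2Triple {h e f : L} (t : IsSl2Triple h e f) {u : E7Lattice}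
    (hu : h = (1 / 2 : ℂ) • C.H u) {d : Fin 7 → ℕ}
    (hd : ∀ j, posE7.ip u (simpleE7 j) = 2 * d j) (j : Fin 7) : d j ≤ 2 := by
  by_contra! hj
  have hs := form_eq_one_of_mem_posRootsE7 _ (simpleE7_mem_posRootsE7 j)
  have hs' : posE7.form (-simpleE7 j) (-simpleE7 j) = 1 := by
    rw [posE7.neg_left, posE7.neg_right, neg_neg, hs]
  have he : ⁅C.H u, e⁆ = (4 : ℂ) • e := by
    have h1 := t.lie_h_e_nsmul
    rw [hu, smul_lie] at h1
    have h2 := congrArg (fun x => (2 : ℂ) • x) h1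
    simp only [smul_smul, ← Nat.cast_smul_eq_nsmul ℂ] at h2
    norm_num at h2
    exact h2
  have hz : ⁅e, C.X (-simpleE7 j)⁆ = 0 := by
    rw [C.eq_sum_of_lie_H_eq (by norm_num) he, sum_lie]
    refine Finset.sum_eq_zero fun σ hσ => ?_
    have hσ := mem_rootsE7.mp hσ
    rw [smul_lie, smul_eq_zero, or_iff_not_imp_left]
    intro hc
    have hdeg : degE7 d σ = 2 := by
      by_contra hne
      refine hc (C.coef_eq_zero_of_lie_H_eq he hσ fun h4 => hne ?_)
      have : posE7.ip u σ = 4 := by exact_mod_cast h4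
      rw [ip_eq_two_mul_degE7 hd] at this
      omega
    have hne : σ ≠ simpleE7 j := by
      rintro rfl
      rw [degE7_simpleE7] at hdeg
      omega
    have hpos : ∀ τ ∈ posRootsE7, 0 ≤ degE7 d τ := fun τ hτ => by
      rw [degE7_of_mem_posRootsE7 d hτ]
      exact Int.natCast_nonneg _
    have hd2 : degE7 d (σ - simpleE7 j) < 0 := by
      rw [sub_eq_add_neg, degE7_add, degE7_neg, degE7_simpleE7]
      omega
    rw [C.lie_X_X _ _ hσ hs' (by rwa [← sub_eq_add_neg, sub_ne_zero]), ← sub_eq_add_neg]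
    rcases mem_posRootsE7_or_neg hσ with h | h
    · rcases sub_simpleE7_mem_posRootsE7 σ h j with h | h | h
      · exact absurd h hne
      · rw [C.X_eq_zero _ h, smul_zero]
      · exact absurd (hpos _ h) (not_le.mpr hd2)
    · have := hpos _ h
      rw [degE7_neg] at this
      omega
  obtain ⟨k, hk⟩ := t.slTwoRel_ad.exists_nat_of_e_apply_eq_zero hz (C.X_ne_zero hs')
    (C.lie_X_eq_of_ip hu hd _)
  rw [degE7_neg, degE7_simpleE7] at hk
  have : -(d j : ℤ) = k := by exact_mod_cast hk
  omega

theorem countP_eq_of_isSl2Triple {h e f : L} (t : IsSl2Triple h e f)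
    (h0 : ∀ x : L, ⁅e, x⁆ = 0 → ⁅h, x⁆ = 0 → x = 0) {u : E7Lattice}
    (hu : h = (1 / 2 : ℂ) • C.H u) {d : Fin 7 → ℕ}
    (hd : ∀ j, posE7.ip u (simpleE7 j) = 2 * d j) :
    7 + 2 * posRootsE7.countP (fun σ => degE7 d σ = 0) =
      posRootsE7.countP (fun σ => degE7 d σ = 2) := by
  have h1 := finrank_eigenspace_ad_eq t h0
  have hH : ∀ i, ⁅h, C.H i⁆ = 0 := fun i => by rw [hu, smul_lie, C.lie_H_H, smul_zero]
  have h2 := C.finrank_eigenspace_eq h _ hH (C.lie_X_eq_of_ip hu hd) 0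
  have h3 := C.finrank_eigenspace_eq h _ hH (C.lie_X_eq_of_ip hu hd) 2
  rw [Int.cast_zero] at h2
  rw [Int.cast_ofNat] at h3
  rw [h2, h3, List.countP_append, List.countP_append, List.countP_map, List.countP_map] at h1
  have h4 : posRootsE7.countP ((fun σ => decide (degE7 d σ = 0)) ∘ fun x => -x) =
      posRootsE7.countP (fun σ => degE7 d σ = 0) :=
    List.countP_congr fun σ _ => by simp [degE7_neg]
  have h5 : posRootsE7.countP ((fun σ => decide (degE7 d σ = 2)) ∘ fun x => -x) = 0 := by
    rw [List.countP_eq_zero]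
    intro σ hσ
    have := degE7_of_mem_posRootsE7 d hσ
    simp only [Function.comp_apply, degE7_neg, decide_eq_true_eq]
    omega
  rw [h4, h5] at h1
  simp only [if_true] at h1
  rw [if_neg (by norm_num)] at h1
  omega

/-- Up to automorphism, the semisimple element of a distinguished `sl₂`-triple is one of six
explicit coweights. -/
theorem exists_lieEquiv_apply_eq_H_distinguished {h e f : L} (t : IsSl2Triple h e f)
    (h0 : ∀ x : L, ⁅e, x⁆ = 0 → ⁅h, x⁆ = 0 → x = 0) :
    ∃ φ : L ≃ₗ⁅ℂ⁆ L, ∃ w ∈ distinguishedE7, φ h = C.H w := by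
  obtain ⟨φ, u, hu, d, hd⟩ := C.exists_lieEquiv_apply_eq_H_dominant t
  have t' := t.map_lieEquiv φ
  have h0' : ∀ x : L, ⁅φ e, x⁆ = 0 → ⁅φ h, x⁆ = 0 → x = 0 := by
    intro x hx hx'
    obtain ⟨x, rfl⟩ : ∃ y, φ y = x := φ.surjective x
    rw [← LieEquiv.map_lie] at hx hx'
    rw [h0 x (φ.injective (hx.trans (map_zero φ).symm))
      (φ.injective (hx'.trans (map_zero φ).symm)), map_zero]
  have hle := C.le_two_of_isSl2Triple t' hu hd
  have hcount := C.countP_eq_of_isSl2Triple t' h0' hu hd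
  have hcast : ∀ k : ℕ, (posRootsE7.map fun σ =>
      (List.zipWith (fun a f => a * f σ) (List.ofFn d) coordE7).sum + 0).count k =
      posRootsE7.countP (fun σ => degE7 d σ = k) := by
    intro k
    rw [List.count, List.countP_map]
    refine List.countP_congr fun σ hσ => ?_
    rw [degE7_of_mem_posRootsE7 d hσ, decide_eq_true_iff, Nat.cast_inj]
    exact beq_iff_eq
  have hmem := mem_diagramSearch posRootsE7 coordE7 (fun _ => 0) (List.ofFn d) (by simp [coordE7])
    (fun a ha => by
      obtain ⟨j, rfl⟩ := (List.mem_ofFn' _ _).mp ha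
      exact hle j) (by rw [hcast, hcast]; exact_mod_cast hcount)
  obtain ⟨w, hw, hdw⟩ := exists_mem_distinguishedE7 _ hmem
  refine ⟨φ, w, hw, ?_⟩
  have huw : u = w + w := eq_of_ip_simpleE7_eq fun j => by
    have h1 := congrFun (List.ofFn_injective hdw) j
    have h2 := ip_simpleE7_nonneg_of_mem_distinguishedE7 w hw j
    rw [hd, posE7.ip_add_left]
    omega
  rw [hu, huw, C.H_add, ← two_smul ℂ (C.H w), smul_smul]
  norm_num

end E7Frame

end Diagram

section Conjugation

open LieAlgebra Filter Topology

variable {L : Type*} [LieRing L] [LieAlgebra ℂ L]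

/-- Injectivity of `ad e` on the centralizer of `h`. -/
def InjOnCentralizer (h e : L) : Prop := ∀ x : L, ⁅e, x⁆ = 0 → ⁅h, x⁆ = 0 → x = 0

variable [FiniteDimensional ℂ L]

theorem finite_not_injOnCentralizer {h e e' : L} (he : InjOnCentralizer h e) :
    {t : ℂ | InjOnCentralizer h (e + t • (e' - e))}ᶜ.Finite := by
  obtain ⟨P, hP⟩ := LinearMap.exists_leftInverse_of_injective
    ((ad ℂ L e).domRestrict ((ad ℂ L h).eigenspace 0)) (by
      rw [LinearMap.ker_eq_bot']
      rintro ⟨x, hx⟩ h1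
      rw [End.mem_eigenspace_iff, zero_smul] at hx
      exact Subtype.ext (he x h1 hx))
  let T : End ℂ ((ad ℂ L h).eigenspace 0) :=
    P ∘ₗ (ad ℂ L e').domRestrict ((ad ℂ L h).eigenspace 0)
  have key : ∀ t ∈ {t : ℂ | InjOnCentralizer h (e + t • (e' - e))}ᶜ,
      t ≠ 0 ∧ T.HasEigenvalue ((t - 1) / t) := by
    intro t ht
    simp only [Set.mem_compl_iff, Set.mem_ofPred_eq, InjOnCentralizer, not_forall] at ht
    obtain ⟨x, h1, h2, hx0⟩ := ht
    have hx : x ∈ (ad ℂ L h).eigenspace 0 := by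
      rw [End.mem_eigenspace_iff, zero_smul]
      exact h2
    have h3 := congrArg P (show (1 - t) • (ad ℂ L e).domRestrict ((ad ℂ L h).eigenspace 0) ⟨x, hx⟩ +
        t • (ad ℂ L e').domRestrict ((ad ℂ L h).eigenspace 0) ⟨x, hx⟩ = 0 by
      rw [← h1]
      simp only [LinearMap.domRestrict_apply, ad_apply, add_lie, smul_lie, sub_lie, smul_sub,
        sub_smul, one_smul]
      abel)
    have h4 : (1 - t) • (⟨x, hx⟩ : (ad ℂ L h).eigenspace 0) + t • T ⟨x, hx⟩ = 0 := by
      rw [map_add, map_smul, map_smul, map_zero] at h3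
      rw [← h3]
      congr 2
      exact (LinearMap.congr_fun hP ⟨x, hx⟩).symm
    have ht0 : t ≠ 0 := by
      rintro rfl
      simp only [sub_zero, one_smul, zero_smul, add_zero] at h4
      exact hx0 (congrArg Subtype.val h4)
    refine ⟨ht0, End.hasEigenvalue_of_hasEigenvector (x := ⟨x, hx⟩) ⟨?_, ?_⟩⟩
    · rw [End.mem_eigenspace_iff]
      apply smul_right_injective _ ht0
      change t • T ⟨x, hx⟩ = t • ((t - 1) / t) • (⟨x, hx⟩ : (ad ℂ L h).eigenspace 0)
      rw [smul_smul, mul_div_cancel₀ _ ht0, eq_neg_of_add_eq_zero_right h4, ← neg_smul, neg_sub]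
    · exact fun h5 => hx0 (congrArg Subtype.val h5)
  refine Set.Finite.of_injOn (fun t ht => (key t ht).2) ?_ T.finite_hasEigenvalue
  intro s hs t ht hst
  have hs := (key s hs).1
  have ht := (key t ht).1
  field_simp at hst
  linear_combination hst

theorem surjective_lie_of_injOnCentralizer {h e f s : L} (t : IsSl2Triple h e f)
    (he : InjOnCentralizer h e) (hs : ⁅h, s⁆ = (2 : ℂ) • s) (hs' : InjOnCentralizer h s) {y : L}
    (hy : ⁅h, y⁆ = (2 : ℂ) • y) : ∃ u : L, ⁅h, u⁆ = 0 ∧ ⁅s, u⁆ = y := by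
  have hmem : ∀ x ∈ (ad ℂ L h).eigenspace 0, ad ℂ L s x ∈ (ad ℂ L h).eigenspace 2 := by
    intro x hx
    rw [End.mem_eigenspace_iff, ad_apply] at hx ⊢
    rw [ad_apply, leibniz_lie, hs, hx, zero_smul, lie_zero, add_zero, smul_lie]
  have hinj : Function.Injective ((ad ℂ L s).restrict hmem) := by
    refine (injective_iff_map_eq_zero _).mpr fun x hx => ?_
    have := End.mem_eigenspace_iff.mp x.2
    exact Subtype.ext (hs' x (congrArg Subtype.val hx) (by simpa using this))
  have hsurj := (LinearMap.injective_iff_surjective_of_finrank_eq_finrank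
    (finrank_eigenspace_ad_eq t he)).mp hinj
  obtain ⟨u, hu⟩ := hsurj ⟨y, End.mem_eigenspace_iff.mpr hy⟩
  refine ⟨u, ?_, congrArg Subtype.val hu⟩
  have := End.mem_eigenspace_iff.mp u.2
  simpa using this

/-- The elements `s` of degree two for which `ad s` is injective in degree zero are conjugate. -/
theorem exists_lieEquiv_apply_eq_of_injOnCentralizer {h e f e' : L} (t : IsSl2Triple h e f)
    (he : InjOnCentralizer h e) (he2 : ⁅h, e'⁆ = (2 : ℂ) • e') (he' : InjOnCentralizer h e') :
    ∃ φ : L ≃ₗ⁅ℂ⁆ L, φ h = h ∧ φ e = e' := by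
  have h2 : ⁅h, e⁆ = (2 : ℂ) • e := by
    rw [t.lie_h_e_nsmul, ← Nat.cast_smul_eq_nsmul ℂ, Nat.cast_ofNat]
  have hdeg : ∀ x : ℂ, ⁅h, e + x • (e' - e)⁆ = (2 : ℂ) • (e + x • (e' - e)) := fun x => by
    rw [lie_add, lie_smul, lie_sub, h2, he2, smul_add, ← smul_sub, smul_comm]
  obtain ⟨K, hK⟩ := Submodule.exists_isCompl ((ad ℂ L h).eigenspace 2)
  have key := related_of_eventually_related (finite_not_injOnCentralizer (e' := e') he)
    (fun x y => ∃ φ : L ≃ₗ⁅ℂ⁆ L, φ h = h ∧ φ (e + x • (e' - e)) = e + y • (e' - e))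
    (fun x y ⟨φ, h1, h3⟩ => ⟨φ.symm, by
      conv_lhs => rw [← h1, LieEquiv.symm_apply_apply],
      by rw [← h3, LieEquiv.symm_apply_apply]⟩)
    (fun x y z ⟨φ, h1, h3⟩ ⟨ψ, h4, h5⟩ => ⟨φ.trans ψ, by rw [LieEquiv.trans_apply, h1, h4],
      by rw [LieEquiv.trans_apply, h3, h5]⟩) ?_
    (x := 0) (y := 1) (by simpa using he) (by simpa using he')
  · simpa using key
  · intro x hx
    have h5 := eventually_exists_lieEquiv_apply ((ad ℂ L h).eigenspace 0) K (e + x • (e' - e))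
      (fun y => ?_) (e' - e)
    · have h6 : Tendsto (fun y : ℂ => y - x) (𝓝 x) (𝓝 0) := by
        have : ContinuousAt (fun y : ℂ => y - x) x := by fun_prop
        simpa [ContinuousAt] using this
      filter_upwards [h6.eventually h5] with y hy _
      obtain ⟨u, hu, k, hk, φ, hφ, h7⟩ := hy
      rw [End.mem_eigenspace_iff, zero_smul, ad_apply] at hu
      have h8 : φ h = h := hφ h (by rw [← lie_skew, hu, neg_zero])
      have h9 : e + y • (e' - e) = φ (e + x • (e' - e) + k) := by
        rw [← h7, sub_smul]
        abel
      have h10 : ⁅h, k⁆ = (2 : ℂ) • k := by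
        have h11 : ⁅h, e + x • (e' - e) + k⁆ = (2 : ℂ) • (e + x • (e' - e) + k) := by
          apply φ.injective
          change φ ⁅h, e + x • (e' - e) + k⁆ = φ ((2 : ℂ) • (e + x • (e' - e) + k))
          rw [LieEquiv.map_lie, h8, ← h9, hdeg, map_smul, ← h9]
        rw [lie_add, smul_add, hdeg] at h11
        exact add_left_cancel h11
      have hk0 : k = 0 := by
        have := Submodule.mem_inf.mpr
          ⟨(End.mem_eigenspace_iff (f := ad ℂ L h)).mpr h10, hk⟩
        rwa [hK.inf_eq_bot] at this
      exact ⟨φ, h8, by rw [h9, hk0, add_zero]⟩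
    · obtain ⟨y2, hy2, k, hk, rfl⟩ := Submodule.mem_sup.mp
        (hK.sup_eq_top ▸ Submodule.mem_top : y ∈ (ad ℂ L h).eigenspace 2 ⊔ K)
      obtain ⟨u, hu, hu2⟩ := surjective_lie_of_injOnCentralizer t he (hdeg x) hx
        (End.mem_eigenspace_iff.mp hy2)
      refine ⟨-u, ?_, k, hk, ?_⟩
      · rw [End.mem_eigenspace_iff, ad_apply, lie_neg, hu, neg_zero, zero_smul]
      · rw [neg_lie, lie_skew, hu2]

end Conjugation

section Transfer

open LieAlgebra

variable {L : Type*} [LieRing L] [LieAlgebra ℂ L]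

theorem InCenterOfCentralizer.map_lieEquiv {e v : L} (φ : L ≃ₗ⁅ℂ⁆ L)
    (h : InCenterOfCentralizer L e v) : InCenterOfCentralizer L (φ e) (φ v) := by
  refine ⟨by rw [← LieEquiv.map_lie, h.1, map_zero], fun y hy => ?_⟩
  obtain ⟨y, rfl⟩ : ∃ x, φ x = y := φ.surjective y
  rw [← LieEquiv.map_lie] at hy
  rw [← LieEquiv.map_lie, h.2 y (φ.injective (hy.trans (map_zero φ).symm)), map_zero]

theorem PropertyP.of_map_lieEquiv {e h f : L} (φ : L ≃ₗ⁅ℂ⁆ L)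
    (hP : PropertyP L (φ e) (φ h) (φ f)) : PropertyP L e h f := by
  have hs : ∀ {v : L}, InCenterOfCentralizer L (φ e) v → InCenterOfCentralizer L e (φ.symm v) :=
    fun hv => by simpa using hv.map_lieEquiv φ.symm
  intro m hm hmax v hv hv0 z hz hzm
  have hP' := hP m ?_ ?_ (φ v) (hv.map_lieEquiv φ)
    (fun h0 => hv0 (φ.injective (h0.trans (map_zero φ).symm))) (φ z) (hz.map_lieEquiv φ)
    (by rw [← LieEquiv.map_lie, hzm, map_smul])
  · obtain ⟨x, hx, hx2⟩ := hP'
    obtain ⟨x, rfl⟩ : ∃ y, φ y = x := φ.surjective x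
    rw [← LieEquiv.map_lie] at hx
    rw [← LieEquiv.map_lie, ← LieEquiv.map_lie] at hx2
    exact ⟨x, φ.injective (hx.trans (map_zero φ).symm), φ.injective hx2⟩
  · obtain ⟨z, hz0, hz, hzm⟩ := hm
    exact ⟨φ z, fun h0 => hz0 (φ.injective (h0.trans (map_zero φ).symm)), hz.map_lieEquiv φ,
      by rw [← LieEquiv.map_lie, hzm, map_smul]⟩
  · rintro m' ⟨z, hz0, hz, hzm⟩
    refine hmax m' ⟨φ.symm z, fun h0 => hz0 (φ.symm.injective (h0.trans (map_zero φ.symm).symm)),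
      hs hz, ?_⟩
    rw [← map_smul, ← hzm, LieEquiv.map_lie, LieEquiv.symm_apply_apply]

theorem lie_eq_smul_of_lie_eq_smul {h x y : L} {a b : ℂ} (hx : ⁅h, x⁆ = a • x)
    (hy : ⁅h, y⁆ = b • y) : ⁅h, ⁅x, y⁆⁆ = (a + b) • ⁅x, y⁆ := by
  rw [leibniz_lie, hx, hy, smul_lie, lie_smul, add_smul]

theorem IsSl2Triple.lie_h_mem_centralizer {h e f : L} (t : IsSl2Triple h e f) {y : L}
    (hy : ⁅y, e⁆ = 0) : ⁅⁅h, y⁆, e⁆ = 0 := by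
  rw [lie_lie, hy, (t.lie_h_e_smul ℂ), lie_smul, hy, smul_zero, lie_zero, sub_zero]

theorem IsSl2Triple.lie_h_mem_zCenter {h e f : L} (t : IsSl2Triple h e f) {v : L}
    (hv : v ∈ zCenter L e) : ⁅h, v⁆ ∈ zCenter L e := by
  refine ⟨t.lie_h_mem_centralizer hv.1, fun y hy => ?_⟩
  rw [lie_lie, hv.2 y hy, hv.2 _ (t.lie_h_mem_centralizer hy), lie_zero, sub_zero]

variable [FiniteDimensional ℂ L]

theorem IsSl2Triple.eq_of_lie_eq {h e f f' : L} (t : IsSl2Triple h e f) (h1 : ⁅e, f'⁆ = h)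
    (h2 : ⁅h, f'⁆ = (-2 : ℂ) • f') : f = f' := by
  by_contra hne
  have h3 : ⁅h, f⁆ = (-2 : ℂ) • f := by
    rw [t.lie_h_f_nsmul, ← Nat.cast_smul_eq_nsmul ℂ, neg_smul, Nat.cast_ofNat]
  obtain ⟨k, hk⟩ := t.slTwoRel_ad.exists_nat_of_e_apply_eq_zero (v := f - f') (μ := -2)
    (by rw [ad_apply, lie_sub, t.lie_e_f, h1, sub_self]) (sub_ne_zero.mpr hne)
    (by rw [ad_apply, lie_sub, h2, h3, smul_sub])
  have : ((-2 : ℤ) : ℂ) = ((k : ℤ) : ℂ) := by push_cast; exact hk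
  have := Int.cast_injective this
  omega

theorem IsSl2Triple.iSup_inf_eigenspace {h e f : L} (t : IsSl2Triple h e f) {p : Submodule ℂ L}
    (hp : ∀ x ∈ p, ⁅h, x⁆ ∈ p) : p = ⨆ k : ℤ, p ⊓ (ad ℂ L h).eigenspace (k : ℂ) := by
  have htop : ⨆ μ : ℂ, (ad ℂ L h).genEigenspace μ 1 = ⊤ := by
    rw [eq_top_iff, ← t.slTwoRel_ad.iSup_eigenspace_int_eq_top]
    exact iSup_le fun k => le_iSup (fun μ : ℂ => (ad ℂ L h).genEigenspace μ 1) (k : ℂ)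
  refine le_antisymm ?_ (iSup_le fun k => inf_le_left)
  conv_lhs => rw [Submodule.eq_iSup_inf_genEigenspace 1 hp htop]
  refine iSup_le fun μ => ?_
  intro x hx
  by_cases hx0 : x = 0
  · rw [hx0]
    exact Submodule.zero_mem _
  · obtain ⟨k, rfl⟩ := t.slTwoRel_ad.exists_int_of_hasEigenvector hx0
      (End.mem_eigenspace_iff.mp hx.2)
    exact Submodule.mem_iSup_of_mem k hx

theorem inCenterOfCentralizer_of_top {h e f : L} (t : IsSl2Triple h e f)
    (h0 : InjOnCentralizer h e) {N : ℤ}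
    (htop : ∀ k : ℤ, N < k → ∀ x : L, ⁅h, x⁆ = (k : ℂ) • x → x = 0) {z : L}
    (hz : ⁅h, z⁆ = (N : ℂ) • z) : InCenterOfCentralizer L e z := by
  refine ⟨htop (N + 2) (by omega) _ ?_, fun y hy => ?_⟩
  · rw [lie_eq_smul_of_lie_eq_smul hz (t.lie_h_e_smul ℂ)]
    push_cast
    rfl
  · have hy' : y ∈ (centralizer L e).toSubmodule := hy
    rw [t.iSup_inf_eigenspace (p := (centralizer L e).toSubmodule)
      fun x hx => t.lie_h_mem_centralizer hx] at hy'
    clear hy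
    induction hy' using Submodule.iSup_induction' with
    | zero => exact lie_zero _
    | add x y _ _ hx hy => rw [lie_add, hx, hy, add_zero]
    | mem k x hx =>
      by_cases hx0 : x = 0
      · rw [hx0, lie_zero]
      · have h1 : ⁅x, e⁆ = 0 := hx.1
        have h2 : ⁅e, x⁆ = 0 := by rw [← lie_skew, h1, neg_zero]
        have h3 : ⁅h, x⁆ = (k : ℂ) • x := End.mem_eigenspace_iff.mp hx.2
        obtain ⟨n, hn⟩ := t.slTwoRel_ad.exists_nat_of_e_apply_eq_zero h2 hx0 h3
        have hn : k = n := by exact_mod_cast hn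
        have hk : k ≠ 0 := by
          rintro rfl
          exact hx0 (h0 x h2 (by rw [h3, Int.cast_zero, zero_smul]))
        refine htop (N + k) (by omega) _ ?_
        rw [lie_eq_smul_of_lie_eq_smul hz h3]
        push_cast
        rfl

/-- Property (P) can be checked on homogeneous elements. -/
theorem propertyP_of_homogeneous {h e f : L} (t : IsSl2Triple h e f) (h0 : InjOnCentralizer h e)
    {N : ℤ} (htop : ∀ k : ℤ, N < k → ∀ x : L, ⁅h, x⁆ = (k : ℂ) • x → x = 0)
    (hN : ∃ z : L, z ≠ 0 ∧ ⁅h, z⁆ = (N : ℂ) • z)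
    (H : ∀ (a : ℤ) (v z : L), v ≠ 0 → InCenterOfCentralizer L e v → ⁅h, v⁆ = (a : ℂ) • v →
      ⁅h, z⁆ = (N : ℂ) • z →
      ∃ x : L, ⁅x, e⁆ = 0 ∧ ⁅h, x⁆ = ((N - a + 2 : ℤ) : ℂ) • x ∧ ⁅⁅f, x⁆, v⁆ = z) :
    PropertyP L e h f := by
  intro m ⟨z₀, hz₀, hz₀c, hz₀m⟩ hmax v hv hv0 z hz hzm
  obtain rfl : m = N := by
    obtain ⟨k, rfl⟩ := t.slTwoRel_ad.exists_int_of_hasEigenvector hz₀ hz₀m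
    obtain ⟨z₁, hz₁, hz₁N⟩ := hN
    have h1 := hmax N ⟨z₁, hz₁, inCenterOfCentralizer_of_top t h0 htop hz₁N, hz₁N⟩
    have h2 : N ≤ k := by simpa using (Complex.le_def.mp h1).1
    have h3 : ¬ N < k := fun h4 => hz₀ (htop k h4 z₀ hz₀m)
    rw [le_antisymm (not_lt.mp h3) h2]
  have hv' : v ∈ ⨆ k : ℤ, zCenter L e ⊓ (ad ℂ L h).eigenspace (k : ℂ) := by
    rw [← t.iSup_inf_eigenspace fun x hx => t.lie_h_mem_zCenter hx]
    exact hv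
  obtain ⟨c, hc, hcv⟩ := (Submodule.mem_iSup_iff_exists_finsupp _ _).mp hv'
  have hne : c.support.Nonempty := by
    rw [Finset.nonempty_iff_ne_empty]
    intro he
    rw [Finsupp.support_eq_empty.mp he, Finsupp.sum_zero_index] at hcv
    exact hv0 hcv.symm
  obtain ⟨a, ha, hamin⟩ := c.support.exists_min_image id hne
  have hh : ∀ k, ⁅h, c k⁆ = (k : ℂ) • c k := fun k => End.mem_eigenspace_iff.mp (hc k).2
  obtain ⟨x, hx, hxd, hxz⟩ := H a (c a) z (Finsupp.mem_support_iff.mp ha) (hc a).1 (hh a) hzm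
  refine ⟨x, hx, ?_⟩
  rw [← hcv, Finsupp.sum, lie_sum, ← hxz]
  refine Finset.sum_eq_single_of_mem a ha fun k hk hka => ?_
  have hak : a ≤ k := hamin k hk
  refine htop (N - a + k) (by omega) _ ?_
  have h3 : ⁅h, f⁆ = (-2 : ℂ) • f := by
    rw [t.lie_h_f_nsmul, ← Nat.cast_smul_eq_nsmul ℂ, neg_smul, Nat.cast_ofNat]
  rw [lie_eq_smul_of_lie_eq_smul (lie_eq_smul_of_lie_eq_smul h3 hxd) (hh k)]
  congr 1
  push_cast
  ring

end Transfer

section Elimination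

/-- The value at `c` of the linear form with integer coefficients `r`. -/
def linEval : List ℤ → List ℂ → ℂ
  | a :: r, x :: c => a * x + linEval r c
  | _, _ => 0

/-- The linear combination `a • r + b • s` of two coefficient lists. -/
def linComb (a b : ℤ) : List ℤ → List ℤ → List ℤ
  | x :: r, y :: s => (a * x + b * y) :: linComb a b r s
  | [], s => s.map (b * ·)
  | r, [] => r.map (a * ·)

theorem linEval_map_mul (a : ℤ) : ∀ (r : List ℤ) (c : List ℂ),
    linEval (r.map (a * ·)) c = a * linEval r c
  | [], _ => by simp [linEval]
  | _ :: _, [] => by simp [linEval]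
  | x :: r, y :: c => by
    simp only [List.map_cons, linEval, linEval_map_mul a r c]
    push_cast
    ring

theorem linEval_linComb (a b : ℤ) : ∀ (r s : List ℤ) (c : List ℂ),
    linEval (linComb a b r s) c = a * linEval r c + b * linEval s c
  | [], s, c => by simp [linComb, linEval_map_mul, linEval]
  | x :: r, [], c => by
    rw [linComb, linEval_map_mul]
    · simp [linEval]
    · simp
  | x :: r, y :: s, [] => by simp [linComb, linEval]
  | x :: r, y :: s, z :: c => by
    simp only [linComb, linEval, linEval_linComb a b r s c]
    push_cast
    ring

/-- Eliminate the first unknown from the equation `r` using the equation `p`. -/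
def elimHead (p r : List ℤ) : List ℤ :=
  if r.headD 0 = 0 then r.tail else linComb (p.headD 0) (-r.headD 0) r.tail p.tail

/-- A sufficient test for a homogeneous linear system in `n` unknowns to have only the zero
solution, by Gaussian elimination. -/
def elimTest : ℕ → List (List ℤ) → Bool
  | 0, _ => true
  | n + 1, rows =>
    match (rows.find? fun r => r.headD 0 == 1 || r.headD 0 == -1) <|>
        rows.find? fun r => r.headD 0 != 0 with
    | none => false
    | some p => elimTest n ((rows.map (elimHead p)).filter fun r => r.any (· != 0))

theorem linEval_cons_right (r : List ℤ) (x : ℂ) (c : List ℂ) :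
    linEval r (x :: c) = r.headD 0 * x + linEval r.tail c := by
  cases r <;> simp [linEval]

theorem eq_zero_of_elimTest : ∀ (n : ℕ) (rows : List (List ℤ)), elimTest n rows = true →
    ∀ c : List ℂ, c.length = n → (∀ r ∈ rows, linEval r c = 0) → ∀ x ∈ c, x = 0
  | 0, _, _, c, hc, _ => by simp [List.length_eq_zero_iff.mp hc]
  | n + 1, rows, ht, [], hc, _ => by simp at hc
  | n + 1, rows, ht, x :: c, hc, h => by
    rw [elimTest] at ht
    split at ht
    · simp at ht
    · rename_i p hp
      have hp' : p ∈ rows ∧ p.headD 0 ≠ 0 := by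
        rw [Option.orElse_eq_some] at hp
        rcases hp with hp | ⟨-, hp⟩
        · refine ⟨List.mem_of_find?_eq_some hp, ?_⟩
          have := List.find?_some hp
          intro h0
          rw [h0] at this
          simp at this
        · exact ⟨List.mem_of_find?_eq_some hp, by simpa using List.find?_some hp⟩
      obtain ⟨hp, hp0⟩ := hp'
      have hpe := h p hp
      rw [linEval_cons_right] at hpe
      have hc0 : ∀ y ∈ c, y = 0 := by
        refine eq_zero_of_elimTest n _ ht c (by simpa using hc) fun r' hr' => ?_
        obtain ⟨r, hr, rfl⟩ := List.mem_map.mp (List.mem_filter.mp hr').1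
        have hre := h r hr
        rw [linEval_cons_right] at hre
        rw [elimHead]
        split
        · rename_i h0
          rwa [h0, Int.cast_zero, zero_mul, zero_add] at hre
        · rw [linEval_linComb]
          push_cast
          linear_combination (p.headD 0 : ℂ) * hre - (r.headD 0 : ℂ) * hpe
      have hx : linEval p.tail c = 0 := by
        clear hpe hc ht h
        generalize p.tail = r
        induction c generalizing r with
        | nil => cases r <;> rfl
        | cons y c ih =>
          rw [linEval_cons_right, hc0 y (by simp), ih fun y hy => hc0 y (by simp [hy])]
          simp
      rw [hx, add_zero, mul_eq_zero, Int.cast_eq_zero, or_iff_right hp0] at hpe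
      intro y hy
      rcases List.mem_cons.mp hy with rfl | hy
      · exact hpe
      · exact hc0 y hy

end Elimination

section RootVectors

open LieAlgebra

/-- Does a formal combination of root vectors represent zero? -/
def isZeroE7 (l : List (E7Lattice × ℤ)) : Bool :=
  l.all fun p => ((l.filter fun q => q.1 = p.1).map Prod.snd).sum == 0

/-- The root vector component of the bracket of two formal combinations of root vectors. -/
def lieE7 (l l' : List (E7Lattice × ℤ)) : List (E7Lattice × ℤ) :=
  l.flatMap fun p => (l'.filter fun q => posE7.form (p.1 + q.1) (p.1 + q.1) = 1).map
    fun q => (p.1 + q.1, p.2 * q.2 * posE7.eps p.1 q.1)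

/-- The Cartan component of the bracket of two formal combinations of root vectors. -/
def lieCartanE7 (l l' : List (E7Lattice × ℤ)) : E7Lattice :=
  (l.map fun p => ((l'.filter fun q => p.1 + q.1 = 0).map fun q => -(p.2 * q.2) • p.1).sum).sum

/-- The matrix row that computes the component at `τ` of the bracket of `y` with a combination of
the root vectors of `D`. -/
def lieRowE7 (y : List (E7Lattice × ℤ)) (τ : E7Lattice) (D : List E7Lattice) : List ℤ :=
  D.map fun β => (y.map fun p => if p.1 + β = τ then p.2 * posE7.eps p.1 β else 0).sum

/-- The positive roots of degree `a` for the grading given by `w`. -/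
def levelE7 (w : E7Lattice) (a : ℤ) : List E7Lattice :=
  posRootsE7.filter fun σ => posE7.ip w σ = a

/-- Do all roots in a formal combination have degree `a`? -/
def isHomogE7 (w : E7Lattice) (a : ℤ) (l : List (E7Lattice × ℤ)) : Bool :=
  l.all fun p => posE7.form p.1 p.1 == 1 && posE7.ip w p.1 == a

theorem form_eq_one_of_isHomogE7 {w : E7Lattice} {a : ℤ} {l : List (E7Lattice × ℤ)}
    (h : isHomogE7 w a l = true) : ∀ p ∈ l, posE7.form p.1 p.1 = 1 := fun p hp => by
  have := List.all_eq_true.mp h p hp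
  simp only [Bool.and_eq_true, beq_iff_eq] at this
  exact this.1

theorem form_eq_one_of_mem_levelE7 {w : E7Lattice} {a : ℤ} {σ : E7Lattice}
    (h : σ ∈ levelE7 w a) : posE7.form σ σ = 1 :=
  form_eq_one_of_mem_posRootsE7 σ (List.mem_filter.mp h).1

theorem mem_levelE7 {w : E7Lattice} {a : ℤ} {σ : E7Lattice} (hw : ∀ j, 0 ≤ posE7.ip w (simpleE7 j))
    (ha : 0 < a) (h : posE7.form σ σ = 1) (hσ : posE7.ip w σ = a) : σ ∈ levelE7 w a := by
  refine List.mem_filter.mpr ⟨(mem_posRootsE7_or_neg h).resolve_right fun hn => ?_, by simpa using hσ⟩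
  have h1 : 0 ≤ posE7.ip w (-σ) := by
    obtain ⟨h0, h1, h2, h3, h4, h5, h6⟩ := nonneg_of_mem_posRootsE7 _ hn
    rw [ip_eq_sum_simpleE7]
    have := mul_nonneg h0 (hw 0)
    have := mul_nonneg h1 (hw 1)
    have := mul_nonneg h2 (hw 2)
    have := mul_nonneg h3 (hw 3)
    have := mul_nonneg h4 (hw 4)
    have := mul_nonneg h5 (hw 5)
    have := mul_nonneg h6 (hw 6)
    linarith
  rw [posE7.ip_neg_right] at h1
  omega

theorem form_eq_one_of_mem_lieE7 (l l' : List (E7Lattice × ℤ)) :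
    ∀ p ∈ lieE7 l l', posE7.form p.1 p.1 = 1 := fun p hp => by
  obtain ⟨q, hq, hp⟩ := List.mem_flatMap.mp hp
  obtain ⟨r, hr, rfl⟩ := List.mem_map.mp hp
  simpa using (List.mem_filter.mp hr).2

theorem nodup_levelE7 (w : E7Lattice) (a : ℤ) : (levelE7 w a).Nodup :=
  (List.nodup_append.mp nodup_rootsE7).1.filter _

namespace E7Frame

variable {L : Type*} [LieRing L] [LieAlgebra ℂ L] (C : E7Frame L)

/-- The element of the Lie algebra given by a formal combination of root vectors. -/
def rootVec (l : List (E7Lattice × ℤ)) : L := (l.map fun p => (p.2 : ℂ) • C.X p.1).sum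

theorem rootVec_nil : C.rootVec [] = 0 := rfl

theorem rootVec_cons (p : E7Lattice × ℤ) (l : List (E7Lattice × ℤ)) :
    C.rootVec (p :: l) = (p.2 : ℂ) • C.X p.1 + C.rootVec l := by
  rw [rootVec, List.map_cons, List.sum_cons, rootVec]

theorem rootVec_append (l l' : List (E7Lattice × ℤ)) :
    C.rootVec (l ++ l') = C.rootVec l + C.rootVec l' := by
  rw [rootVec, List.map_append, List.sum_append, rootVec, rootVec]

theorem rootVec_eq_zero {l : List (E7Lattice × ℤ)} (h : isZeroE7 l = true) : C.rootVec l = 0 := by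
  classical
  have h1 : C.rootVec l = ∑ σ ∈ (l.map Prod.fst).toFinset,
      ((((l.filter fun q => q.1 = σ).map Prod.snd).sum : ℤ) : ℂ) • C.X σ := by
    clear h
    have key : ∀ (l' : List (E7Lattice × ℤ)) (S : Finset E7Lattice), (∀ p ∈ l', p.1 ∈ S) →
        C.rootVec l' = ∑ σ ∈ S,
          ((((l'.filter fun q => q.1 = σ).map Prod.snd).sum : ℤ) : ℂ) • C.X σ := by
      intro l' S
      induction l' with
      | nil => simp [rootVec_nil]
      | cons p l' ih =>
        intro hS
        rw [rootVec_cons, ih fun q hq => hS q (by simp [hq]),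
          ← Finset.sum_erase_add _ _ (hS p (by simp)), ← Finset.sum_erase_add S _ (hS p (by simp)),
          add_left_comm]
        refine congrArg₂ (· + ·) (Finset.sum_congr rfl fun σ hσ => ?_) ?_
        · have : p.1 ≠ σ := (Finset.ne_of_mem_erase hσ).symm
          simp [this]
        · simp [add_smul]
    exact key l _ fun p hp => by simpa using ⟨p.2, hp⟩
  rw [h1]
  refine Finset.sum_eq_zero fun σ hσ => ?_
  obtain ⟨p, hp, rfl⟩ := List.mem_map.mp (List.mem_toFinset.mp hσ)
  have := List.all_eq_true.mp h p hp
  rw [beq_iff_eq] at this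
  rw [this, Int.cast_zero, zero_smul]

theorem lie_H_rootVec {w : E7Lattice} {a : ℤ} {l : List (E7Lattice × ℤ)}
    (h : isHomogE7 w a l = true) : ⁅C.H w, C.rootVec l⁆ = (a : ℂ) • C.rootVec l := by
  induction l with
  | nil => simp [rootVec_nil]
  | cons p l ih =>
    simp only [isHomogE7, List.all_cons, Bool.and_eq_true, beq_iff_eq] at h ih
    rw [rootVec_cons, lie_add, lie_smul, C.lie_H_X, ih h.2, h.1.2, smul_add, smul_comm]

theorem lie_X_X_eq {γ δ : E7Lattice} (hγ : posE7.form γ γ = 1) (hδ : posE7.form δ δ = 1) :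
    ⁅C.X γ, C.X δ⁆ = (if posE7.form (γ + δ) (γ + δ) = 1 then
      (posE7.eps γ δ : ℂ) • C.X (γ + δ) else 0) + if γ + δ = 0 then -C.H γ else 0 := by
  by_cases h0 : γ + δ = 0
  · rw [if_pos h0, if_neg, zero_add, ← C.lie_X_neg γ hγ, eq_neg_of_add_eq_zero_right h0]
    rw [h0, posE7.zero_left]
    omega
  · rw [if_neg h0, add_zero, C.lie_X_X γ δ hγ hδ h0]
    split
    · rfl
    · rename_i h
      rw [C.X_eq_zero _ h, smul_zero]

theorem lie_rootVec {l l' : List (E7Lattice × ℤ)} (hl : ∀ p ∈ l, posE7.form p.1 p.1 = 1)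
    (hl' : ∀ p ∈ l', posE7.form p.1 p.1 = 1) :
    ⁅C.rootVec l, C.rootVec l'⁆ = C.rootVec (lieE7 l l') + C.H (lieCartanE7 l l') := by
  induction l with
  | nil => simp [rootVec_nil, lieE7, lieCartanE7, C.H_zero]
  | cons p l ih =>
    have h1 : ⁅(p.2 : ℂ) • C.X p.1, C.rootVec l'⁆ =
        C.rootVec ((l'.filter fun q => posE7.form (p.1 + q.1) (p.1 + q.1) = 1).map
          fun q => (p.1 + q.1, p.2 * q.2 * posE7.eps p.1 q.1)) +
        C.H ((l'.filter fun q => p.1 + q.1 = 0).map fun q => -(p.2 * q.2) • p.1).sum := by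
      have hp := hl p (by simp)
      clear ih hl
      induction l' with
      | nil => simp [rootVec_nil, C.H_zero]
      | cons q l' ih =>
        rw [rootVec_cons, lie_add, ih fun r hr => hl' r (by simp [hr]), smul_lie, lie_smul,
          C.lie_X_X_eq hp (hl' q (by simp)), List.filter_cons, List.filter_cons]
        have hH : C.H (-(p.2 * q.2) • p.1) = -((p.2 * q.2 : ℂ) • C.H p.1) := by
          have := C.HHom.map_zsmul (-(p.2 * q.2)) p.1
          rw [← Int.cast_smul_eq_zsmul ℂ _ (C.HHom p.1)] at this
          rw [← neg_smul]
          refine this.trans (congrArg (fun c : ℂ => c • C.H p.1) ?_)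
          push_cast
          rfl
        by_cases ha : posE7.form (p.1 + q.1) (p.1 + q.1) = 1 <;> by_cases hb : p.1 + q.1 = 0 <;>
          simp only [ha, hb, if_true, if_false, decide_true, decide_false, List.map_cons,
            List.sum_cons, rootVec_cons, C.H_add, hH, smul_add, smul_neg, smul_smul, smul_zero,
            Int.cast_mul, Bool.false_eq_true, posE7.zero_left, zero_ne_one] <;>
          module
    rw [rootVec_cons, add_lie, h1, ih fun q hq => hl q (by simp [hq])]
    simp only [lieE7, lieCartanE7, List.flatMap_cons, rootVec_append, List.map_cons, List.sum_cons,
      C.H_add]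
    abel

theorem lie_rootVec_eq_zero {l l' : List (E7Lattice × ℤ)}
    (hl : ∀ p ∈ l, posE7.form p.1 p.1 = 1) (hl' : ∀ p ∈ l', posE7.form p.1 p.1 = 1)
    (h1 : isZeroE7 (lieE7 l l') = true) (h2 : lieCartanE7 l l' = 0) :
    ⁅C.rootVec l, C.rootVec l'⁆ = 0 := by
  rw [C.lie_rootVec hl hl', C.rootVec_eq_zero h1, h2, C.H_zero, add_zero]

theorem coef_lie_rootVec_X {y : List (E7Lattice × ℤ)} (hy : ∀ p ∈ y, posE7.form p.1 p.1 = 1)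
    {β τ : E7Lattice} (hβ : posE7.form β β = 1) (hτ : posE7.form τ τ = 1) :
    C.coef τ ⁅C.rootVec y, C.X β⁆ =
      ((y.map fun p => if p.1 + β = τ then p.2 * posE7.eps p.1 β else 0).sum : ℤ) := by
  induction y with
  | nil => simp [rootVec_nil]
  | cons p y ih =>
    rw [rootVec_cons, add_lie, map_add, ih fun q hq => hy q (by simp [hq]), List.map_cons,
      List.sum_cons, Int.cast_add, smul_lie, map_smul, C.lie_X_X_eq (hy p (by simp)) hβ, map_add,
      smul_eq_mul]
    have h1 : C.coef τ (if p.1 + β = 0 then -C.H p.1 else 0) = 0 := by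
      split
      · rw [map_neg, C.coef_H _ _ hτ, neg_zero]
      · exact map_zero _
    rw [h1, add_zero]
    congr 1
    by_cases h : p.1 + β = τ
    · rw [h, if_pos hτ, if_pos rfl, map_smul, C.coef_X _ _ hτ, if_pos rfl]
      simp
    · rw [if_neg h]
      split
      · rw [map_smul, C.coef_X _ _ hτ, if_neg h]
        simp
      · simp

theorem coef_lie_rootVec_sum {y : List (E7Lattice × ℤ)} (hy : ∀ p ∈ y, posE7.form p.1 p.1 = 1)
    {D : List E7Lattice} (hD : ∀ σ ∈ D, posE7.form σ σ = 1) {τ : E7Lattice}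
    (hτ : posE7.form τ τ = 1) (c : E7Lattice → ℂ) :
    C.coef τ ⁅C.rootVec y, (D.map fun σ => c σ • C.X σ).sum⁆ =
      linEval (lieRowE7 y τ D) (D.map c) := by
  induction D with
  | nil => simp [lieRowE7, linEval]
  | cons β D ih =>
    rw [List.map_cons, List.sum_cons, lie_add, map_add, ih fun σ hσ => hD σ (by simp [hσ]),
      lie_smul, map_smul, C.coef_lie_rootVec_X hy (hD β (by simp)) hτ, smul_eq_mul, mul_comm]
    simp only [lieRowE7, List.map_cons, linEval]

theorem sum_rootsE7_eq_sum_list {D : List E7Lattice} (hD : D.Nodup)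
    (hD1 : ∀ σ ∈ D, posE7.form σ σ = 1) {c : E7Lattice → ℂ}
    (hc : ∀ σ, posE7.form σ σ = 1 → σ ∉ D → c σ = 0) :
    ∑ σ ∈ rootsE7, c σ • C.X σ = (D.map fun σ => c σ • C.X σ).sum := by
  classical
  rw [← List.sum_toFinset _ hD]
  symm
  refine Finset.sum_subset (fun σ hσ => mem_rootsE7.mpr (hD1 σ (List.mem_toFinset.mp hσ)))
    fun σ hσ hn => ?_
  rw [hc σ (mem_rootsE7.mp hσ) (fun h => hn (List.mem_toFinset.mpr h)), zero_smul]

theorem eq_sum_levelE7 {w : E7Lattice} (hw : ∀ j, 0 ≤ posE7.ip w (simpleE7 j)) {a : ℤ} (ha : 0 < a)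
    {v : L} (hv : ⁅C.H w, v⁆ = (a : ℂ) • v) :
    v = ((levelE7 w a).map fun σ => C.coef σ v • C.X σ).sum := by
  conv_lhs => rw [C.eq_sum_of_lie_H_eq (by exact_mod_cast ha.ne') hv]
  refine C.sum_rootsE7_eq_sum_list (nodup_levelE7 w a) (fun σ => form_eq_one_of_mem_levelE7)
    fun σ hσ hn => C.coef_eq_zero_of_lie_H_eq hv hσ fun h => hn (mem_levelE7 hw ha hσ ?_)
  exact_mod_cast h

theorem eq_of_coef_levelE7_eq {w : E7Lattice} (hw : ∀ j, 0 ≤ posE7.ip w (simpleE7 j)) {a : ℤ}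
    (ha : 0 < a) {u v : L} (hu : ⁅C.H w, u⁆ = (a : ℂ) • u) (hv : ⁅C.H w, v⁆ = (a : ℂ) • v)
    (h : ∀ σ ∈ levelE7 w a, C.coef σ u = C.coef σ v) : u = v := by
  rw [C.eq_sum_levelE7 hw ha hu, C.eq_sum_levelE7 hw ha hv]
  refine congrArg List.sum (List.map_congr_left fun σ hσ => ?_)
  rw [h σ hσ]

theorem coef_lie_rootVec {w : E7Lattice} (hw : ∀ j, 0 ≤ posE7.ip w (simpleE7 j)) {a : ℤ}
    (ha : 0 < a) {v : L} (hv : ⁅C.H w, v⁆ = (a : ℂ) • v) {y : List (E7Lattice × ℤ)}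
    (hy : ∀ p ∈ y, posE7.form p.1 p.1 = 1) {τ : E7Lattice} (hτ : posE7.form τ τ = 1) :
    C.coef τ ⁅C.rootVec y, v⁆ =
      linEval (lieRowE7 y τ (levelE7 w a)) ((levelE7 w a).map fun σ => C.coef σ v) := by
  conv_lhs => rw [C.eq_sum_levelE7 hw ha hv]
  exact C.coef_lie_rootVec_sum hy (fun σ => form_eq_one_of_mem_levelE7) hτ _

end E7Frame

end RootVectors

section Tests

open LieAlgebra

/-- Does a formal combination of root vectors of degree `k` commute with `e`? -/
def commTestE7 (w : E7Lattice) (e : List (E7Lattice × ℤ)) (k : ℤ) (x : List (E7Lattice × ℤ)) :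
    Bool :=
  isHomogE7 w k x && isZeroE7 (lieE7 x e) && lieCartanE7 x e == 0

/-- The row that computes the component at `τ` of the bracket of `e` with a Cartan element. -/
def cartanRowE7 (e : List (E7Lattice × ℤ)) (τ : E7Lattice) : List ℤ :=
  (List.finRange 7).map fun i =>
    (e.map fun p => if p.1 = τ then -(p.2 * posE7.ip (simpleE7 i) τ) else 0).sum

/-- The roots of degree zero for the grading given by `w`. -/
def zeroLevelE7 (w : E7Lattice) : List E7Lattice :=
  (posRootsE7 ++ posRootsE7.map fun x => -x).filter fun σ => posE7.ip w σ = 0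

/-- A sufficient test for `ad e` to be injective in degree zero. -/
def injTestE7 (w : E7Lattice) (e : List (E7Lattice × ℤ)) : Bool :=
  elimTest (7 + (zeroLevelE7 w).length)
    ((levelE7 w 2).map fun τ => cartanRowE7 e τ ++ lieRowE7 e τ (zeroLevelE7 w))

/-- A sufficient test for `w`, `e`, `f` to define an `sl₂`-triple. -/
def tripleTestE7 (w : E7Lattice) (e f : List (E7Lattice × ℤ)) : Bool :=
  isHomogE7 w 2 e && isHomogE7 w (-2) f && isZeroE7 (lieE7 e f) && lieCartanE7 e f == w

/-- A sufficient test for an element `v` of degree `a` to vanish if it commutes with `e` and the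
elements of `xs` and if, for the pairs `(x, τ)` in `ys`, the component at `τ` of `⁅⁅f, x⁆, v⁆`
vanishes. -/
def vanishTestE7 (w : E7Lattice) (e f : List (E7Lattice × ℤ)) (a : ℤ)
    (xs : List (ℤ × List (E7Lattice × ℤ))) (ys : List (List (E7Lattice × ℤ) × E7Lattice)) : Bool :=
  xs.all (fun x => commTestE7 w e x.1 x.2) && elimTest (levelE7 w a).length
    ((levelE7 w (a + 2)).map (fun τ => lieRowE7 e τ (levelE7 w a)) ++
      xs.flatMap (fun x => (levelE7 w (a + x.1)).map fun τ => lieRowE7 x.2 τ (levelE7 w a)) ++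
      ys.map fun y => lieRowE7 (lieE7 f y.1) y.2 (levelE7 w a))

theorem linEval_append : ∀ {r : List ℤ} {c : List ℂ} (s : List ℤ) (d : List ℂ),
    r.length = c.length → linEval (r ++ s) (c ++ d) = linEval r c + linEval s d
  | [], [], s, d, _ => by simp [linEval]
  | a :: r, x :: c, s, d, h => by
    simp only [List.cons_append, linEval,
      linEval_append s d (show r.length = c.length by simpa using h)]
    ring
  | [], _ :: _, _, _, h => by simp at h
  | _ :: _, [], _, _, h => by simp at h

theorem linEval_map_eq_sum {ι : Type*} (l : List ι) (a : ι → ℤ) (c : ι → ℂ) :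
    linEval (l.map a) (l.map c) = (l.map fun i => (a i : ℂ) * c i).sum := by
  induction l with
  | nil => rfl
  | cons i l ih => simp only [List.map_cons, linEval, List.sum_cons, ih]

namespace E7Frame

variable {L : Type*} [LieRing L] [LieAlgebra ℂ L] (C : E7Frame L)

theorem coef_lie_rootVec_H (e : List (E7Lattice × ℤ)) {τ : E7Lattice}
    (hτ : posE7.form τ τ = 1) (α : E7Lattice) :
    C.coef τ ⁅C.rootVec e, C.H α⁆ =
      ((e.map fun p => if p.1 = τ then -(p.2 * posE7.ip α τ) else 0).sum : ℤ) := by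
  rw [← lie_skew, map_neg, C.coef_lie_H _ _ hτ]
  induction e with
  | nil => simp [rootVec_nil]
  | cons p e ih =>
    rw [rootVec_cons, map_add, map_smul, C.coef_X _ _ hτ, mul_add, neg_add, ih, List.map_cons,
      List.sum_cons, Int.cast_add]
    congr 1
    split
    · push_cast
      simp [mul_comm]
    · simp

theorem injOnCentralizer_of_injTestE7 {w : E7Lattice} {e : List (E7Lattice × ℤ)}
    (he : ∀ p ∈ e, posE7.form p.1 p.1 = 1) (ht : injTestE7 w e = true) :
    InjOnCentralizer (C.H w) (C.rootVec e) := by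
  intro x hx hx0
  obtain ⟨c, hc⟩ := C.exists_eq_sum x
  have hroot : ∀ σ, posE7.form σ σ = 1 ↔ σ ∈ posRootsE7 ++ posRootsE7.map fun x => -x := fun σ => by
    rw [← mem_rootsE7, rootsE7, List.mem_toFinset]
  have hD : ∀ σ ∈ zeroLevelE7 w, posE7.form σ σ = 1 := fun σ hσ =>
    (hroot σ).mpr (List.mem_filter.mp hσ).1
  rw [C.sum_rootsE7_eq_sum_list (D := zeroLevelE7 w) (nodup_rootsE7.filter _) hD
    (fun σ hσ hn => C.coef_eq_zero_of_lie_H_eq (μ := 0) (by rw [hx0, zero_smul]) hσ fun h => hn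
      (List.mem_filter.mpr ⟨(hroot σ).mp hσ, by simpa using h⟩))] at hc
  have hz := eq_zero_of_elimTest _ _ ht
    ((List.finRange 7).map c ++ (zeroLevelE7 w).map fun σ => C.coef σ x)
    (by rw [List.length_append, List.length_map, List.length_map, List.length_finRange])
    (by
      intro r hr
      obtain ⟨τ, hτ, rfl⟩ := List.mem_map.mp hr
      have hτ := form_eq_one_of_mem_levelE7 hτ
      rw [linEval_append _ _ (by simp [cartanRowE7]),
        ← C.coef_lie_rootVec_sum he hD hτ (fun σ => C.coef σ x), cartanRowE7, linEval_map_eq_sum,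
        ← List.ofFn_eq_map, List.sum_ofFn]
      have h1 := congrArg (C.coef τ) hx
      rw [hc, lie_add, lie_sum, map_add, map_sum, map_zero] at h1
      convert h1 using 2
      · refine Finset.sum_congr rfl fun i _ => ?_
        rw [lie_smul, map_smul, C.coef_lie_rootVec_H e hτ, smul_eq_mul, mul_comm])
  rw [hc, Finset.sum_eq_zero fun i _ => ?_, List.sum_eq_zero, add_zero]
  · intro y hy
    obtain ⟨σ, hσ, rfl⟩ := List.mem_map.mp hy
    rw [hz _ (List.mem_append.mpr (Or.inr (List.mem_map.mpr ⟨σ, hσ, rfl⟩))), zero_smul]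
  · rw [hz _ (List.mem_append.mpr (Or.inl (List.mem_map.mpr ⟨i, List.mem_finRange i, rfl⟩))),
      zero_smul]

theorem eq_zero_of_vanishTestE7 {w : E7Lattice} (hw : ∀ j, 0 ≤ posE7.ip w (simpleE7 j))
    {e f : List (E7Lattice × ℤ)} (he : ∀ p ∈ e, posE7.form p.1 p.1 = 1) {a : ℤ} (ha : 0 < a)
    {xs : List (ℤ × List (E7Lattice × ℤ))} {ys : List (List (E7Lattice × ℤ) × E7Lattice)}
    (ht : vanishTestE7 w e f a xs ys = true) {v : L} (hv : ⁅C.H w, v⁆ = (a : ℂ) • v)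
    (hcen : InCenterOfCentralizer L (C.rootVec e) v)
    (hys : ∀ y ∈ ys, posE7.form y.2 y.2 = 1 ∧ (∀ p ∈ lieE7 f y.1, posE7.form p.1 p.1 = 1) ∧
      C.coef y.2 ⁅C.rootVec (lieE7 f y.1), v⁆ = 0) : v = 0 := by
  rw [vanishTestE7, Bool.and_eq_true] at ht
  have hz := eq_zero_of_elimTest _ _ ht.2 ((levelE7 w a).map fun σ => C.coef σ v)
    (List.length_map ..) ?_
  · refine C.eq_of_coef_levelE7_eq hw ha hv (by rw [lie_zero, smul_zero]) fun σ hσ => ?_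
    rw [map_zero]
    exact hz _ (List.mem_map.mpr ⟨σ, hσ, rfl⟩)
  · intro r hr
    rcases List.mem_append.mp hr with hr | hr
    · rcases List.mem_append.mp hr with hr | hr
      · obtain ⟨τ, hτ, rfl⟩ := List.mem_map.mp hr
        rw [← C.coef_lie_rootVec hw ha hv he (form_eq_one_of_mem_levelE7 hτ), ← lie_skew, hcen.1,
          neg_zero, map_zero]
      · obtain ⟨x, hx, hr⟩ := List.mem_flatMap.mp hr
        obtain ⟨τ, hτ, rfl⟩ := List.mem_map.mp hr
        have hx := List.all_eq_true.mp ht.1 x hx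
        simp only [commTestE7, Bool.and_eq_true, beq_iff_eq] at hx
        have hxf := form_eq_one_of_isHomogE7 hx.1.1
        rw [← C.coef_lie_rootVec hw ha hv hxf (form_eq_one_of_mem_levelE7 hτ), ← lie_skew,
          hcen.2 _ (C.lie_rootVec_eq_zero hxf he hx.1.2 hx.2), neg_zero, map_zero]
    · obtain ⟨y, hy, rfl⟩ := List.mem_map.mp hr
      obtain ⟨h1, h2, h3⟩ := hys y hy
      rw [← C.coef_lie_rootVec hw ha hv h2 h1, h3]

end E7Frame

end Tests

section OneDimensionalTop

open LieAlgebra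

/-- A sufficient test for property (P) in case `θ` is the only root of largest degree `N`. The list
`sel` has an entry `(a, xs, ys)` for each degree `0 < a < N` such that `vanishTestE7` applies. -/
def topTestE7 (w : E7Lattice) (e f : List (E7Lattice × ℤ)) (N : ℤ) (θ : E7Lattice)
    (sel : List (ℤ × List (ℤ × List (E7Lattice × ℤ)) × List (List (E7Lattice × ℤ)))) : Bool :=
  decide (0 < N) && posE7.form θ θ == 1 && posE7.ip w θ == N &&
  (posRootsE7.all fun σ => posE7.ip w σ == 0 || σ == θ || sel.any fun s => s.1 == posE7.ip w σ) &&
  sel.all fun s => decide (0 < s.1) && decide (s.1 < N) &&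
    vanishTestE7 w e f s.1 s.2.1 (s.2.2.map fun y => (y, θ)) &&
    s.2.2.all fun y => commTestE7 w e (N - s.1 + 2) y && lieCartanE7 f y == 0

namespace E7Frame

variable {L : Type*} [LieRing L] [LieAlgebra ℂ L] (C : E7Frame L)

theorem exists_mem_levelE7 {w : E7Lattice} (hw : ∀ j, 0 ≤ posE7.ip w (simpleE7 j)) {a : ℤ}
    (ha : 0 < a) {v : L} (hv : ⁅C.H w, v⁆ = (a : ℂ) • v) (hv0 : v ≠ 0) :
    ∃ σ ∈ posRootsE7, posE7.ip w σ = a := by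
  by_contra! h
  refine hv0 (C.eq_of_coef_levelE7_eq hw ha hv (by rw [lie_zero, smul_zero]) fun σ hσ => ?_)
  exact absurd (by simpa using (List.mem_filter.mp hσ).2) (h σ (List.mem_filter.mp hσ).1)

variable [FiniteDimensional ℂ L]

theorem pos_of_inCenterOfCentralizer {h e f : L} (t : IsSl2Triple h e f) (h0 : InjOnCentralizer h e)
    {a : ℤ} {v : L} (hv0 : v ≠ 0) (hcen : InCenterOfCentralizer L e v)
    (hv : ⁅h, v⁆ = (a : ℂ) • v) : 0 < a := by
  have hev : ⁅e, v⁆ = 0 := by rw [← lie_skew, hcen.1, neg_zero]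
  obtain ⟨k, hk⟩ := t.slTwoRel_ad.exists_nat_of_e_apply_eq_zero hev hv0 hv
  have hk : a = k := by exact_mod_cast hk
  rcases k.eq_zero_or_pos with rfl | hk0
  · refine absurd (h0 v hev ?_) hv0
    rw [hv, hk]
    simp
  · omega

theorem propertyP_of_topTestE7 {w : E7Lattice} (hw : ∀ j, 0 ≤ posE7.ip w (simpleE7 j))
    {e f : List (E7Lattice × ℤ)} (t : IsSl2Triple (C.H w) (C.rootVec e) (C.rootVec f))
    (h0 : InjOnCentralizer (C.H w) (C.rootVec e)) (he : ∀ p ∈ e, posE7.form p.1 p.1 = 1)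
    (hf : isHomogE7 w (-2) f = true) {N : ℤ} {θ : E7Lattice}
    {sel : List (ℤ × List (ℤ × List (E7Lattice × ℤ)) × List (List (E7Lattice × ℤ)))}
    (ht : topTestE7 w e f N θ sel = true) :
    PropertyP L (C.rootVec e) (C.H w) (C.rootVec f) := by
  simp only [topTestE7, Bool.and_eq_true, decide_eq_true_eq, beq_iff_eq, List.all_eq_true,
    Bool.or_eq_true, List.any_eq_true] at ht
  obtain ⟨⟨⟨⟨hN, hθ⟩, hθN⟩, hall⟩, hsel⟩ := ht
  have hlev : ∀ a : ℤ, 0 < a → ∀ v : L, v ≠ 0 → ⁅C.H w, v⁆ = (a : ℂ) • v →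
      a = N ∨ ∃ s ∈ sel, s.1 = a := fun a ha v hv0 hv => by
    obtain ⟨σ, hσ, rfl⟩ := C.exists_mem_levelE7 hw ha hv hv0
    rcases hall σ hσ with (h | rfl) | h
    · omega
    · exact Or.inl hθN
    · exact Or.inr h
  have hle : ∀ σ ∈ levelE7 w N, σ = θ := fun σ hσ => by
    obtain ⟨hσ, h1⟩ := List.mem_filter.mp hσ
    have h1 : posE7.ip w σ = N := by simpa using h1
    rcases hall σ hσ with (h | h) | ⟨s, hs, h⟩
    · omega
    · exact h
    · have := (hsel s hs).1.1.2
      omega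
  have htop : ∀ u z : L, ⁅C.H w, u⁆ = (N : ℂ) • u → ⁅C.H w, z⁆ = (N : ℂ) • z →
      C.coef θ u = C.coef θ z → u = z := fun u z hu hz h =>
    C.eq_of_coef_levelE7_eq hw hN hu hz fun σ hσ => by rwa [hle σ hσ]
  have hscale : ∀ u z : L, ⁅C.H w, u⁆ = (N : ℂ) • u → ⁅C.H w, z⁆ = (N : ℂ) • z →
      C.coef θ u ≠ 0 → (C.coef θ z / C.coef θ u) • u = z := fun u z hu hz h =>
    htop _ z (by rw [lie_smul, hu, smul_comm]) hz (by
      rw [map_smul, smul_eq_mul, div_mul_cancel₀ _ h])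
  refine propertyP_of_homogeneous t h0 (N := N) ?_ ?_ ?_
  · intro k hk x hx
    by_contra hx0
    rcases hlev k (by omega) x hx0 hx with h | ⟨s, hs, rfl⟩
    · omega
    · have := (hsel s hs).1.1.2
      omega
  · exact ⟨C.X θ, C.X_ne_zero hθ, by rw [C.lie_H_X, hθN]⟩
  · intro a v z hv0 hcen hv hz
    have ha := pos_of_inCenterOfCentralizer t h0 hv0 hcen hv
    rcases hlev a ha v hv0 hv with rfl | ⟨s, hs, rfl⟩
    · have hN0 : (a : ℂ) ≠ 0 := by exact_mod_cast ha.ne'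
      refine ⟨(C.coef θ z / C.coef θ v * (-(1 / a : ℂ))) • C.rootVec e, ?_, ?_, ?_⟩
      · rw [smul_lie, lie_self, smul_zero]
      · rw [lie_smul, t.lie_h_e_smul ℂ, smul_comm]
        norm_num
      · rw [lie_smul, ← lie_skew (C.rootVec f), t.lie_e_f, smul_neg, neg_lie, smul_lie, hv, smul_smul,
          ← neg_smul]
        refine Eq.trans ?_
          (hscale v z hv hz fun h => hv0 (htop v 0 hv (by simp) (by simpa using h)))
        congr 1
        field_simp
    · obtain ⟨⟨-, hvan⟩, hys⟩ := hsel s hs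
      have hdeg : ∀ y ∈ s.2.2, (∀ p ∈ y, posE7.form p.1 p.1 = 1) := fun y hy => by
        have := (hys y hy).1
        simp only [commTestE7, Bool.and_eq_true] at this
        exact form_eq_one_of_isHomogE7 this.1.1
      obtain ⟨y, hy, hyv⟩ : ∃ y ∈ s.2.2, C.coef θ ⁅C.rootVec (lieE7 f y), v⁆ ≠ 0 := by
        by_contra! hcon
        refine hv0 (C.eq_zero_of_vanishTestE7 hw he ha hvan hv hcen fun p hp => ?_)
        obtain ⟨y, hy, rfl⟩ := List.mem_map.mp hp
        exact ⟨hθ, form_eq_one_of_mem_lieE7 _ _, hcon y hy⟩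
      obtain ⟨hcomm, hcart⟩ := hys y hy
      simp only [commTestE7, Bool.and_eq_true, beq_iff_eq] at hcomm
      have hyf := hdeg y hy
      have hfy : ⁅C.rootVec f, C.rootVec y⁆ = C.rootVec (lieE7 f y) := by
        rw [C.lie_rootVec (form_eq_one_of_isHomogE7 hf) hyf, hcart, C.H_zero, add_zero]
      have hyh := C.lie_H_rootVec hcomm.1.1
      refine ⟨(C.coef θ z / C.coef θ ⁅C.rootVec (lieE7 f y), v⁆) • C.rootVec y, ?_, ?_, ?_⟩
      · rw [smul_lie, C.lie_rootVec_eq_zero hyf he hcomm.1.2 hcomm.2, smul_zero]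
      · rw [lie_smul, hyh, smul_comm]
      · rw [lie_smul, smul_lie, hfy]
        refine hscale _ z ?_ hz hyv
        rw [← hfy, lie_eq_smul_of_lie_eq_smul (lie_eq_smul_of_lie_eq_smul (C.lie_H_rootVec hf) hyh)
          hv]
        congr 1
        push_cast
        ring

end E7Frame

end OneDimensionalTop

section TopData

/-- An `sl₂`-triple given by formal combinations of root vectors, with input for `topTestE7`. -/
structure TopDataE7 where
  /-- The coweight that defines the semisimple element. -/
  w : E7Lattice
  /-- The nilpositive element. -/
  e : List (E7Lattice × ℤ)
  /-- The nilnegative element. -/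
  f : List (E7Lattice × ℤ)
  /-- The largest degree. -/
  N : ℤ
  /-- The elements that detect nonzero central elements of the centralizer in each degree. -/
  sel : List (ℤ × List (ℤ × List (E7Lattice × ℤ)) × List (List (E7Lattice × ℤ)))

/-- The distinguished `sl₂`-triples for which the top degree component is a root space. -/
def topDataE7 : List TopDataE7 :=
  [⟨(14, 19, 26, 38, 29, 20, 11),
    [((0, 0, 0, 1, 1, 1, 0), 1), ((1, 0, 1, 0, 0, 0, 0), 1), ((0, 1, 0, 1, 1, 0, 0), 1),
    ((0, 1, 1, 1, 0, 0, 0), 1), ((0, 0, 0, 0, 1, 1, 1), 1), ((0, 0, 1, 1, 1, 0, 0), 1),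
    ((0, 0, 0, 1, 0, 0, 0), 1)],
    [((0, 0, 0, 0, 0, 0, -1), -9), ((0, 0, 0, -1, 0, 0, 0), -9), ((-1, 0, -1, 0, 0, 0, 0), -14),
    ((0, 0, -1, -1, -1, 0, 0), -1), ((0, 0, 0, 0, -1, -1, -1), -11),
    ((0, -1, 0, -1, -1, 0, 0), -8), ((0, 0, 0, -1, -1, -1, 0), -9),
    ((0, -1, -1, -1, -1, -1, 0), 9), ((0, -1, -1, -1, 0, 0, 0), -11)],
    14,
    [(2, [(8, [((1, 1, 2, 2, 2, 1, 1), 1), ((1, 1, 2, 3, 2, 1, 0), 1),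
    ((1, 1, 1, 2, 1, 1, 1), -1)])], [[((2, 2, 3, 4, 3, 2, 1), 1)]]), (4, [(6,
    [((1, 1, 1, 2, 1, 0, 0), 1), ((0, 1, 1, 2, 1, 1, 1), -1), ((1, 0, 1, 1, 1, 1, 1), -1)])],
    []), (6, [(4, [((1, 1, 1, 1, 1, 1, 0), 1), ((0, 1, 1, 2, 1, 0, 0), 1),
    ((0, 0, 1, 1, 1, 1, 1), -2), ((0, 1, 1, 2, 2, 1, 0), -1), ((0, 1, 0, 1, 1, 1, 1), 1),
    ((1, 1, 1, 1, 0, 0, 0), 1)])], []), (8, [(2, [((0, 1, 1, 1, 1, 1, 0), 1),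
    ((0, 1, 1, 1, 0, 0, 0), 1), ((0, 0, 0, 0, 1, 1, 1), 1), ((0, 0, 0, 0, 0, 0, 1), -1)])], []),
    (10, [(2, [((0, 0, 1, 1, 1, 0, 0), 1)]), (2, [((0, 1, 1, 1, 1, 1, 0), 1),
    ((0, 1, 1, 1, 0, 0, 0), 1), ((0, 0, 0, 0, 1, 1, 1), 1), ((0, 0, 0, 0, 0, 0, 1), -1)]), (2,
    [((0, 0, 0, 1, 1, 0, 0), 1), ((0, 0, 1, 1, 0, 0, 0), 1), ((0, 1, 1, 1, 1, 0, 0), -3),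
    ((1, 0, 0, 0, 0, 0, 0), 1), ((0, 1, 0, 1, 0, 0, 0), 1), ((0, 0, 0, 0, 0, 1, 1), 1),
    ((0, 0, 1, 1, 1, 1, 0), 3)])], [[((1, 1, 2, 2, 1, 1, 0), 1), ((1, 1, 1, 2, 2, 1, 0), -1),
    ((0, 1, 1, 2, 2, 2, 1), 1)]]), (12, [(2, [((0, 0, 0, 1, 1, 0, 0), 1),
    ((0, 0, 1, 1, 0, 0, 0), 1), ((0, 1, 1, 1, 1, 0, 0), -3), ((1, 0, 0, 0, 0, 0, 0), 1),
    ((0, 1, 0, 1, 0, 0, 0), 1), ((0, 0, 0, 0, 0, 1, 1), 1), ((0, 0, 1, 1, 1, 1, 0), 3)])], [])]⟩,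
    ⟨(18, 25, 34, 50, 39, 28, 15),
    [((0, 1, 0, 1, 1, 0, 0), 1), ((1, 0, 1, 0, 0, 0, 0), 1), ((0, 1, 1, 1, 0, 0, 0), 1),
    ((0, 0, 1, 1, 1, 0, 0), 1), ((0, 0, 0, 1, 0, 0, 0), 1), ((0, 0, 0, 0, 0, 0, 1), 1),
    ((0, 0, 0, 0, 0, 1, 0), 1)],
    [((0, 0, 0, 0, 0, 0, -1), -15), ((0, 0, 0, 0, 0, -1, 0), -28), ((0, 0, 0, -1, 0, 0, 0), -10),
    ((-1, 0, -1, 0, 0, 0, 0), -18), ((0, 0, -1, -1, -1, 0, 0), -15),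
    ((0, -1, 0, -1, -1, 0, 0), -24), ((0, -1, -1, -1, 0, 0, 0), -1)],
    18,
    [(2, [(14, [((1, 2, 2, 3, 2, 2, 1), 1), ((1, 1, 2, 3, 3, 2, 1), 1)])],
    [[((2, 2, 3, 4, 3, 2, 1), 1)]]), (4, [(2, [((0, 1, 1, 1, 0, 0, 0), 1)])], []), (6, [(8,
    [((1, 1, 1, 2, 2, 1, 0), 1), ((1, 1, 2, 2, 1, 1, 0), -1), ((0, 1, 1, 2, 1, 1, 1), 2),
    ((1, 0, 1, 1, 1, 1, 1), 1)])], []), (8, [(2, [((0, 1, 1, 1, 0, 0, 0), 1)])], []), (10, [(4,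
    [((1, 0, 1, 1, 1, 0, 0), 1), ((1, 1, 1, 1, 0, 0, 0), -3), ((0, 1, 1, 1, 1, 1, 0), 1),
    ((0, 0, 0, 1, 1, 1, 0), 1), ((0, 1, 1, 2, 1, 0, 0), -2), ((0, 0, 0, 0, 1, 1, 1), 1)])],
    [[((1, 1, 1, 2, 1, 1, 1), 1), ((1, 1, 2, 3, 2, 1, 0), -1)]]), (12, [], []), (14, [(2,
    [((0, 1, 1, 1, 0, 0, 0), 1)])], [[((0, 1, 0, 1, 1, 1, 1), 1), ((1, 1, 1, 2, 1, 0, 0), -1),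
    ((0, 0, 1, 1, 1, 1, 1), -2), ((0, 1, 1, 2, 2, 1, 0), -1), ((1, 1, 1, 1, 1, 1, 0), 1)]]), (16,
    [], [[((1, 0, 1, 1, 1, 0, 0), 1), ((1, 1, 1, 1, 0, 0, 0), -3), ((0, 1, 1, 1, 1, 1, 0), 1),
    ((0, 0, 0, 1, 1, 1, 0), 1), ((0, 1, 1, 2, 1, 0, 0), -2), ((0, 0, 0, 0, 1, 1, 1), 1)]])]⟩,
    ⟨(22, 31, 42, 60, 47, 32, 17),
    [((0, 0, 1, 1, 0, 0, 0), 1), ((0, 0, 0, 0, 0, 1, 1), 1), ((0, 1, 0, 1, 0, 0, 0), 1),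
    ((1, 0, 0, 0, 0, 0, 0), 1), ((0, 1, 0, 0, 0, 0, 0), 1), ((0, 0, 0, 1, 1, 1, 0), 1),
    ((0, 0, 0, 0, 1, 0, 0), 1)],
    [((0, 0, 0, 0, 0, 0, -1), -3), ((0, 0, 0, 0, -1, 0, 0), -32), ((0, 0, -1, 0, 0, 0, 0), 28),
    ((0, -1, 0, 0, 0, 0, 0), -28), ((-1, 0, 0, 0, 0, 0, 0), -22), ((0, 0, 0, 0, 0, -1, -1), -17),
    ((0, 0, 0, -1, -1, -1, 0), -15), ((0, 0, 0, -1, -1, 0, 0), -3),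
    ((0, 0, -1, -1, 0, 0, 0), -42), ((0, -1, 0, -1, 0, 0, 0), -3)],
    22,
    [(2, [(14, [((1, 1, 2, 2, 2, 2, 1), 1), ((1, 2, 2, 3, 2, 1, 0), -1)])],
    [[((2, 2, 3, 4, 3, 2, 1), 1)]]), (4, [], []), (6, [(10, [((0, 1, 1, 2, 2, 1, 1), 1),
    ((1, 1, 1, 2, 1, 1, 1), 1)])], []), (8, [(10, [((0, 1, 1, 2, 2, 1, 1), 1),
    ((1, 1, 1, 2, 1, 1, 1), 1)])], []), (10, [(8, [((1, 1, 1, 2, 1, 0, 0), 1),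
    ((1, 1, 1, 2, 1, 1, 0), -1), ((0, 1, 1, 2, 2, 1, 0), -1), ((1, 0, 1, 1, 1, 1, 1), 1),
    ((0, 1, 1, 1, 1, 1, 1), -1)])], [[((1, 1, 2, 2, 2, 2, 1), 1), ((1, 2, 2, 3, 2, 1, 0), -1)]]),
    (12, [], []), (14, [(2, [((0, 0, 0, 0, 0, 0, 1), 1), ((0, 0, 0, 1, 1, 0, 0), 1),
    ((0, 1, 0, 1, 0, 0, 0), 1)])], [[((1, 1, 1, 2, 2, 1, 0), 1), ((1, 1, 1, 1, 1, 1, 1), -1),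
    ((0, 1, 1, 2, 2, 2, 1), -2), ((1, 1, 2, 2, 1, 0, 0), 1)]]), (16, [(2,
    [((0, 0, 0, 0, 0, 0, 1), 1), ((0, 0, 0, 1, 1, 0, 0), 1), ((0, 1, 0, 1, 0, 0, 0), 1)])], []),
    (18, [], [[((0, 1, 1, 1, 1, 1, 0), 3), ((1, 0, 1, 1, 1, 0, 0), 1),
    ((0, 1, 1, 2, 1, 0, 0), -1), ((0, 0, 1, 1, 1, 1, 1), 1), ((0, 1, 1, 1, 1, 0, 0), 1),
    ((1, 0, 1, 1, 1, 1, 0), -3), ((0, 1, 1, 2, 1, 1, 0), 1), ((0, 1, 0, 1, 1, 1, 1), -2),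
    ((1, 1, 1, 1, 0, 0, 0), 2)]]), (20, [], [])]⟩,
    ⟨(26, 37, 50, 72, 57, 40, 21),
    [((0, 0, 1, 0, 0, 0, 0), 1), ((0, 0, 0, 1, 1, 0, 0), 1), ((1, 0, 0, 0, 0, 0, 0), 1),
    ((0, 1, 0, 1, 0, 0, 0), 1), ((0, 0, 0, 0, 0, 1, 0), 1), ((0, 0, 0, 0, 0, 0, 1), 1),
    ((0, 1, 0, 0, 0, 0, 0), 1)],
    [((0, 0, 0, 0, 0, 0, -1), -21), ((0, 0, 0, 0, 0, -1, 0), -40), ((0, 0, 0, 0, -1, 0, 0), -22),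
    ((0, 0, -1, 0, 0, 0, 0), -50), ((0, -1, 0, 0, 0, 0, 0), -22), ((-1, 0, 0, 0, 0, 0, 0), -26),
    ((0, 0, 0, -1, -1, 0, 0), -57), ((0, -1, 0, -1, 0, 0, 0), -15),
    ((0, 0, -1, -1, 0, 0, 0), 15)],
    26,
    [(2, [], [[((2, 2, 3, 4, 3, 2, 1), 1)]]), (4, [], []), (6, [(10, [((1, 1, 2, 2, 1, 0, 0), 1),
    ((1, 1, 1, 2, 1, 1, 0), 1), ((0, 1, 1, 2, 1, 1, 1), 1)])], []), (8, [], []), (10, [(16,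
    [((1, 1, 2, 2, 2, 1, 1), 1), ((1, 2, 2, 3, 2, 1, 0), 1), ((1, 1, 1, 2, 2, 2, 1), 1)])],
    [[((1, 2, 2, 3, 2, 1, 1), 1), ((1, 1, 2, 3, 2, 2, 1), -1)]]), (12, [], []), (14, [],
    [[((1, 1, 2, 2, 1, 1, 1), 1), ((1, 1, 2, 3, 2, 1, 0), 1), ((1, 1, 2, 2, 2, 1, 0), 1),
    ((1, 1, 1, 2, 2, 1, 1), 1), ((0, 1, 1, 2, 2, 2, 1), 1)]]), (16, [(10,
    [((1, 1, 2, 2, 1, 0, 0), 1), ((1, 1, 1, 2, 1, 1, 0), 1), ((0, 1, 1, 2, 1, 1, 1), 1)])], []),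
    (18, [], [[((1, 1, 2, 2, 1, 0, 0), 1), ((1, 1, 1, 2, 1, 1, 0), 1),
    ((0, 1, 1, 2, 1, 1, 1), 1)]]), (20, [], []), (22, [], [[((1, 0, 1, 1, 1, 0, 0), 1),
    ((0, 1, 1, 2, 1, 0, 0), 1), ((1, 1, 1, 1, 0, 0, 0), -2), ((0, 1, 1, 1, 1, 0, 0), -1),
    ((0, 1, 0, 1, 1, 1, 0), -2), ((0, 0, 0, 1, 1, 1, 1), 1), ((0, 0, 0, 0, 1, 1, 1), -3),
    ((0, 0, 1, 1, 1, 1, 0), 1)]]), (24, [], [])]⟩,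
    ⟨(34, 49, 66, 96, 75, 52, 27),
    [((0, 0, 0, 0, 0, 0, 1), 1), ((0, 0, 0, 0, 0, 1, 0), 1), ((0, 0, 0, 0, 1, 0, 0), 1),
    ((0, 0, 0, 1, 0, 0, 0), 1), ((0, 0, 1, 0, 0, 0, 0), 1), ((0, 1, 0, 0, 0, 0, 0), 1),
    ((1, 0, 0, 0, 0, 0, 0), 1)],
    [((0, 0, 0, 0, 0, 0, -1), -27), ((0, 0, 0, 0, 0, -1, 0), -52), ((0, 0, 0, 0, -1, 0, 0), -75),
    ((0, 0, 0, -1, 0, 0, 0), -96), ((0, 0, -1, 0, 0, 0, 0), -66), ((0, -1, 0, 0, 0, 0, 0), -49),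
    ((-1, 0, 0, 0, 0, 0, 0), -34)],
    34,
    [(2, [], [[((2, 2, 3, 4, 3, 2, 1), 1)]]), (4, [], []), (6, [], []), (8, [], []), (10, [],
    [[((1, 1, 2, 3, 3, 2, 1), 1), ((1, 2, 2, 3, 2, 2, 1), -1)]]), (12, [], []), (14, [],
    [[((1, 1, 2, 2, 2, 2, 1), 1), ((1, 2, 2, 3, 2, 1, 0), 1), ((1, 1, 2, 3, 2, 1, 1), -1)]]),
    (16, [], []), (18, [], [[((0, 1, 1, 2, 2, 2, 1), 1), ((1, 1, 2, 2, 1, 1, 1), 1),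
    ((1, 1, 1, 2, 2, 1, 1), 1)]]), (20, [], []), (22, [], [[((0, 1, 1, 2, 2, 1, 0), 1),
    ((0, 1, 1, 2, 1, 1, 1), -1), ((1, 1, 1, 1, 1, 1, 1), -2), ((1, 1, 1, 2, 1, 1, 0), 1),
    ((1, 1, 2, 2, 1, 0, 0), 1)]]), (24, [], []), (26, [], [[((1, 0, 1, 1, 1, 1, 0), 2),
    ((0, 1, 1, 1, 1, 1, 0), -1), ((0, 0, 1, 1, 1, 1, 1), 2), ((1, 1, 1, 1, 1, 0, 0), 1),
    ((0, 1, 0, 1, 1, 1, 1), -3), ((0, 1, 1, 2, 1, 0, 0), 1)]]), (28, [], []), (30, [], []), (32,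
    [], [])]⟩]

theorem tripleTestE7_of_mem_topDataE7 :
    ∀ d ∈ topDataE7, tripleTestE7 d.w d.e d.f = true := by decide +kernel

theorem injTestE7_of_mem_topDataE7 : ∀ d ∈ topDataE7, injTestE7 d.w d.e = true := by decide +kernel

theorem topTestE7_of_mem_topDataE7 :
    ∀ d ∈ topDataE7, topTestE7 d.w d.e d.f d.N (2, 2, 3, 4, 3, 2, 1) d.sel = true := by
  decide +kernel

theorem eq_or_exists_mem_topDataE7 : ∀ w ∈ distinguishedE7,
    w = (10, 15, 20, 30, 23, 16, 9) ∨ ∃ d ∈ topDataE7, d.w = w := by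
  decide +kernel

end TopData

section ThreeDimensionalTop

open LieAlgebra

/-- The semisimple element of the triple of type `E₇(a₅)`. -/
def wA5 : E7Lattice := (10, 15, 20, 30, 23, 16, 9)

/-- The nilpositive element of the triple of type `E₇(a₅)`. -/
def eA5 : List (E7Lattice × ℤ) :=
  [((0, 1, 0, 1, 1, 0, 0), 1), ((0, 0, 0, 0, 0, 0, 1), 1), ((1, 1, 1, 1, 0, 0, 0), 1),
  ((0, 0, 0, 0, 0, 1, 1), 1), ((1, 0, 1, 1, 1, 0, 0), 1), ((0, 0, 0, 1, 0, 0, 0), 1),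
  ((0, 0, 1, 1, 1, 1, 0), 1)]

/-- The nilnegative element of the triple of type `E₇(a₅)`. -/
def fA5 : List (E7Lattice × ℤ) :=
  [((0, 0, 0, 0, 0, 0, -1), -3), ((0, 0, 0, 0, 0, -1, -1), -6), ((0, 0, 0, -1, 0, 0, 0), -1),
  ((0, 0, -1, -1, -1, 0, 0), -3), ((0, 0, -1, -1, -1, -1, 0), -10),
  ((0, -1, -1, -1, 0, 0, 0), 3), ((0, -1, 0, -1, -1, 0, 0), -9), ((0, -1, 0, -1, -1, -1, 0), -6),
  ((-1, -1, -1, -1, 0, 0, 0), -6), ((-1, 0, -1, -1, -1, 0, 0), -4)]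

/-- The three roots of degree ten. -/
def topRootA5 : Fin 3 → E7Lattice :=
  ![(1, 2, 2, 4, 3, 2, 1), (1, 2, 3, 4, 3, 2, 1), (2, 2, 3, 4, 3, 2, 1)]

/-- Six elements of degree two in the centralizer. -/
def centA5 : Fin 6 → List (E7Lattice × ℤ) :=
  ![[((0, 0, 0, 1, 0, 0, 0), 1)],
    [((0, 0, 0, 0, 0, 0, 1), 1), ((0, 0, 1, 1, 1, 0, 0), 1), ((0, 1, 1, 1, 0, 0, 0), -1)],
    [((0, 1, 1, 1, 1, 1, 0), 2), ((0, 1, 0, 1, 0, 0, 0), -2), ((0, 0, 0, 1, 1, 0, 0), 4),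
    ((0, 1, 1, 1, 1, 0, 0), -2), ((0, 0, 1, 1, 0, 0, 0), 2), ((0, 0, 0, 0, 1, 1, 1), 1),
    ((1, 1, 1, 1, 1, 0, 0), -2), ((0, 0, 0, 1, 1, 1, 0), -3), ((1, 1, 1, 1, 1, 1, 0), 3)],
    [((0, 0, 0, 1, 1, 1, 0), 1), ((0, 0, 0, 1, 1, 0, 0), -2), ((0, 0, 0, 0, 1, 1, 1), -1),
    ((1, 1, 1, 1, 1, 1, 0), -1), ((1, 0, 1, 1, 0, 0, 0), 2)],
    [((0, 1, 0, 1, 1, 1, 0), 1), ((1, 0, 1, 1, 1, 1, 0), -1), ((1, 0, 1, 1, 1, 0, 0), 2),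
    ((0, 0, 0, 0, 0, 1, 1), 1), ((0, 0, 0, 1, 0, 0, 0), -6)],
    [((0, 1, 0, 1, 1, 0, 0), 2), ((0, 0, 1, 1, 1, 1, 0), 2), ((0, 0, 1, 1, 1, 0, 0), -4),
    ((1, 1, 1, 1, 0, 0, 0), 2), ((0, 1, 1, 1, 0, 0, 0), 4), ((1, 0, 1, 1, 1, 0, 0), -4),
    ((0, 0, 0, 0, 0, 1, 1), -1), ((0, 0, 0, 0, 0, 0, 1), -2), ((0, 1, 0, 1, 1, 1, 0), -3),
    ((1, 0, 1, 1, 1, 1, 0), 3)]]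

/-- The action of the elements `⁅f, x⁆`, for `x` among `centA5`, on the degree ten component. -/
def actA5 : Fin 6 → Fin 3 → Fin 3 → ℤ :=
  ![![![-1, 0, 0], ![0, 0, 0], ![0, 0, 0]],
    ![![0, 0, 0], ![0, -6, -2], ![0, 0, 0]],
    ![![0, -12, -4], ![-4, 0, 0], ![0, 0, 0]],
    ![![0, 4, 8], ![0, 0, 0], ![4, 0, 0]],
    ![![0, 0, 0], ![0, 0, 0], ![0, -4, -8]],
    ![![0, 0, 0], ![0, 4, 8], ![0, 12, 4]]]

/-- Elements of the centralizer that do not commute with central elements of given degree. -/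
def selA5 : List (ℤ × List (ℤ × List (E7Lattice × ℤ))) :=
  [(4, [(2, [((1, 1, 1, 1, 1, 1, 0), 1), ((0, 0, 0, 1, 1, 0, 0), 2), ((0, 0, 0, 0, 1, 1, 1), 1),
  ((1, 0, 1, 1, 0, 0, 0), -2), ((0, 0, 0, 1, 1, 1, 0), -1)])]), (6, [(2,
  [((0, 1, 0, 1, 1, 1, 0), 1), ((1, 0, 1, 1, 1, 1, 0), -1), ((0, 0, 0, 0, 0, 1, 1), 1),
  ((1, 0, 1, 1, 1, 0, 0), 2)]), (2, [((0, 1, 1, 1, 1, 0, 0), 1), ((0, 0, 0, 1, 1, 0, 0), 1),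
  ((0, 0, 0, 0, 1, 1, 1), 1), ((0, 1, 1, 1, 1, 1, 0), -1), ((1, 1, 1, 1, 1, 0, 0), 1),
  ((0, 1, 0, 1, 0, 0, 0), 1), ((1, 0, 1, 1, 0, 0, 0), -3), ((0, 0, 1, 1, 0, 0, 0), -1)])]), (8,
  [(2, [((0, 1, 0, 1, 1, 1, 0), 1), ((1, 0, 1, 1, 1, 1, 0), -1), ((0, 0, 0, 0, 0, 1, 1), 1),
  ((1, 0, 1, 1, 1, 0, 0), 2)]), (2, [((0, 0, 0, 1, 0, 0, 0), 1)])])]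

/-- Elements of the centralizer that restrict the central elements of degree two. -/
def selTwoA5 : List (ℤ × List (E7Lattice × ℤ)) :=
  [(4, [((1, 1, 2, 2, 2, 1, 0), 1), ((1, 1, 1, 2, 1, 0, 0), 1), ((1, 1, 1, 1, 1, 1, 1), 1),
  ((1, 1, 1, 2, 1, 1, 0), -2), ((0, 1, 1, 2, 1, 0, 0), -1), ((0, 1, 1, 1, 1, 1, 1), 1)]), (6,
  [((1, 1, 1, 2, 2, 2, 1), 1)])]

/-- The matrix row that computes the component at `τ` of the bracket of `⁅f, x⁆` with a combination
of the root vectors of `D`. -/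
def actRowE7 (f x : List (E7Lattice × ℤ)) (τ : E7Lattice) (D : List E7Lattice) : List ℤ :=
  linComb 1 1 (lieRowE7 (lieE7 f x) τ D)
    (D.map fun β => if β = τ then posE7.ip (lieCartanE7 f x) τ else 0)

theorem tripleTestE7_A5 : tripleTestE7 wA5 eA5 fA5 = true := by decide +kernel

theorem injTestE7_A5 : injTestE7 wA5 eA5 = true := by decide +kernel

theorem levelE7_A5 : levelE7 wA5 10 = List.ofFn topRootA5 := by decide +kernel

theorem ip_wA5_of_mem_posRootsE7 : ∀ σ ∈ posRootsE7, posE7.ip wA5 σ = 0 ∨ posE7.ip wA5 σ = 2 ∨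
    posE7.ip wA5 σ = 10 ∨ ∃ s ∈ selA5, s.1 = posE7.ip wA5 σ := by decide +kernel

theorem selA5_spec : ∀ s ∈ selA5, s.1 < 10 ∧ vanishTestE7 wA5 eA5 fA5 s.1 s.2 [] = true := by
  decide +kernel

theorem selTwoA5_spec :
    vanishTestE7 wA5 eA5 fA5 2 selTwoA5 [([(topRootA5 0, 1)], topRootA5 0)] = true := by
  decide +kernel

theorem centA5_spec : ∀ i, commTestE7 wA5 eA5 2 (centA5 i) = true ∧ ∀ j,
    actRowE7 fA5 (centA5 i) (topRootA5 j) (List.ofFn topRootA5) = List.ofFn (actA5 i j) := by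
  decide +kernel

theorem topRootA5_spec : lieCartanE7 fA5 [(topRootA5 0, 1)] = 0 ∧
    isHomogE7 wA5 10 [(topRootA5 0, 1)] = true := by decide +kernel

theorem exists_sum_actA5_eq {v : Fin 3 → ℂ} (hv : v ≠ 0) (z : Fin 3 → ℂ) :
    ∃ c : Fin 6 → ℂ, ∀ j, ∑ i, c i * ∑ k, (actA5 i j k : ℂ) * v k = z j := by
  have key : ∃ c : Fin 6 → ℂ, -(c 0 * v 0) - 4 * c 2 * (3 * v 1 + v 2) +
      4 * c 3 * (v 1 + 2 * v 2) = z 0 ∧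
      -(2 * c 1 * (3 * v 1 + v 2)) - 4 * c 2 * v 0 + 4 * c 5 * (v 1 + 2 * v 2) = z 1 ∧
      4 * c 3 * v 0 - 4 * c 4 * (v 1 + 2 * v 2) + 4 * c 5 * (3 * v 1 + v 2) = z 2 := by
    by_cases h0 : v 0 = 0
    · by_cases hp : 3 * v 1 + v 2 = 0
      · have hq : v 1 + 2 * v 2 ≠ 0 := fun hq => hv (by
          ext k
          fin_cases k
          · exact h0
          · show v 1 = 0
            linear_combination (2 * hp - hq) / 5
          · show v 2 = 0
            linear_combination (3 * hq - hp) / 5)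
        refine ⟨![0, 0, 0, z 0 / (4 * (v 1 + 2 * v 2)), -(z 2 / (4 * (v 1 + 2 * v 2))),
          z 1 / (4 * (v 1 + 2 * v 2))], ?_, ?_, ?_⟩ <;> simp [h0, hp] <;>
          field_simp
      · refine ⟨![0, (z 2 / (3 * v 1 + v 2) * (v 1 + 2 * v 2) - z 1) / (2 * (3 * v 1 + v 2)),
          -(z 0 / (4 * (3 * v 1 + v 2))), 0, 0, z 2 / (4 * (3 * v 1 + v 2))], ?_, ?_, ?_⟩ <;>
          simp [h0] <;> field_simp <;> ring
    · refine ⟨![((z 1 / v 0) * (3 * v 1 + v 2) + (z 2 / v 0) * (v 1 + 2 * v 2) - z 0) / v 0, 0,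
        -(z 1 / (4 * v 0)), z 2 / (4 * v 0), 0, 0], ?_, ?_, ?_⟩ <;> simp <;> field_simp <;> ring
  obtain ⟨c, h0, h1, h2⟩ := key
  refine ⟨c, fun j => ?_⟩
  fin_cases j
  · refine Eq.trans ?_ h0
    simp [actA5, Fin.sum_univ_six, Fin.sum_univ_three]
    ring
  · refine Eq.trans ?_ h1
    simp [actA5, Fin.sum_univ_six, Fin.sum_univ_three]
    ring
  · refine Eq.trans ?_ h2
    simp [actA5, Fin.sum_univ_six, Fin.sum_univ_three]
    ring

namespace E7Frame

variable {L : Type*} [LieRing L] [LieAlgebra ℂ L] (C : E7Frame L)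

theorem coef_lie_lie_rootVec {w : E7Lattice} (hw : ∀ j, 0 ≤ posE7.ip w (simpleE7 j)) {a : ℤ}
    (ha : 0 < a) {v : L} (hv : ⁅C.H w, v⁆ = (a : ℂ) • v) {f x : List (E7Lattice × ℤ)}
    (hf : ∀ p ∈ f, posE7.form p.1 p.1 = 1) (hx : ∀ p ∈ x, posE7.form p.1 p.1 = 1)
    {τ : E7Lattice} (hτ : τ ∈ levelE7 w a) :
    C.coef τ ⁅⁅C.rootVec f, C.rootVec x⁆, v⁆ =
      linEval (actRowE7 f x τ (levelE7 w a)) ((levelE7 w a).map fun σ => C.coef σ v) := by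
  have hτ1 := form_eq_one_of_mem_levelE7 hτ
  rw [C.lie_rootVec hf hx, add_lie, map_add, C.coef_lie_H _ _ hτ1, actRowE7, linEval_linComb,
    C.coef_lie_rootVec hw ha hv (form_eq_one_of_mem_lieE7 f x) hτ1, linEval_map_eq_sum,
    ← List.sum_toFinset _ (nodup_levelE7 w a), Finset.sum_eq_single τ]
  · simp
  · intro σ _ hσ
    simp [hσ]
  · exact fun h => absurd (List.mem_toFinset.mpr hτ) h

variable [FiniteDimensional ℂ L]

theorem propertyP_A5 (t : IsSl2Triple (C.H wA5) (C.rootVec eA5) (C.rootVec fA5)) :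
    PropertyP L (C.rootVec eA5) (C.H wA5) (C.rootVec fA5) := by
  have hw := ip_simpleE7_nonneg_of_mem_distinguishedE7 wA5 (by decide)
  have htr := tripleTestE7_A5
  simp only [tripleTestE7, Bool.and_eq_true] at htr
  obtain ⟨⟨⟨hhe, hhf⟩, -⟩, -⟩ := htr
  have he := form_eq_one_of_isHomogE7 hhe
  have hf := form_eq_one_of_isHomogE7 hhf
  have h0 := C.injOnCentralizer_of_injTestE7 he injTestE7_A5
  have hlev : ∀ a : ℤ, 0 < a → ∀ v : L, v ≠ 0 → ⁅C.H wA5, v⁆ = (a : ℂ) • v →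
      a = 2 ∨ a = 10 ∨ ∃ s ∈ selA5, s.1 = a := fun a ha v hv0 hv => by
    obtain ⟨σ, hσ, rfl⟩ := C.exists_mem_levelE7 hw ha hv hv0
    exact (ip_wA5_of_mem_posRootsE7 σ hσ).resolve_left ha.ne'
  have hle : ∀ k : ℤ, 10 < k → ∀ x : L, ⁅C.H wA5, x⁆ = (k : ℂ) • x → x = 0 := by
    intro k hk x hx
    by_contra hx0
    rcases hlev k (by omega) x hx0 hx with h | h | ⟨s, hs, rfl⟩
    · omega
    · omega
    · have := (selA5_spec s hs).1
      omega
  have hform : ∀ j, topRootA5 j ∈ levelE7 wA5 10 := fun j => by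
    rw [levelE7_A5]
    exact List.mem_ofFn.mpr ⟨j, rfl⟩
  have hext : ∀ u z : L, ⁅C.H wA5, u⁆ = ((10 : ℤ) : ℂ) • u → ⁅C.H wA5, z⁆ = ((10 : ℤ) : ℂ) • z →
      (∀ j, C.coef (topRootA5 j) u = C.coef (topRootA5 j) z) → u = z := fun u z hu hz h =>
    C.eq_of_coef_levelE7_eq hw (by norm_num) hu hz fun σ hσ => by
      rw [levelE7_A5] at hσ
      obtain ⟨j, rfl⟩ := List.mem_ofFn.mp hσ
      exact h j
  obtain ⟨hcart, hhom⟩ := topRootA5_spec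
  have hX : ⁅C.H wA5, C.rootVec [(topRootA5 0, 1)]⁆ =
      ((10 : ℤ) : ℂ) • C.rootVec [(topRootA5 0, 1)] := C.lie_H_rootVec hhom
  have hX1 : C.coef (topRootA5 0) (C.rootVec [(topRootA5 0, 1)]) = 1 := by
    rw [rootVec_cons, rootVec_nil, add_zero, map_smul, C.coef_X _ _
      (form_eq_one_of_mem_levelE7 (hform 0))]
    simp
  have hcomm : ∀ z : L, ⁅C.H wA5, z⁆ = ((10 : ℤ) : ℂ) • z → ⁅z, C.rootVec eA5⁆ = 0 := fun z hz =>
    hle 12 (by norm_num) _ (by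
      rw [lie_eq_smul_of_lie_eq_smul hz (t.lie_h_e_smul ℂ)]
      norm_num)
  have hlower : ∀ z : L, ⁅C.H wA5, z⁆ = ((10 : ℤ) : ℂ) • z →
      ⁅⁅C.rootVec fA5, z⁆, C.rootVec eA5⁆ = (-10 : ℂ) • z := fun z hz => by
    rw [lie_lie, hcomm z hz, lie_zero, zero_sub, ← lie_skew (C.rootVec fA5), t.lie_e_f, lie_neg, neg_neg,
      ← lie_skew, hz, neg_smul]
    norm_num
  refine propertyP_of_homogeneous t h0 (N := 10) hle ⟨_, fun h => ?_, hX⟩ ?_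
  · rw [h, map_zero] at hX1
    exact zero_ne_one hX1
  · intro a v z hv0 hcen hv hz
    have ha := pos_of_inCenterOfCentralizer t h0 hv0 hcen hv
    rcases hlev a ha v hv0 hv with rfl | rfl | ⟨s, hs, rfl⟩
    · obtain ⟨r, rfl⟩ : ∃ r : ℂ, v = r • C.rootVec eA5 := by
        have hy : ⁅C.rootVec fA5, C.rootVec [(topRootA5 0, 1)]⁆ =
            C.rootVec (lieE7 fA5 [(topRootA5 0, 1)]) := by
          rw [C.lie_rootVec hf (form_eq_one_of_isHomogE7 hhom), hcart, C.H_zero, add_zero]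
        set y := C.rootVec (lieE7 fA5 [(topRootA5 0, 1)])
        refine ⟨-(C.coef (topRootA5 0) ⁅y, v⁆ / 10), eq_of_sub_eq_zero ?_⟩
        refine C.eq_zero_of_vanishTestE7 hw he ha selTwoA5_spec ?_ ?_ ?_
        · rw [lie_sub, hv, lie_smul, t.lie_h_e_smul ℂ, smul_comm, smul_sub]
          norm_num
        · exact (zCenter L (C.rootVec eA5)).sub_mem hcen ((zCenter L (C.rootVec eA5)).smul_mem _
            ⟨lie_self _, fun u hu => by rw [← lie_skew, hu, neg_zero]⟩)
        · simp only [List.mem_singleton, forall_eq]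
          refine ⟨form_eq_one_of_mem_levelE7 (hform 0), form_eq_one_of_mem_lieE7 _ _, ?_⟩
          change C.coef (topRootA5 0) ⁅y, _⁆ = 0
          rw [lie_sub, lie_smul, ← hy, hlower _ hX, map_sub, map_smul, map_smul, hX1]
          simp
      have hr : r ≠ 0 := by
        rintro rfl
        exact hv0 (zero_smul _ _)
      refine ⟨(-(1 / (10 * r))) • z, ?_, ?_, ?_⟩
      · rw [smul_lie, hcomm z hz, smul_zero]
      · rw [lie_smul, hz, smul_comm]
        norm_num
      · rw [lie_smul, lie_smul, smul_lie, hlower z hz, smul_smul, smul_smul]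
        convert one_smul ℂ z using 2
        field_simp
    · have hv' : (fun j => C.coef (topRootA5 j) v) ≠ 0 := fun h =>
        hv0 (hext v 0 hv (by rw [lie_zero, smul_zero]) fun j => by
          rw [map_zero]
          exact congrFun h j)
      obtain ⟨c, hc⟩ := exists_sum_actA5_eq hv' fun j => C.coef (topRootA5 j) z
      have hcent : ∀ i, ⁅C.rootVec (centA5 i), C.rootVec eA5⁆ = 0 ∧
          ⁅C.H wA5, C.rootVec (centA5 i)⁆ = ((2 : ℤ) : ℂ) • C.rootVec (centA5 i) ∧
          ∀ p ∈ centA5 i, posE7.form p.1 p.1 = 1 := fun i => by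
        have h := (centA5_spec i).1
        simp only [commTestE7, Bool.and_eq_true, beq_iff_eq] at h
        have hx := form_eq_one_of_isHomogE7 h.1.1
        exact ⟨C.lie_rootVec_eq_zero hx he h.1.2 h.2, C.lie_H_rootVec h.1.1, hx⟩
      refine ⟨∑ i, c i • C.rootVec (centA5 i), ?_, ?_, ?_⟩
      · rw [sum_lie]
        exact Finset.sum_eq_zero fun i _ => by rw [smul_lie, (hcent i).1, smul_zero]
      · rw [lie_sum, Finset.smul_sum]
        refine Finset.sum_congr rfl fun i _ => ?_
        rw [lie_smul, (hcent i).2.1, smul_comm]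
        norm_num
      · rw [lie_sum, sum_lie]
        refine hext _ z ?_ hz fun j => ?_
        · rw [lie_sum, Finset.smul_sum]
          refine Finset.sum_congr rfl fun i _ => ?_
          rw [lie_smul, smul_lie, lie_smul, lie_eq_smul_of_lie_eq_smul
            (lie_eq_smul_of_lie_eq_smul (C.lie_H_rootVec hhf) (hcent i).2.1) hv, smul_comm (c i)]
          congr 1
          norm_num
        · rw [map_sum, ← hc j]
          refine Finset.sum_congr rfl fun i _ => ?_
          rw [lie_smul, smul_lie, map_smul, smul_eq_mul,
            C.coef_lie_lie_rootVec hw (by norm_num) hv hf (hcent i).2.2 (hform j), levelE7_A5,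
            (centA5_spec i).2 j]
          refine congrArg (c i * ·) ?_
          simp [linEval, List.ofFn_succ, Fin.sum_univ_three]
          ring
    · exact absurd (C.eq_zero_of_vanishTestE7 hw he ha (selA5_spec s hs).2 hv hcen (by simp)) hv0

end E7Frame

end ThreeDimensionalTop

section Classification

namespace E7Frame

variable {L : Type*} [LieRing L] [LieAlgebra ℂ L] [FiniteDimensional ℂ L] (C : E7Frame L)

/-- A triple with a given semisimple element is conjugate to any explicit one. -/
theorem exists_lieEquiv_apply_eq_rootVec {w : E7Lattice} {e f : L} (t : IsSl2Triple (C.H w) e f)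
    (h0 : InjOnCentralizer (C.H w) e) {e' f' : List (E7Lattice × ℤ)}
    (htr : tripleTestE7 w e' f' = true) (hinj : injTestE7 w e' = true) :
    ∃ φ : L ≃ₗ⁅ℂ⁆ L, φ (C.H w) = C.H w ∧ φ e = C.rootVec e' ∧ φ f = C.rootVec f' := by
  simp only [tripleTestE7, Bool.and_eq_true, beq_iff_eq] at htr
  obtain ⟨⟨⟨he, hf⟩, hz⟩, hcart⟩ := htr
  have he1 := form_eq_one_of_isHomogE7 he
  obtain ⟨φ, h1, h2⟩ := exists_lieEquiv_apply_eq_of_injOnCentralizer t h0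
    (by simpa using C.lie_H_rootVec he) (C.injOnCentralizer_of_injTestE7 he1 hinj)
  have t' := t.map_lieEquiv φ
  rw [h1, h2] at t'
  refine ⟨φ, h1, h2, t'.eq_of_lie_eq ?_ (by simpa using C.lie_H_rootVec hf)⟩
  rw [C.lie_rootVec he1 (form_eq_one_of_isHomogE7 hf), C.rootVec_eq_zero hz, hcart, zero_add]

theorem propertyP_of_injOnCentralizer (C : E7Frame L) {h e f : L} (t : IsSl2Triple h e f)
    (h0 : InjOnCentralizer h e) : PropertyP L e h f := by
  obtain ⟨φ, w, hw, hφ⟩ := C.exists_lieEquiv_apply_eq_H_distinguished t h0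
  have t₁ := t.map_lieEquiv φ
  have h0₁ : InjOnCentralizer (φ h) (φ e) := fun x hx hx' => by
    obtain ⟨x, rfl⟩ : ∃ y, φ y = x := φ.surjective x
    rw [← LieEquiv.map_lie] at hx hx'
    rw [h0 x (φ.injective (hx.trans (map_zero φ).symm))
      (φ.injective (hx'.trans (map_zero φ).symm)), map_zero]
  rw [hφ] at t₁ h0₁
  refine PropertyP.of_map_lieEquiv φ ?_
  rw [hφ]
  rcases eq_or_exists_mem_topDataE7 w hw with rfl | ⟨d, hd, rfl⟩
  · obtain ⟨ψ, h1, h2, h3⟩ :=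
      C.exists_lieEquiv_apply_eq_rootVec t₁ h0₁ tripleTestE7_A5 injTestE7_A5
    have t₂ := t₁.map_lieEquiv ψ
    refine PropertyP.of_map_lieEquiv ψ ?_
    rw [h2, h3] at t₂ ⊢
    erw [h1] at t₂ ⊢
    exact C.propertyP_A5 t₂
  · have htr := tripleTestE7_of_mem_topDataE7 d hd
    have hinj := injTestE7_of_mem_topDataE7 d hd
    obtain ⟨ψ, h1, h2, h3⟩ := C.exists_lieEquiv_apply_eq_rootVec t₁ h0₁ htr hinj
    have t₂ := t₁.map_lieEquiv ψ
    refine PropertyP.of_map_lieEquiv ψ ?_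
    rw [h1, h2, h3] at t₂ ⊢
    simp only [tripleTestE7, Bool.and_eq_true] at htr
    have he := form_eq_one_of_isHomogE7 htr.1.1.1
    exact C.propertyP_of_topTestE7 (ip_simpleE7_nonneg_of_mem_distinguishedE7 _ hw) t₂
      (C.injOnCentralizer_of_injTestE7 he hinj) he htr.1.1.2 (topTestE7_of_mem_topDataE7 d hd)

end E7Frame

end Classification

/-- Distinguished non-regular nilpotent elements of the complex simple
Lie algebra of type corresponding to `LieAlgebra.e₇` satisfy property (P). -/
theorem propertyP_of_type_6
    (L : Type*) [LieRing L] [LieAlgebra ℂ L] [FiniteDimensional ℂ L]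
    [LieAlgebra.IsSimple ℂ L]
    (htype : Nonempty (L ≃ₗ⁅ℂ⁆ LieAlgebra.e₇ ℂ))
    (e h f : L) (ht : IsSl2Triple h e f) (he : IsNilpotent (LieAlgebra.ad ℂ L e))
    (hdist : IsDistinguished L e)
    (hnonreg : Module.finrank ℂ ↥(centralizer L e) ≠ LieAlgebra.rank ℂ L) :
    PropertyP L e h f := by
  obtain ⟨ι⟩ := htype
  obtain ⟨C⟩ := nonempty_E7Frame ι
  exact C.propertyP_of_injOnCentralizer ht fun x hx hx' =>
    hdist.eq_zero_of_lie_eq_zero ht hx hx'
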